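/- arXiv:1706.08330 — 2 statements merged into one kernel-verified Lean document; each statement's English description precedes it below -/
import Mathlib

section
/- Let G be a graph with exactly one end ω, and assume ω has finite vertex degree k. Let X be a finite set of vertices of G containing every vertex that dominates ω. If the graph G − X is connected, then the pointwise stabiliser of X in Aut(G) is either finite or contains at least 2^{ℵ₀} elements. -/
open Set Cardinal

namespace PaperEnds

/-- A ray in `G`: a one-sided infinite path, i.e. an injective sequence of
pairwise adjacent consecutive vertices. -/
def IsRay {V : Type} (G : SimpleGraph V) (r : ℕ → V) : Prop :=
  Function.Injective r ∧ ∀ n, G.Adj (r n) (r (n + 1))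

/-- `a` and `b` are connected by a walk avoiding the vertex set `S`. -/
def ReachableOutside {V : Type} (G : SimpleGraph V) (S : Set V) (a b : V) : Prop :=
  ∃ w : G.Walk a b, ∀ v ∈ w.support, v ∉ S

/-- Two rays are equivalent (belong to the same end) if for every finite vertex
set `S` they have tails lying in the same component of `G − S`. -/
def RayEquiv {V : Type} (G : SimpleGraph V) (r₁ r₂ : ℕ → V) : Prop :=
  ∀ S : Set V, S.Finite → ∃ m n : ℕ,
    (∀ i, m ≤ i → r₁ i ∉ S) ∧ (∀ j, n ≤ j → r₂ j ∉ S) ∧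
    ReachableOutside G S (r₁ m) (r₂ n)

/-- `r` is a ray belonging to the end represented by the ray `ω`. -/
def InEnd {V : Type} (G : SimpleGraph V) (ω r : ℕ → V) : Prop :=
  IsRay G r ∧ RayEquiv G r ω

/-- `G` has exactly one end: it has a ray and any two rays are equivalent. -/
def OneEnded {V : Type} (G : SimpleGraph V) : Prop :=
  (∃ r, IsRay G r) ∧ ∀ r₁ r₂, IsRay G r₁ → IsRay G r₂ → RayEquiv G r₁ r₂

/-- A family of pairwise (vertex-)disjoint rays. -/
def DisjointRays {V : Type} {ι : Type} (f : ι → ℕ → V) : Prop :=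
  Pairwise fun i j => Disjoint (Set.range (f i)) (Set.range (f j))

/-- The end represented by `ω` has vertex degree `k`: the maximum cardinality of a
family of pairwise disjoint rays belonging to the end is `k`. -/
def EndVertexDegree {V : Type} (G : SimpleGraph V) (ω : ℕ → V) (k : ℕ) : Prop :=
  (∃ f : Fin k → ℕ → V, (∀ i, InEnd G ω (f i)) ∧ DisjointRays f) ∧
  ¬ ∃ f : Fin (k + 1) → ℕ → V, (∀ i, InEnd G ω (f i)) ∧ DisjointRays f

/-- `v` dominates the end represented by `ω`: for every ray `r` in the end there are
infinitely many `v`–`r` paths pairwise meeting only in `v`. -/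
def Dominates {V : Type} (G : SimpleGraph V) (v : V) (ω : ℕ → V) : Prop :=
  ∀ r : ℕ → V, InEnd G ω r →
    ∃ (t : ℕ → ℕ) (P : (n : ℕ) → G.Walk v (r (t n))),
      Function.Injective t ∧
      (∀ n, (P n).IsPath) ∧
      (∀ n, ∀ u ∈ (P n).support, u ∈ Set.range r → u = r (t n)) ∧
      (∀ m n, m ≠ n → ∀ u, u ∈ (P m).support → u ∈ (P n).support → u = v)

/-- The end represented by `ω` is undominated. -/
def Undominated {V : Type} (G : SimpleGraph V) (ω : ℕ → V) : Prop :=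
  ¬ ∃ v, Dominates G v ω

/-- `(A, B)` is a separation of `G`. -/
def IsSeparation {V : Type} (G : SimpleGraph V) (A B : Set V) : Prop :=
  A ∪ B = Set.univ ∧ ∀ a ∈ A \ B, ∀ b ∈ B \ A, ¬ G.Adj a b

/-- The order of a separation `(A, B)`, i.e. `|A ∩ B|` as an extended natural number. -/
noncomputable def SepOrder {V : Type} (A B : Set V) : ℕ∞ := (A ∩ B).encard

/-- The end represented by `ω` lies in the side `B`: every ray of the end has all
but finitely many vertices in `B`. -/
def LiesIn {V : Type} (G : SimpleGraph V) (ω : ℕ → V) (B : Set V) : Prop :=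
  ∀ r, InEnd G ω r → ∃ m, ∀ n, m ≤ n → r n ∈ B

/-- The vertex set `s` is connected in `G` (any two of its vertices are joined by a
walk inside `s`). -/
def ConnectedIn {V : Type} (G : SimpleGraph V) (s : Set V) : Prop :=
  ∀ a ∈ s, ∀ b ∈ s, ∃ w : G.Walk a b, ∀ v ∈ w.support, v ∈ s

/-- `(A, B)` is an ω-relevant separation (for the end of vertex degree `k`
represented by the ray `ω`). -/
def Relevant {V : Type} (G : SimpleGraph V) (ω : ℕ → V) (k : ℕ) (A B : Set V) : Prop :=
  IsSeparation G A B ∧ SepOrder A B = (k : ℕ∞) ∧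
  ConnectedIn G (A \ B) ∧
  (∀ v ∈ A ∩ B, ∃ u ∈ A \ B, G.Adj v u) ∧
  LiesIn G ω B ∧
  ¬ ∃ C D : Set V, IsSeparation G C D ∧ SepOrder C D < (k : ℕ∞) ∧ A ⊆ C ∧ LiesIn G ω D

/-- Two separations `(A, B)` and `(C, D)` are nested. -/
def Nested {V : Type} (A B C D : Set V) : Prop :=
  (A ⊆ C ∧ D ⊆ B) ∨ (A ⊆ D ∧ C ⊆ B) ∨ (B ⊆ C ∧ D ⊆ A) ∨ (B ⊆ D ∧ C ⊆ A)



/-- reachability inside `U` -/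
def RIn {V : Type} (G : SimpleGraph V) (U : Set V) (a b : V) : Prop :=
  Relation.ReflTransGen (fun x y => G.Adj x y ∧ x ∈ U ∧ y ∈ U) a b

def Conn {V : Type} (G : SimpleGraph V) (U : Set V) : Prop :=
  ∀ a ∈ U, ∀ b ∈ U, RIn G U a b

def cmp {V : Type} (G : SimpleGraph V) (U : Set V) (a : V) : Set V :=
  {b | b ∈ U ∧ RIn G U a b}

/-- outer vertex boundary inside `M` -/
def NB {V : Type} (G : SimpleGraph V) (M C : Set V) : Set V :=
  {v | v ∈ M ∧ v ∉ C ∧ ∃ u ∈ C, G.Adj u v}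

section basics
variable {V : Type} {G : SimpleGraph V}

lemma RIn.refl {U : Set V} (a : V) : RIn G U a a := Relation.ReflTransGen.refl

lemma RIn.trans {U : Set V} {a b c : V} (h : RIn G U a b) (h' : RIn G U b c) : RIn G U a c :=
  Relation.ReflTransGen.trans h h'

lemma RIn.symm {U : Set V} {a b : V} (h : RIn G U a b) : RIn G U b a := by
  induction h with
  | refl => exact RIn.refl _
  | tail _ h ih => exact Relation.ReflTransGen.head ⟨h.1.symm, h.2.2, h.2.1⟩ ih

lemma RIn.single {U : Set V} {a b : V} (h : G.Adj a b) (ha : a ∈ U) (hb : b ∈ U) : RIn G U a b :=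
  Relation.ReflTransGen.single ⟨h, ha, hb⟩

lemma RIn.mono {U W : Set V} {a b : V} (h : RIn G U a b) (hUW : U ⊆ W) : RIn G W a b := by
  induction h with
  | refl => exact RIn.refl _
  | tail _ h ih => exact Relation.ReflTransGen.tail ih ⟨h.1, hUW h.2.1, hUW h.2.2⟩

lemma RIn.mem {U : Set V} {a b : V} (h : RIn G U a b) (ha : a ∈ U) : b ∈ U := by
  induction h with
  | refl => exact ha
  | tail _ h _ => exact h.2.2

/-- a set closed under the steps is preserved -/
lemma RIn.closed {U T : Set V} {a b : V} (h : RIn G U a b) (ha : a ∈ T)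
    (hT : ∀ x ∈ T, ∀ y ∈ U, x ∈ U → G.Adj x y → y ∈ T) : b ∈ T := by
  induction h with
  | refl => exact ha
  | tail _ h ih => exact hT _ ih _ h.2.2 h.2.1 h.1

/-- first exit from `T` -/
lemma RIn.exit {U T : Set V} {a b : V} (h : RIn G U a b) (_haU : a ∈ U) (ha : a ∈ T) (hb : b ∉ T) :
    ∃ x y, x ∈ T ∧ y ∉ T ∧ x ∈ U ∧ y ∈ U ∧ G.Adj x y ∧ RIn G (U ∩ T) a x := by
  induction h with
  | refl => exact absurd ha hb
  | @tail c d hac h ih =>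
    by_cases hc : c ∈ T
    · by_cases hR : RIn G (U ∩ T) a c
      · exact ⟨c, d, hc, hb, h.2.1, h.2.2, h.1, hR⟩
      · -- some exit earlier
        clear ih
        by_contra hcon
        push Not at hcon
        apply hR
        have : c ∈ {z | RIn G (U ∩ T) a z ∧ z ∈ T} := by
          refine RIn.closed (G := G) (U := U) hac ⟨RIn.refl _, ha⟩ ?_
          rintro x ⟨hx1, hx2⟩ y hy hxU hxy
          by_cases hyT : y ∈ T
          · exact ⟨hx1.trans (RIn.single hxy ⟨hxU, hx2⟩ ⟨hy, hyT⟩), hyT⟩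
          · exact absurd hx1 (hcon x y hx2 hyT hxU hy hxy)
        exact this.1
    · exact ih hc

lemma cmp_sub {U : Set V} {a : V} : cmp G U a ⊆ U := fun _ h => h.1

lemma mem_cmp_self {U : Set V} {a : V} (ha : a ∈ U) : a ∈ cmp G U a := ⟨ha, RIn.refl _⟩

lemma cmp_adj {U : Set V} {a x y : V} (hx : x ∈ cmp G U a) (hy : y ∈ U) (h : G.Adj x y) :
    y ∈ cmp G U a := ⟨hy, hx.2.trans (RIn.single h hx.1 hy)⟩

lemma rin_cmp {U : Set V} {a b : V} (ha : a ∈ U) (h : RIn G U a b) : RIn G (cmp G U a) a b := by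
  have : b ∈ {z | RIn G (cmp G U a) a z ∧ z ∈ cmp G U a} := by
    refine RIn.closed h ⟨RIn.refl _, mem_cmp_self ha⟩ ?_
    rintro x ⟨hx1, hx2⟩ y hy hxU hxy
    have := cmp_adj hx2 hy hxy
    exact ⟨hx1.trans (RIn.single hxy hx2 this), this⟩
  exact this.1

lemma conn_cmp {U : Set V} {a : V} : Conn G (cmp G U a) := by
  by_cases ha : a ∈ U
  · intro x hx y hy
    exact (rin_cmp ha hx.2).symm.trans (rin_cmp ha hy.2)
  · intro x hx
    exact absurd (hx.2.symm.mem hx.1) ha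

lemma Conn.sub_cmp {U T : Set V} {a : V} (hT : Conn G T) (hTU : T ⊆ U) (ha : a ∈ T) :
    T ⊆ cmp G U a := fun x hx => ⟨hTU hx, (hT a ha x hx).mono hTU⟩

lemma cmp_eq_of_mem {U : Set V} {a b : V} (h : b ∈ cmp G U a) : cmp G U b = cmp G U a := by
  ext x
  exact ⟨fun hx => ⟨hx.1, h.2.trans hx.2⟩, fun hx => ⟨hx.1, h.2.symm.trans hx.2⟩⟩

lemma cmp_mono {U T : Set V} (h : U ⊆ T) (a : V) : cmp G U a ⊆ cmp G T a :=
  fun _ hx => ⟨h hx.1, hx.2.mono h⟩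

lemma Conn.union {C D : Set V} (hC : Conn G C) (hD : Conn G D) {x : V} (hxC : x ∈ C) (hxD : x ∈ D) :
    Conn G (C ∪ D) := by
  have key : ∀ a ∈ C ∪ D, RIn G (C ∪ D) a x := by
    rintro a (ha | ha)
    · exact (hC a ha x hxC).mono subset_union_left
    · exact (hD a ha x hxD).mono subset_union_right
  intro a ha b hb
  exact (key a ha).trans (key b hb).symm

lemma conn_of_base {C : Set V} {x : V} (h : ∀ a ∈ C, RIn G C a x) : Conn G C :=
  fun a ha b hb => (h a ha).trans (h b hb).symm

/-- connected set meeting `C` and avoiding its boundary stays in `C`. -/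
lemma Conn.sub_of_avoid {M C D : Set V} (hD : Conn G D) (hDM : D ⊆ M) {x : V} (hx : x ∈ D) (hxC : x ∈ C)
    (hav : ∀ v ∈ D, v ∉ NB G M C) : D ⊆ C := by
  intro y hy
  by_contra hyC
  obtain ⟨a, b, ha, hb, haD, hbD, hab, -⟩ := (hD x hx y hy).exit hx hxC hyC
  exact hav b hbD ⟨hDM hbD, hb, a, ha, hab⟩

lemma RIn.finite_path {U : Set V} {a b : V} (h : RIn G U a b) (ha : a ∈ U) :
    ∃ J : Set V, J.Finite ∧ J ⊆ U ∧ Conn G J ∧ a ∈ J ∧ b ∈ J := by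
  induction h with
  | refl => exact ⟨{a}, finite_singleton _, by simpa using ha,
      by rintro x rfl y rfl; exact RIn.refl _, rfl, rfl⟩
  | @tail c d hac h ih =>
    obtain ⟨J, hJ, hJU, hJc, haJ, hcJ⟩ := ih
    refine ⟨insert d J, hJ.insert d, ?_, ?_, mem_insert_of_mem _ haJ, mem_insert _ _⟩
    · exact insert_subset h.2.2 hJU
    · refine conn_of_base (x := c) ?_
      rintro x (rfl | hx)
      · exact RIn.single h.1.symm (mem_insert _ _) (mem_insert_of_mem _ hcJ)
      · exact (hJc x hx c hcJ).mono (subset_insert _ _)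

lemma Conn.finite_conn {U F : Set V} (hU : Conn G U) (hF : F.Finite) (hFU : F ⊆ U) :
    ∃ J : Set V, J.Finite ∧ J ⊆ U ∧ Conn G J ∧ F ⊆ J := by
  rcases F.eq_empty_or_nonempty with rfl | ⟨a, ha⟩
  · exact ⟨∅, finite_empty, empty_subset _, by intro x hx; exact absurd hx (by simp), subset_rfl⟩
  · have : ∀ b ∈ F, ∃ J : Set V, J.Finite ∧ J ⊆ U ∧ Conn G J ∧ a ∈ J ∧ b ∈ J := fun b hb =>
      (hU a (hFU ha) b (hFU hb)).finite_path (hFU ha)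
    choose! J h1 h2 h3 h4 h5 using this
    refine ⟨⋃ b ∈ F, J b, hF.biUnion h1, iUnion₂_subset h2, ?_, ?_⟩
    · refine conn_of_base (x := a) ?_
      intro x hx
      simp only [mem_iUnion] at hx
      obtain ⟨b, hb, hx⟩ := hx
      exact (h3 b hb x hx a (h4 b hb)).mono (subset_biUnion_of_mem (u := J) hb)
    · intro b hb
      exact mem_biUnion hb (h5 b hb)

lemma NB_sub_M {M C : Set V} : NB G M C ⊆ M := fun _ h => h.1

lemma NB_mono_closure {M C D : Set V} (h : C ⊆ D) : NB G M C ⊆ D ∪ NB G M D := by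
  rintro v ⟨hv, hvC, u, hu, huv⟩
  by_cases hvD : v ∈ D
  · exact Or.inl hvD
  · exact Or.inr ⟨hv, hvD, u, h hu, huv⟩

/-- leaving a vertex for the last time -/
lemma RIn.leave {U : Set V} {v x : V} (h : RIn G U v x) (hne : x ≠ v) :
    ∃ w, G.Adj v w ∧ w ∈ U \ {v} ∧ RIn G (U \ {v}) w x := by
  induction h with
  | refl => exact absurd rfl hne
  | @tail c d hac h ih =>
    by_cases hc : c = v
    · subst hc
      exact ⟨d, h.1, ⟨h.2.2, hne⟩, RIn.refl _⟩
    · obtain ⟨w, h1, h2, h3⟩ := ih hc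
      exact ⟨w, h1, h2, h3.trans (RIn.single h.1 ⟨h.2.1, hc⟩ ⟨h.2.2, hne⟩)⟩

/-- Producing a ray. -/
lemma exists_ray {U : Set V} (x : ℕ → V) (hx : ∀ j, x j ∈ U)
    (h0 : ∀ j, RIn G U (x j) (x (j+1)))
    (h : ∀ S : Set V, S.Finite → ∃ J, ∀ j, J ≤ j → x j ∉ S ∧ RIn G (U \ S) (x j) (x (j+1))) :
    ∃ r, IsRay G r ∧ ∀ n, r n ∈ U := by
  classical
  -- states
  let St := {p : V × Finset V // p.1 ∈ U \ (p.2 : Set V) ∧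
      ∃ J, ∀ j, J ≤ j → RIn G (U \ (p.2 : Set V)) p.1 (x j)}
  have step : ∀ s : St, ∃ t : St, G.Adj s.1.1 t.1.1 ∧ t.1.2 = insert s.1.1 s.1.2 := by
    rintro ⟨⟨v, S⟩, hv, J, hJ⟩
    simp only at hv hJ
    obtain ⟨J', hJ'⟩ := h (insert v S : Finset V) (Finset.finite_toSet _)
    have hmem : x (max J J') ∉ ((insert v S : Finset V) : Set V) := (hJ' _ (le_max_right _ _)).1
    have hne : x (max J J') ≠ v := by
      rintro e; apply hmem; simp [e]
    obtain ⟨w, h1, h2, h3⟩ := (hJ _ (le_max_left J J')).leave hne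
    have hset : (U \ (S : Set V)) \ {v} = U \ ((insert v S : Finset V) : Set V) := by
      ext z; simp; tauto
    rw [hset] at h2 h3
    refine ⟨⟨⟨w, insert v S⟩, h2, max J J', ?_⟩, h1, rfl⟩
    intro j hj
    induction j, hj using Nat.le_induction with
    | base => exact h3
    | succ j hj ih => exact ih.trans (hJ' j (le_trans (le_max_right _ _) hj)).2
  choose nx hnx1 hnx2 using step
  have base : St := ⟨⟨x 0, ∅⟩, by simpa using hx 0, 0, by
    intro j _
    simp only [Finset.coe_empty, sdiff_empty]
    induction j with
    | zero => exact RIn.refl _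
    | succ j ih => exact (ih (Nat.zero_le _)).trans (h0 j)⟩
  let s : ℕ → St := fun n => Nat.rec base (fun _ t => nx t) n
  have hs : ∀ n, s (n+1) = nx (s n) := fun n => rfl
  have hin : ∀ m n, m < n → (s m).1.1 ∈ (s n).1.2 := by
    intro m n hmn
    induction n, hmn using Nat.le_induction with
    | base => rw [hs, hnx2]; simp
    | succ n hn ih => rw [hs, hnx2]; simp [ih]
  refine ⟨fun n => (s n).1.1, ⟨?_, fun n => hnx1 (s n)⟩, fun n => (s n).2.1.1⟩
  intro m n hmn
  simp only at hmn
  rcases lt_trichotomy m n with h | h | h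
  · exact absurd (hmn ▸ hin m n h) (s n).2.1.2
  · exact h
  · exact absurd (hmn ▸ hin n m h) (s m).2.1.2

end basics


/-- adjacency preserving permutations moving only vertices of `Z` -/
def Gam {V : Type} (G : SimpleGraph V) (Z : Set V) : Subgroup (Equiv.Perm V) where
  carrier := {g | (∀ a b, G.Adj (g a) (g b) ↔ G.Adj a b) ∧ ∀ v, v ∉ Z → g v = v}
  mul_mem' := by
    rintro g h ⟨hg1, hg2⟩ ⟨hh1, hh2⟩
    refine ⟨fun a b => ?_, fun v hv => ?_⟩
    · rw [Equiv.Perm.mul_apply, Equiv.Perm.mul_apply, hg1, hh1]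
    · rw [Equiv.Perm.mul_apply, hh2 v hv, hg2 v hv]
  one_mem' := ⟨fun _ _ => Iff.rfl, fun _ _ => rfl⟩
  inv_mem' := by
    rintro g ⟨hg1, hg2⟩
    refine ⟨fun a b => ?_, fun v hv => ?_⟩
    · rw [← hg1]; simp
    · rw [Equiv.Perm.inv_eq_iff_eq]; exact (hg2 v hv).symm

section gam
variable {V : Type} {G : SimpleGraph V}

lemma Gam.adj {Z : Set V} {g : Equiv.Perm V} (h : g ∈ Gam G Z) (a b : V) :
    G.Adj (g a) (g b) ↔ G.Adj a b := h.1 a b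

lemma Gam.fix {Z : Set V} {g : Equiv.Perm V} (h : g ∈ Gam G Z) {v : V} (hv : v ∉ Z) : g v = v := h.2 v hv

lemma Gam_mono {Z W : Set V} (h : Z ⊆ W) : Gam G Z ≤ Gam G W :=
  fun _ hg => ⟨hg.1, fun v hv => hg.2 v (fun hz => hv (h hz))⟩

lemma Gam.mem_iff {Z : Set V} {g : Equiv.Perm V} (h : g ∈ Gam G Z) (x : V) : g x ∈ Z ↔ x ∈ Z := by
  constructor
  · intro hx
    by_contra hc
    rw [Gam.fix h hc] at hx
    exact hc hx
  · intro hx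
    by_contra hc
    have := Gam.fix h hc
    rw [EmbeddingLike.apply_eq_iff_eq] at this
    rw [this] at hc
    exact hc hx

lemma Gam.image_eq {Z : Set V} {g : Equiv.Perm V} (h : g ∈ Gam G Z) : g '' Z = Z := by
  ext x
  constructor
  · rintro ⟨y, hy, rfl⟩
    exact (Gam.mem_iff h y).2 hy
  · intro hx
    exact ⟨g⁻¹ x, (Gam.mem_iff (inv_mem h) x).2 hx, by simp⟩

lemma RIn.map {g : Equiv.Perm V} (hg : ∀ a b, G.Adj (g a) (g b) ↔ G.Adj a b) {U : Set V} {a b : V}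
    (h : RIn G U a b) : RIn G (g '' U) (g a) (g b) := by
  induction h with
  | refl => exact RIn.refl _
  | tail _ h ih =>
    exact ih.trans (RIn.single ((hg _ _).2 h.1) (mem_image_of_mem _ h.2.1) (mem_image_of_mem _ h.2.2))

lemma Conn.map {g : Equiv.Perm V} (hg : ∀ a b, G.Adj (g a) (g b) ↔ G.Adj a b) {U : Set V}
    (h : Conn G U) : Conn G (g '' U) := by
  rintro _ ⟨a, ha, rfl⟩ _ ⟨b, hb, rfl⟩
  exact (h a ha b hb).map hg

lemma adj_inv {g : Equiv.Perm V} (hg : ∀ a b, G.Adj (g a) (g b) ↔ G.Adj a b) :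
    ∀ a b, G.Adj (g⁻¹ a) (g⁻¹ b) ↔ G.Adj a b := by
  intro a b
  rw [← hg]; simp

lemma image_inv_image {g : Equiv.Perm V} (U : Set V) : (⇑g⁻¹) '' (g '' U) = U := by
  ext x; simp

lemma image_image_inv {g : Equiv.Perm V} (U : Set V) : g '' ((⇑g⁻¹) '' U) = U := by
  ext x; simp

lemma cmp_map {g : Equiv.Perm V} (hg : ∀ a b, G.Adj (g a) (g b) ↔ G.Adj a b) (U : Set V) (a : V) :
    g '' (cmp G U a) = cmp G (g '' U) (g a) := by
  ext x
  constructor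
  · rintro ⟨y, hy, rfl⟩
    exact ⟨mem_image_of_mem _ hy.1, hy.2.map hg⟩
  · rintro ⟨⟨y, hy, rfl⟩, hx⟩
    refine ⟨y, ⟨hy, ?_⟩, rfl⟩
    have := hx.map (adj_inv hg)
    rw [image_inv_image] at this
    simpa using this

/-- restriction of an automorphism to an invariant set with fixed boundary -/
lemma restrict {g : Equiv.Perm V} (hg : ∀ a b, G.Adj (g a) (g b) ↔ G.Adj a b) {C : Set V}
    (hC : ∀ x, g x ∈ C ↔ x ∈ C) (hfix : ∀ v, v ∉ C → (∃ u ∈ C, G.Adj u v) → g v = v) :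
    ∃ h ∈ Gam G C, ∀ x ∈ C, h x = g x := by
  classical
  let h : Equiv.Perm V := Equiv.Perm.ofSubtype (g.subtypePerm (p := fun x => x ∈ C) hC)
  have h1 : ∀ x ∈ C, h x = g x := by
    intro x hx
    simp [h, Equiv.Perm.ofSubtype_apply_of_mem _ hx]
  have h2 : ∀ x, x ∉ C → h x = x := by
    intro x hx
    simp [h, Equiv.Perm.ofSubtype_apply_of_not_mem _ hx]
  have mixed : ∀ a ∈ C, ∀ b, b ∉ C → (G.Adj (g a) b ↔ G.Adj a b) := by
    intro a ha b hb
    constructor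
    · intro hab
      have := hfix b hb ⟨g a, (hC a).2 ha, hab⟩
      rw [← this, hg] at hab
      exact hab
    · intro hab
      have := hfix b hb ⟨a, ha, hab⟩
      rw [← this, hg]
      exact hab
  refine ⟨h, ⟨fun a b => ?_, h2⟩, h1⟩
  by_cases ha : a ∈ C <;> by_cases hb : b ∈ C
  · rw [h1 a ha, h1 b hb, hg]
  · rw [h1 a ha, h2 b hb, mixed a ha b hb]
  · rw [h2 a ha, h1 b hb, G.adj_comm, mixed b hb a ha, G.adj_comm]
  · rw [h2 a ha, h2 b hb]

/-- finite index argument -/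
lemma finite_of_fibers (P : Subgroup (Equiv.Perm V)) {T : Type} [Finite T] (f : Equiv.Perm V → T)
    {K : Set (Equiv.Perm V)} (hK : K.Finite)
    (h : ∀ g ∈ P, ∀ g₀ ∈ P, f g = f g₀ → g₀⁻¹ * g ∈ K) : (P : Set (Equiv.Perm V)).Finite := by
  classical
  have key : ∀ t : T, {g | g ∈ P ∧ f g = t}.Finite := by
    intro t
    by_cases ht : ∃ g₀ ∈ P, f g₀ = t
    · obtain ⟨g₀, hg₀, rfl⟩ := ht
      refine (hK.image (fun x => g₀ * x)).subset ?_
      rintro g ⟨hg, hfg⟩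
      exact ⟨g₀⁻¹ * g, h g hg g₀ hg₀ hfg, by simp⟩
    · push Not at ht
      convert Set.finite_empty (α := Equiv.Perm V)
      ext g
      simp only [mem_setOf_eq, mem_empty_iff_false, iff_false, not_and]
      exact fun hg => ht g hg
  refine (Set.finite_iUnion key).subset ?_
  intro g hg
  exact mem_iUnion.2 ⟨f g, hg, rfl⟩

lemma finite_of_stab (P : Subgroup (Equiv.Perm V)) {S : Set V} (hS : S.Finite)
    (hinv : ∀ g ∈ P, ∀ s ∈ S, g s ∈ S)
    (hK : {g | g ∈ P ∧ ∀ s ∈ S, g s = s}.Finite) : (P : Set (Equiv.Perm V)).Finite := by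
  classical
  have : Finite S := hS
  refine finite_of_fibers P (T := S → Option S)
    (fun g s => if h : g s ∈ S then some ⟨g s, h⟩ else none) hK ?_
  intro g hg g₀ hg₀ he
  refine ⟨mul_mem (inv_mem hg₀) hg, fun s hs => ?_⟩
  have := congrFun he ⟨s, hs⟩
  simp only [hinv g hg s hs, hinv g₀ hg₀ s hs, dif_pos, Option.some.injEq, Subtype.mk.injEq] at this
  rw [Equiv.Perm.mul_apply, this]; simp

/-- partial products -/
def pprod (g : ℕ → Equiv.Perm V) (T : ℕ → Bool) : ℕ → Equiv.Perm V
  | 0 => 1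
  | n+1 => pprod g T n * (if T n then g n else 1)

lemma infinite_product {Z : Set V} (g : ℕ → Equiv.Perm V) (hg : ∀ n, g n ∈ Gam G Z)
    (B : ℕ → Set V) (hmono : Monotone B) (hcov : ∀ v, ∃ n, v ∈ B n)
    (hfix : ∀ n, ∀ v ∈ B n, g n v = v) (hmov : ∀ n, ∃ v ∈ B (n+1), g n v ≠ v)
    (hback : ∀ T m, ∀ v ∈ B m, (pprod g T (m+1))⁻¹ v ∈ B (m+1)) :
    𝔠 ≤ #(Gam G Z) := by
  classical
  have hp : ∀ T n, pprod g T n ∈ Gam G Z := by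
    intro T n
    induction n with
    | zero => exact one_mem _
    | succ n ih =>
      refine mul_mem ih ?_
      split_ifs
      · exact hg n
      · exact one_mem _
  have hstab : ∀ T n v, v ∈ B n → ∀ m, n ≤ m → pprod g T m v = pprod g T n v := by
    intro T n v hv m hm
    induction m, hm using Nat.le_induction with
    | base => rfl
    | succ m hm ih =>
      rw [← ih, pprod, Equiv.Perm.mul_apply]
      congr 1
      split_ifs
      · exact hfix m v (hmono hm hv)
      · rfl
  let N : V → ℕ := fun v => Classical.choose (hcov v)
  have hN : ∀ v, v ∈ B (N v) := fun v => Classical.choose_spec (hcov v)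
  let L : (ℕ → Bool) → V → V := fun T v => pprod g T (N v) v
  have hL : ∀ T n v, v ∈ B n → L T v = pprod g T n v := by
    intro T n v hv
    rcases le_total n (N v) with h | h
    · exact hstab T n v hv _ h
    · exact (hstab T (N v) v (hN v) _ h).symm
  have hL2 : ∀ T v w, ∃ n, L T v = pprod g T n v ∧ L T w = pprod g T n w := by
    intro T v w
    exact ⟨max (N v) (N w), hL _ _ _ (hmono (le_max_left _ _) (hN v)),
      hL _ _ _ (hmono (le_max_right _ _) (hN w))⟩
  have hbij : ∀ T, Function.Bijective (L T) := by
    intro T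
    constructor
    · intro v w hvw
      obtain ⟨n, h1, h2⟩ := hL2 T v w
      rw [h1, h2] at hvw
      exact (pprod g T n).injective hvw
    · intro v
      refine ⟨(pprod g T (N v + 1))⁻¹ v, ?_⟩
      rw [hL T _ _ (hback T (N v) v (hN v))]
      simp
  let φ : (ℕ → Bool) → Gam G Z := fun T => ⟨Equiv.ofBijective (L T) (hbij T), by
    refine ⟨fun a b => ?_, fun v hv => ?_⟩
    · simp only [Equiv.ofBijective_apply]
      obtain ⟨n, h1, h2⟩ := hL2 T a b
      rw [h1, h2]
      exact (hp T n).1 a b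
    · simp only [Equiv.ofBijective_apply]
      exact (hp T (N v)).2 v hv⟩
  have hφ : Function.Injective φ := by
    intro T T' hTT
    have hLL : ∀ v, L T v = L T' v := by
      intro v
      have := congrArg (fun x : Gam G Z => (x : Equiv.Perm V) v) hTT
      simpa [φ] using this
    have hall : ∀ n, pprod g T n = pprod g T' n ∧ ∀ m < n, T m = T' m := by
      intro n
      induction n with
      | zero => exact ⟨rfl, by simp⟩
      | succ n ih =>
        obtain ⟨v, hv, hgv⟩ := hmov n
        have e := hLL v
        rw [hL T _ v hv, hL T' _ v hv, pprod, pprod, ih.1, Equiv.Perm.mul_apply,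
          Equiv.Perm.mul_apply, EmbeddingLike.apply_eq_iff_eq] at e
        have : T n = T' n := by
          cases h1 : T n <;> cases h2 : T' n <;> simp [h1, h2] at e ⊢
          · exact hgv e.symm
          · exact hgv e
        refine ⟨by rw [pprod, pprod, ih.1, this], ?_⟩
        intro m hm
        rcases Nat.lt_succ_iff_lt_or_eq.1 hm with h | h
        · exact ih.2 m h
        · rw [h]; exact this
    ext n
    rw [(hall (n+1)).2 n (Nat.lt_succ_self n)]
  have := Cardinal.mk_le_of_injective hφ
  simpa using this

lemma continuum_of_disjoint {Z : Set V} (g : ℕ → Equiv.Perm V) (hg : ∀ n, g n ∈ Gam G Z)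
    (hne : ∀ n, g n ≠ 1) (hd : ∀ m n, m ≠ n → (g m).Disjoint (g n)) : 𝔠 ≤ #(Gam G Z) := by
  have hmove : ∀ v m n, g m v ≠ v → m ≠ n → g n v = v := by
    intro v m n h1 h2
    exact (hd m n h2 v).resolve_left h1
  refine infinite_product g hg (fun m => {v | ∀ n, m ≤ n → g n v = v}) ?_ ?_ ?_ ?_ ?_
  · intro m n hmn v hv i hi
    exact hv i (hmn.trans hi)
  · intro v
    by_cases h : ∃ m, g m v ≠ v
    · obtain ⟨m, hm⟩ := h
      exact ⟨m+1, fun n hn => hmove v m n hm (by omega)⟩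
    · push Not at h
      exact ⟨0, fun n _ => h n⟩
  · intro n v hv
    exact hv n le_rfl
  · intro n
    have : ∃ v, g n v ≠ v := by
      by_contra hc
      push Not at hc
      exact hne n (Equiv.ext hc)
    obtain ⟨v, hv⟩ := this
    exact ⟨v, fun i hi => hmove v n i hv (by omega), hv⟩
  · intro T m v hv n hn
    have hcomm : ∀ j, j ≤ m+1 → Commute (g n) (pprod g T j) := by
      intro j hj
      induction j with
      | zero => exact Commute.one_right _
      | succ j ih =>
        refine Commute.mul_right (ih (by omega)) ?_
        split_ifs
        · exact (hd n j (by omega)).commute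
        · exact Commute.one_right _
    have h1 := (hcomm (m+1) le_rfl).inv_right
    have h2 := congrArg (fun p : Equiv.Perm V => p v) h1.eq
    simp only [Equiv.Perm.mul_apply] at h2
    rw [h2, hv n (by omega)]

lemma cont_mono {Z W : Set V} (h : Z ⊆ W) (hZ : 𝔠 ≤ #(Gam G Z)) : 𝔠 ≤ #(Gam G W) :=
  hZ.trans (Cardinal.mk_le_of_injective (Subgroup.inclusion_injective (Gam_mono h)))

end gam


def FC {V : Type} (G : SimpleGraph V) (Z : Set V) : Prop :=
  (Gam G Z : Set (Equiv.Perm V)).Finite ∨ 𝔠 ≤ #(Gam G Z)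

/-- the set of components -/
def Cp {V : Type} (G : SimpleGraph V) (Y : Set V) : Set (Set V) :=
  {Q | ∃ y ∈ Y, Q = cmp G Y y}

section comps
variable {V : Type} {G : SimpleGraph V} {Y : Set V}

lemma Cp.sub {Q : Set V} (h : Q ∈ Cp G Y) : Q ⊆ Y := by
  obtain ⟨y, hy, rfl⟩ := h; exact cmp_sub

lemma Cp.nonempty {Q : Set V} (h : Q ∈ Cp G Y) : Q.Nonempty := by
  obtain ⟨y, hy, rfl⟩ := h; exact ⟨y, mem_cmp_self hy⟩

lemma Cp.eq {Q Q' : Set V} (h : Q ∈ Cp G Y) (h' : Q' ∈ Cp G Y) {x : V} (hx : x ∈ Q) (hx' : x ∈ Q') :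
    Q = Q' := by
  obtain ⟨y, hy, rfl⟩ := h
  obtain ⟨y', hy', rfl⟩ := h'
  rw [← cmp_eq_of_mem hx, ← cmp_eq_of_mem hx']

lemma Cp.adj {Q : Set V} (h : Q ∈ Cp G Y) {x y : V} (hx : x ∈ Q) (hy : y ∈ Y) (hxy : G.Adj x y) :
    y ∈ Q := by
  obtain ⟨z, hz, rfl⟩ := h; exact cmp_adj hx hy hxy

lemma Cp.mk' {y : V} (hy : y ∈ Y) : cmp G Y y ∈ Cp G Y := ⟨y, hy, rfl⟩

lemma Cp.image {Q : Set V} (h : Q ∈ Cp G Y) {g : Equiv.Perm V} (hg : g ∈ Gam G Y) :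
    g '' Q ∈ Cp G Y := by
  obtain ⟨y, hy, rfl⟩ := h
  refine ⟨g y, (Gam.mem_iff hg y).2 hy, ?_⟩
  rw [cmp_map hg.1, Gam.image_eq hg]

lemma Cp.swap {Q Q' : Set V} (hQ : Q ∈ Cp G Y) (hQ' : Q' ∈ Cp G Y) (hne : Q ≠ Q')
    {g : Equiv.Perm V} (hg : g ∈ Gam G Y) (hgQ : g '' Q = Q') :
    ∃ h ∈ Gam G Y, h ≠ 1 ∧ ∀ v, v ∉ Q → v ∉ Q' → h v = v := by
  classical
  let s : V → V := fun v => if v ∈ Q then g v else if v ∈ Q' then g⁻¹ v else v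
  have hdis : ∀ v ∈ Q, v ∉ Q' := fun v h h' => hne (Cp.eq hQ hQ' h h')
  have s1 : ∀ v ∈ Q, s v = g v := fun v h => if_pos h
  have s2 : ∀ v ∈ Q', s v = g⁻¹ v := fun v h => by
    have : v ∉ Q := fun h' => hdis v h' h
    simp [s, this, h]
  have s3 : ∀ v, v ∉ Q → v ∉ Q' → s v = v := fun v h h' => by simp [s, h, h']
  have m1 : ∀ v ∈ Q, g v ∈ Q' := fun v h => hgQ ▸ mem_image_of_mem _ h
  have m2 : ∀ v ∈ Q', g⁻¹ v ∈ Q := fun v h => by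
    rw [← hgQ] at h
    obtain ⟨u, hu, rfl⟩ := h
    simpa using hu
  have hinv : Function.Involutive s := by
    intro v
    by_cases h : v ∈ Q
    · rw [s1 v h, s2 _ (m1 v h)]; simp
    · by_cases h' : v ∈ Q'
      · rw [s2 v h', s1 _ (m2 v h')]; simp
      · rw [s3 v h h', s3 v h h']
  have hadj : ∀ a b, G.Adj a b → G.Adj (s a) (s b) := by
    have c1 : ∀ a ∈ Q, ∀ b, G.Adj a b → G.Adj (s a) (s b) := by
      intro a ha b hab
      have : s b = g b := by
        by_cases hb : b ∈ Y
        · exact s1 b (Cp.adj hQ ha hb hab)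
        · rw [Gam.fix hg hb, s3 b (fun h => hb (Cp.sub hQ h)) (fun h => hb (Cp.sub hQ' h))]
      rw [this, s1 a ha, hg.1]; exact hab
    have c2 : ∀ a ∈ Q', ∀ b, G.Adj a b → G.Adj (s a) (s b) := by
      intro a ha b hab
      have : s b = g⁻¹ b := by
        by_cases hb : b ∈ Y
        · exact s2 b (Cp.adj hQ' ha hb hab)
        · rw [Gam.fix (inv_mem hg) hb, s3 b (fun h => hb (Cp.sub hQ h)) (fun h => hb (Cp.sub hQ' h))]
      rw [this, s2 a ha, (inv_mem hg : g⁻¹ ∈ Gam G Y).1]; exact hab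
    intro a b hab
    by_cases ha : a ∈ Q
    · exact c1 a ha b hab
    by_cases ha' : a ∈ Q'
    · exact c2 a ha' b hab
    by_cases hb : b ∈ Q
    · exact (c1 b hb a hab.symm).symm
    by_cases hb' : b ∈ Q'
    · exact (c2 b hb' a hab.symm).symm
    rw [s3 a ha ha', s3 b hb hb']; exact hab
  refine ⟨hinv.toPerm, ⟨fun a b => ⟨fun h => ?_, fun h => hadj a b h⟩, fun v hv => ?_⟩, ?_, s3⟩
  · have := hadj _ _ h
    simpa [Function.Involutive.coe_toPerm, hinv a, hinv b] using this
  · exact s3 v (fun h => hv (Cp.sub hQ h)) (fun h => hv (Cp.sub hQ' h))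
  · intro e
    obtain ⟨v, hv⟩ := Cp.nonempty hQ
    have : s v = v := congrArg (fun p : Equiv.Perm V => p v) e
    rw [s1 v hv] at this
    exact hdis v hv (this ▸ m1 v hv)

lemma comps_dichotomy (h : ∀ y ∈ Y, FC G (cmp G Y y)) : FC G Y := by
  classical
  by_cases hc : 𝔠 ≤ #(Gam G Y)
  · exact Or.inr hc
  left
  have hfinQ : ∀ Q ∈ Cp G Y, (Gam G Q : Set (Equiv.Perm V)).Finite := by
    rintro Q ⟨y, hy, rfl⟩
    exact (h y hy).resolve_right (fun h' => hc (cont_mono cmp_sub h'))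
  let P : Equiv.Perm V → Prop := fun g => g ∈ Gam G Y ∧ g ≠ 1 ∧
    ∃ F : Set (Set V), F.Finite ∧ ∀ v, g v ≠ v → ∃ Q ∈ F, Q ∈ Cp G Y ∧ v ∈ Q
  have hT : ∃ T : Set (Set V), T.Finite ∧ ∀ g, P g → ∃ Q ∈ T, Q ∈ Cp G Y ∧ ∃ v ∈ Q, g v ≠ v := by
    by_contra hcon
    push Not at hcon
    apply hc
    obtain ⟨f, hf1, hf2⟩ := exists_seq_of_forall_finset_exists P (fun a b => a.Disjoint b) (by
      intro s hs
      have : ∀ g ∈ s, ∃ F : Set (Set V), F.Finite ∧ ∀ v, g v ≠ v → ∃ Q ∈ F, Q ∈ Cp G Y ∧ v ∈ Q :=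
        fun g hg => (hs g hg).2.2
      choose! F hF1 hF2 using this
      obtain ⟨g, hg, hg2⟩ := hcon (⋃ x ∈ s, F x) (s.finite_toSet.biUnion hF1)
      refine ⟨g, hg, fun x hx v => ?_⟩
      by_cases hxv : x v = v
      · exact Or.inl hxv
      · obtain ⟨Q, hQF, hQ, hv⟩ := hF2 x hx v hxv
        exact Or.inr (hg2 Q (mem_iUnion₂.2 ⟨x, hx, hQF⟩) hQ v hv))
    refine continuum_of_disjoint f (fun n => (hf1 n).1) (fun n => (hf1 n).2.1) ?_
    intro m n hmn
    rcases lt_or_gt_of_ne hmn with h | h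
    · exact hf2 m n h
    · exact (hf2 n m h).symm
  obtain ⟨T, hTf, hT⟩ := hT
  let T2 : Set (Set V) := {Q | Q ∈ Cp G Y ∧ ∃ g ∈ Gam G Y, g '' Q ∈ T}
  have hswap : ∀ Q ∈ Cp G Y, Q ∉ T → ∀ g ∈ Gam G Y, g '' Q ∉ T → g '' Q = Q := by
    intro Q hQ hQT g hg hgT
    by_contra hne
    obtain ⟨s, hs, hs1, hs2⟩ := Cp.swap hQ (Cp.image hQ hg) (Ne.symm hne) hg rfl
    obtain ⟨R, hRT, hR, v, hv, hsv⟩ := hT s ⟨hs, hs1, {Q, g '' Q}, by simp, fun v hv => by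
      by_contra hcon
      apply hv
      apply hs2 v
      · exact fun h => hcon ⟨Q, by simp, hQ, h⟩
      · exact fun h => hcon ⟨g '' Q, by simp, Cp.image hQ hg, h⟩⟩
    apply hsv
    apply hs2 v
    · intro h; exact hQT (Cp.eq hQ hR h hv ▸ hRT)
    · intro h; exact hgT (Cp.eq (Cp.image hQ hg) hR h hv ▸ hRT)
  have hT2fin : T2.Finite := by
    have : (T2 \ T).Finite := by
      have hch : ∀ Q : Set V, ∃ g : Equiv.Perm V, Q ∈ T2 → g ∈ Gam G Y ∧ g '' Q ∈ T := by
        intro Q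
        by_cases hQ : Q ∈ T2
        · obtain ⟨-, g, hg⟩ := hQ
          exact ⟨g, fun _ => hg⟩
        · exact ⟨1, fun h => absurd h hQ⟩
      choose g hg using hch
      refine Set.Finite.of_injOn (f := fun Q => g Q '' Q) (t := T) ?_ ?_ hTf
      · intro Q hQ; exact (hg Q hQ.1).2
      · intro Q hQ Q' hQ' e
        simp only at e
        have e2 : ((g Q')⁻¹ * g Q : Equiv.Perm V) '' Q = Q' := by
          rw [Equiv.Perm.coe_mul, image_comp, e, image_inv_image]
        have := hswap Q hQ.1.1 hQ.2 ((g Q')⁻¹ * g Q) (mul_mem (inv_mem (hg Q' hQ'.1).1) (hg Q hQ.1).1)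
          (by rw [e2]; exact hQ'.2)
        rw [← this, e2]
    refine (this.union hTf).subset ?_
    intro Q hQ
    by_cases h : Q ∈ T
    · exact Or.inr h
    · exact Or.inl ⟨hQ, h⟩
  have hT2inv : ∀ Q ∈ T2, ∀ g ∈ Gam G Y, g '' Q ∈ T2 := by
    rintro Q ⟨hQ, g', hg', hT'⟩ g hg
    refine ⟨Cp.image hQ hg, g' * g⁻¹, mul_mem hg' (inv_mem hg), ?_⟩
    rw [Equiv.Perm.coe_mul, image_comp, image_inv_image]
    exact hT'
  have hres : ∀ g ∈ Gam G Y, ∀ Q ∈ Cp G Y, g '' Q = Q → ∃ h ∈ Gam G Q, ∀ x ∈ Q, h x = g x := by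
    intro g hg Q hQ hgQ
    refine restrict hg.1 (fun x => ?_) (fun v hv => ?_)
    · constructor
      · intro hx
        rw [← hgQ] at hx
        obtain ⟨y, hy, e⟩ := hx
        rwa [← g.injective e]
      · intro hx; rw [← hgQ]; exact mem_image_of_mem _ hx
    · rintro ⟨u, hu, huv⟩
      exact Gam.fix hg (fun hvY => hv (Cp.adj hQ hu hvY huv))
  have hfixed : ∀ g ∈ Gam G Y, ∀ Q ∈ Cp G Y, Q ∉ T2 → ∀ x ∈ Q, g x = x := by
    intro g hg Q hQ hQT x hx
    have hQn : ∀ g ∈ Gam G Y, g '' Q ∉ T := fun g hg h => hQT ⟨hQ, g, hg, h⟩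
    have hQn1 : Q ∉ T := by simpa using hQn 1 (one_mem _)
    have e := hswap Q hQ hQn1 g hg (hQn g hg)
    obtain ⟨k, hk, hkg⟩ := hres g hg Q hQ e
    by_contra hne
    obtain ⟨R, hRT, hR, v, hv, hkv⟩ := hT k ⟨Gam_mono (Cp.sub hQ) hk, by
      rintro rfl; exact hne (hkg x hx).symm, {Q}, by simp, fun v hv => ⟨Q, rfl, hQ, by
        by_contra hn; exact hv (Gam.fix hk hn)⟩⟩
    have : v ∈ Q := by by_contra hn; exact hkv (Gam.fix hk hn)
    exact hQn1 (Cp.eq hQ hR this hv ▸ hRT)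
  have : Finite T2 := hT2fin
  let K : Set (Equiv.Perm V) := {g | g ∈ Gam G Y ∧ ∀ Q ∈ T2, g '' Q = Q}
  have hK : K.Finite := by
    have : ∀ g : K, ∀ Q : T2, ∃ h : Gam G (Q : Set V), ∀ x ∈ (Q : Set V), (h : Equiv.Perm V) x = (g : Equiv.Perm V) x := by
      rintro ⟨g, hg⟩ ⟨Q, hQ⟩
      obtain ⟨h, hh, hx⟩ := hres g hg.1 Q hQ.1 (hg.2 Q hQ)
      exact ⟨⟨h, hh⟩, hx⟩
    choose F hF using this
    have : ∀ Q : T2, Finite (Gam G (Q : Set V)) := fun Q => hfinQ Q Q.2.1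
    refine Set.finite_coe_iff.1 (Finite.of_injective F ?_)
    intro g g' e
    apply Subtype.ext
    apply Equiv.ext
    intro v
    by_cases hv : v ∈ Y
    · by_cases hQ : cmp G Y v ∈ T2
      · rw [← hF g ⟨_, hQ⟩ v (mem_cmp_self hv), e, hF g' ⟨_, hQ⟩ v (mem_cmp_self hv)]
      · rw [hfixed _ g.2.1 _ (Cp.mk' hv) hQ v (mem_cmp_self hv),
          hfixed _ g'.2.1 _ (Cp.mk' hv) hQ v (mem_cmp_self hv)]
    · rw [Gam.fix g.2.1 hv, Gam.fix g'.2.1 hv]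
  refine finite_of_fibers (Gam G Y) (T := T2 → Option T2)
    (fun g Q => if h : g '' (Q : Set V) ∈ T2 then some ⟨_, h⟩ else none) hK ?_
  intro g hg g₀ hg₀ he
  refine ⟨mul_mem (inv_mem hg₀) hg, fun Q hQ => ?_⟩
  have := congrFun he ⟨Q, hQ⟩
  simp only [hT2inv Q hQ g hg, hT2inv Q hQ g₀ hg₀, dif_pos, Option.some.injEq, Subtype.mk.injEq] at this
  rw [Equiv.Perm.coe_mul, image_comp, this, image_inv_image]

end comps


def Rk {V : Type} (G : SimpleGraph V) (α : Ordinal.{0}) (Y : Set V) : Prop :=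
  ∃ S : Set V, S.Finite ∧ ∀ y ∈ Y \ S, ∃ β, ∃ _ : β < α, Rk G β (cmp G (Y \ S) y)
termination_by α

section rk
variable {V : Type} {G : SimpleGraph V}

lemma Rk_iff (α : Ordinal.{0}) (Y : Set V) : Rk G α Y ↔
    ∃ S : Set V, S.Finite ∧ ∀ y ∈ Y \ S, ∃ β < α, Rk G β (cmp G (Y \ S) y) := by
  rw [Rk]; simp only [exists_prop]

lemma Rk_sub {α : Ordinal.{0}} : ∀ {Y Y' : Set V}, Y' ⊆ Y → Rk G α Y → Rk G α Y' := by
  induction α using WellFoundedLT.induction with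
  | ind α ih =>
    intro Y Y' hY h
    rw [Rk_iff] at h ⊢
    obtain ⟨S, hS, h⟩ := h
    refine ⟨S, hS, fun y hy => ?_⟩
    obtain ⟨β, hβ, hr⟩ := h y ⟨hY hy.1, hy.2⟩
    exact ⟨β, hβ, ih β hβ (cmp_mono (sdiff_subset_sdiff_left hY) y) hr⟩

lemma Rk_mono {α β : Ordinal.{0}} (hab : α ≤ β) {Y : Set V} (h : Rk G α Y) : Rk G β Y := by
  rw [Rk_iff] at h ⊢
  obtain ⟨S, hS, h⟩ := h
  refine ⟨S, hS, fun y hy => ?_⟩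
  obtain ⟨γ, hγ, hr⟩ := h y hy
  exact ⟨γ, hγ.trans_le hab, hr⟩

lemma Rk_map {g : Equiv.Perm V} (hg : ∀ a b, G.Adj (g a) (g b) ↔ G.Adj a b) {α : Ordinal.{0}} :
    ∀ {Y : Set V}, Rk G α Y → Rk G α (g '' Y) := by
  induction α using WellFoundedLT.induction with
  | ind α ih =>
    intro Y h
    rw [Rk_iff] at h ⊢
    obtain ⟨S, hS, h⟩ := h
    refine ⟨g '' S, hS.image _, ?_⟩
    rw [← image_sdiff g.injective]
    rintro _ ⟨y, hy, rfl⟩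
    obtain ⟨β, hβ, hr⟩ := h y hy
    exact ⟨β, hβ, cmp_map hg _ _ ▸ ih β hβ hr⟩

lemma exists_rank {Z : Set V} (hZ : ¬ ∃ r, IsRay G r ∧ ∀ n, r n ∈ Z) : ∃ α, Rk G α Z := by
  classical
  have key : ∀ Y : Set V, (∀ α, ¬ Rk G α Y) → ∀ S : Set V, S.Finite →
      ∃ y ∈ Y \ S, ∀ α, ¬ Rk G α (cmp G (Y \ S) y) := by
    intro Y hY S hS
    by_contra hcon
    push Not at hcon
    choose! β hβ using hcon
    apply hY (Order.succ (⨆ y : V, β y))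
    rw [Rk_iff]
    exact ⟨S, hS, fun y hy => ⟨β y, Order.lt_succ_iff.2 (Ordinal.le_iSup β y), hβ y hy⟩⟩
  by_contra hcon
  push Not at hcon
  apply hZ
  let St := {p : V × Set V // p.1 ∈ p.2 ∧ Conn G p.2 ∧ p.2 ⊆ Z ∧ ∀ α, ¬ Rk G α p.2}
  have step : ∀ s : St, ∃ t : St, G.Adj s.1.1 t.1.1 ∧ t.1.2 ⊆ s.1.2 \ {s.1.1} := by
    rintro ⟨⟨v, Y⟩, hv, hY, hYZ, hbad⟩
    simp only at hv hY hYZ hbad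
    obtain ⟨y, hy, hb⟩ := key Y hbad {v} (finite_singleton _)
    obtain ⟨w, h1, h2, h3⟩ := (hY v hv y hy.1).leave hy.2
    refine ⟨⟨⟨w, cmp G (Y \ {v}) y⟩, ⟨h2, h3.symm⟩, conn_cmp,
      cmp_sub.trans (sdiff_subset.trans hYZ), hb⟩, h1, cmp_sub⟩
  choose nx hnx1 hnx2 using step
  obtain ⟨y, hy, hb⟩ := key Z hcon ∅ finite_empty
  let base : St := ⟨⟨y, cmp G (Z \ ∅) y⟩, mem_cmp_self hy, conn_cmp, cmp_sub.trans sdiff_subset, hb⟩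
  let s : ℕ → St := fun n => Nat.rec base (fun _ t => nx t) n
  have hs : ∀ n, s (n+1) = nx (s n) := fun n => rfl
  have hin : ∀ m n, m < n → (s n).1.2 ⊆ (s m).1.2 \ {(s m).1.1} := by
    intro m n hmn
    induction n, hmn using Nat.le_induction with
    | base => rw [hs]; exact hnx2 _
    | succ n hn ih => rw [hs]; exact (hnx2 _).trans (sdiff_subset.trans ih)
  refine ⟨fun n => (s n).1.1, ⟨?_, fun n => hnx1 (s n)⟩, fun n => (s n).2.2.2.1 (s n).2.1⟩
  intro m n hmn
  simp only at hmn
  rcases lt_trichotomy m n with h | h | h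
  · exact absurd hmn.symm (hin m n h (s n).2.1).2
  · exact h
  · exact absurd hmn (hin n m h (s m).2.1).2

def Wit (G : SimpleGraph V) (α : Ordinal.{0}) (Z S : Set V) : Prop :=
  S ⊆ Z ∧ S.Finite ∧ ∀ y ∈ Z \ S, ∃ β < α, Rk G β (cmp G (Z \ S) y)

lemma Wit.exists {α : Ordinal.{0}} {Z : Set V} (h : Rk G α Z) : ∃ S, Wit G α Z S := by
  rw [Rk_iff] at h
  obtain ⟨S, hS, h⟩ := h
  refine ⟨Z ∩ S, inter_subset_left, hS.subset inter_subset_right, ?_⟩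
  rw [sdiff_self_inter]; exact h

lemma Wit.map {α : Ordinal.{0}} {Z S : Set V} (h : Wit G α Z S) {g : Equiv.Perm V} (hg : g ∈ Gam G Z) :
    Wit G α Z (g '' S) := by
  obtain ⟨h1, h2, h3⟩ := h
  have hZ := Gam.image_eq hg
  refine ⟨by rw [← hZ]; exact image_mono h1, h2.image _, ?_⟩
  have : Z \ g '' S = g '' (Z \ S) := by rw [image_sdiff g.injective, hZ]
  rw [this]
  rintro _ ⟨y, hy, rfl⟩
  obtain ⟨β, hβ, hr⟩ := h3 y hy
  exact ⟨β, hβ, cmp_map hg.1 _ _ ▸ Rk_map hg.1 hr⟩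

lemma Wit.inter {α : Ordinal.{0}} {Z S S' : Set V} (h : Wit G α Z S) (h' : Wit G α Z S') :
    Wit G α Z (S ∩ S') := by
  classical
  obtain ⟨hSZ, hSf, hS⟩ := h
  obtain ⟨hSZ', hSf', hS'⟩ := h'
  refine ⟨inter_subset_left.trans hSZ, hSf.subset inter_subset_left, ?_⟩
  intro y hy
  set Y := cmp G (Z \ (S ∩ S')) y with hYdef
  have hYsub : Y ⊆ Z \ (S ∩ S') := cmp_sub
  have hYc : Conn G Y := conn_cmp
  have hyY : y ∈ Y := mem_cmp_self hy
  by_cases hdis : ∀ t ∈ Y, t ∉ S ∪ S'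
  · have hYS : Y ⊆ Z \ S := fun t ht => ⟨(hYsub ht).1, fun hs => hdis t ht (Or.inl hs)⟩
    obtain ⟨β, hβ, hr⟩ := hS y (hYS hyY)
    exact ⟨β, hβ, Rk_sub (hYc.sub_cmp hYS hyY) hr⟩
  push Not at hdis
  obtain ⟨t₀, ht₀Y, ht₀⟩ := hdis
  let T : Set V := (S \ S') ∪ (S' \ S)
  have hTf : T.Finite := (hSf.subset sdiff_subset).union (hSf'.subset sdiff_subset)
  let D : V → Set V := fun t => if t ∈ S' then cmp G (Z \ S) t else cmp G (Z \ S') t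
  have hD1 : ∀ t ∈ T, ∃ β < α, Rk G β (D t) := by
    rintro t (⟨ht, ht'⟩ | ⟨ht', ht⟩)
    · simp only [D, ht', if_false]; exact hS' t ⟨hSZ ht, ht'⟩
    · simp only [D, ht', if_true]; exact hS t ⟨hSZ' ht', ht⟩
  have hD2 : ∀ t ∈ T, ∀ Q : Set V, Conn G Q → Q ⊆ Z \ (S ∪ S') → ∀ x ∈ Q, x ∈ D t → Q ⊆ D t := by
    rintro t - Q hQ hQZ x hxQ hx
    by_cases ht' : t ∈ S'
    · simp only [D, ht', if_true] at hx ⊢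
      rw [← cmp_eq_of_mem hx]
      exact hQ.sub_cmp (fun z hz => ⟨(hQZ hz).1, fun h => (hQZ hz).2 (Or.inl h)⟩) hxQ
    · simp only [D, ht', if_false] at hx ⊢
      rw [← cmp_eq_of_mem hx]
      exact hQ.sub_cmp (fun z hz => ⟨(hQZ hz).1, fun h => (hQZ hz).2 (Or.inr h)⟩) hxQ
  have hD3 : ∀ z ∈ Y, z ∉ S ∪ S' → ∃ t ∈ T, z ∈ D t := by
    intro z hz hzS
    obtain ⟨a, t, ha, ht, haY, htY, hat, hr⟩ := (hYc z hz t₀ ht₀Y).exit (T := (S ∪ S')ᶜ) hz hzS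
      (fun h => h ht₀)
    have htI := (hYsub htY).2
    have htSS : t ∈ S ∪ S' := not_not.1 ht
    have hYZ : ∀ u ∈ Y, u ∈ Z := fun u hu => (hYsub hu).1
    by_cases ht' : t ∈ S'
    · have htS : t ∉ S := fun h => htI ⟨h, ht'⟩
      refine ⟨t, Or.inr ⟨ht', htS⟩, ?_⟩
      simp only [D, ht', if_true]
      have hsub : Y ∩ (S ∪ S')ᶜ ⊆ Z \ S := fun u hu => ⟨hYZ u hu.1, fun h => hu.2 (Or.inl h)⟩
      exact ⟨hsub ⟨hz, hzS⟩, ((hr.mono hsub).trans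
        (RIn.single hat (hsub ⟨haY, ha⟩) ⟨hYZ t htY, htS⟩)).symm⟩
    · have htS : t ∈ S := htSS.resolve_right ht'
      refine ⟨t, Or.inl ⟨htS, ht'⟩, ?_⟩
      simp only [D, ht', if_false]
      have hsub : Y ∩ (S ∪ S')ᶜ ⊆ Z \ S' := fun u hu => ⟨hYZ u hu.1, fun h => hu.2 (Or.inr h)⟩
      exact ⟨hsub ⟨hz, hzS⟩, ((hr.mono hsub).trans
        (RIn.single hat (hsub ⟨haY, ha⟩) ⟨hYZ t htY, ht'⟩)).symm⟩
  have hTne : T.Nonempty := by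
    refine ⟨t₀, ?_⟩
    have := (hYsub ht₀Y).2
    rcases ht₀ with h | h
    · exact Or.inl ⟨h, fun h' => this ⟨h, h'⟩⟩
    · exact Or.inr ⟨h, fun h' => this ⟨h', h⟩⟩
  choose! β hβ1 hβ2 using hD1
  obtain ⟨t₁, ht₁, hmax⟩ := Set.exists_max_image T β hTf hTne
  have hR : ∀ t ∈ T, ∃ K : Set V, K.Finite ∧ ∀ y ∈ D t \ K, ∃ γ < β t₁, Rk G γ (cmp G (D t \ K) y) := by
    intro t ht
    have := Rk_mono (hmax t ht) (hβ2 t ht)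
    rwa [Rk_iff] at this
  choose! K hK1 hK2 using hR
  refine ⟨β t₁, hβ1 t₁ ht₁, ?_⟩
  rw [Rk_iff]
  refine ⟨S ∪ S' ∪ ⋃ t ∈ T, K t, (hSf.union hSf').union (hTf.biUnion hK1), ?_⟩
  intro z hz
  have hzS : z ∉ S ∪ S' := fun h => hz.2 (Or.inl h)
  obtain ⟨t, ht, hzD⟩ := hD3 z hz.1 hzS
  set Q := cmp G (Y \ (S ∪ S' ∪ ⋃ t ∈ T, K t)) z
  have hQs : Q ⊆ Y \ (S ∪ S' ∪ ⋃ t ∈ T, K t) := cmp_sub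
  have hQc : Conn G Q := conn_cmp
  have hzQ : z ∈ Q := mem_cmp_self hz
  have hQD := hD2 t ht Q hQc (fun u hu => ⟨(hYsub (hQs hu).1).1, fun h => (hQs hu).2 (Or.inl h)⟩) z hzQ hzD
  have hQK : Q ⊆ D t \ K t := fun u hu =>
    ⟨hQD hu, fun h => (hQs hu).2 (Or.inr (mem_iUnion₂.2 ⟨t, ht, h⟩))⟩
  obtain ⟨γ, hγ, hr⟩ := hK2 t ht z (hQK hzQ)
  exact ⟨γ, hγ, Rk_sub (hQc.sub_cmp hQK hzQ) hr⟩

lemma pstab_finite {Z S : Set V} (h : (Gam G (Z \ S) : Set (Equiv.Perm V)).Finite) :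
    {g | g ∈ Gam G Z ∧ ∀ s ∈ S, g s = s}.Finite := by
  refine h.subset ?_
  rintro g ⟨hg, hs⟩
  refine ⟨hg.1, fun v hv => ?_⟩
  by_cases hvS : v ∈ S
  · exact hs v hvS
  · exact Gam.fix hg (fun hz => hv ⟨hz, hvS⟩)

lemma rk_dichotomy {α : Ordinal.{0}} : ∀ {Z : Set V}, Rk G α Z → FC G Z := by
  classical
  induction α using WellFoundedLT.induction with
  | ind α ih =>
    intro Z hZ
    obtain ⟨S, hS, hmin⟩ : ∃ S, Wit G α Z S ∧ ∀ S', Wit G α Z S' → S.ncard ≤ S'.ncard := by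
      have hex : ∃ n, ∃ S, Wit G α Z S ∧ S.ncard = n := by
        obtain ⟨S, hS⟩ := Wit.exists hZ
        exact ⟨_, S, hS, rfl⟩
      obtain ⟨S, hS, hn⟩ := Nat.find_spec hex
      exact ⟨S, hS, fun S' hS' => hn ▸ Nat.find_min' hex ⟨S', hS', rfl⟩⟩
    have hinv : ∀ g ∈ Gam G Z, ∀ s ∈ S, g s ∈ S := by
      intro g hg s hs
      have hw := hS.map hg
      have hi := hS.inter hw
      have h1 : S ∩ g '' S = g '' S := by
        apply Set.eq_of_subset_of_ncard_le inter_subset_right _ (hS.2.1.image _)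
        rw [Set.ncard_image_of_injective _ g.injective]
        exact hmin _ hi
      have : g s ∈ S ∩ g '' S := by rw [h1]; exact mem_image_of_mem _ hs
      exact this.1
    have hFC : FC G (Z \ S) := comps_dichotomy (fun y hy => by
      obtain ⟨β, hβ, hr⟩ := hS.2.2 y hy
      exact ih β hβ hr)
    rcases hFC with h | h
    · exact Or.inl (finite_of_stab _ hS.2.1 hinv (pstab_finite h))
    · exact Or.inr (cont_mono sdiff_subset h)

lemma rayless_dichotomy {Z : Set V} (hZ : ¬ ∃ r, IsRay G r ∧ ∀ n, r n ∈ Z) : FC G Z := by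
  obtain ⟨α, h⟩ := exists_rank hZ
  exact rk_dichotomy h

end rk


def Region {V : Type} (G : SimpleGraph V) (M : Set V) (ω : ℕ → V) (C : Set V) : Prop :=
  C ⊆ M ∧ Conn G C ∧ (NB G M C).Finite ∧ ∃ m, ∀ n, m ≤ n → ω n ∈ C

structure Good {V : Type} (G : SimpleGraph V) (M : Set V) (ω : ℕ → V) (k : ℕ) : Prop where
  ray : IsRay G ω
  inM : ∀ n, ω n ∈ M
  conn : Conn G M
  h2 : ∀ r, IsRay G r → (∀ n, r n ∈ M) → ∀ C, Region G M ω C → ∃ m, ∀ n, m ≤ n → r n ∈ C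
  h3 : ∀ v ∈ M, ∃ C, Region G M ω C ∧ v ∉ C ∧ v ∉ NB G M C
  h4 : ¬ ∃ f : Fin (k+1) → ℕ → V, (∀ i, IsRay G (f i) ∧ ∀ n, f i n ∈ M) ∧ DisjointRays f

section regions
variable {V : Type} {G : SimpleGraph V} {M : Set V} {ω : ℕ → V} {k : ℕ}

lemma Region.sub {C : Set V} (h : Region G M ω C) : C ⊆ M := h.1
lemma Region.conn {C : Set V} (h : Region G M ω C) : Conn G C := h.2.1
lemma Region.fin {C : Set V} (h : Region G M ω C) : (NB G M C).Finite := h.2.2.1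
lemma Region.tail {C : Set V} (h : Region G M ω C) : ∃ m, ∀ n, m ≤ n → ω n ∈ C := h.2.2.2

lemma Region.nonempty {C : Set V} (h : Region G M ω C) : C.Nonempty := by
  obtain ⟨m, hm⟩ := h.tail
  exact ⟨_, hm m le_rfl⟩

lemma NB_cmp {U : Set V} {a : V} : NB G M (cmp G U a) ⊆ NB G M U := by
  rintro v ⟨hv, hvC, u, hu, huv⟩
  exact ⟨hv, fun hvU => hvC (cmp_adj hu hvU huv), u, hu.1, huv⟩

lemma region_cmp (hr : IsRay G ω) {U : Set V} (hU : U ⊆ M) (hf : (NB G M U).Finite) {m : ℕ}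
    (hm : ∀ n, m ≤ n → ω n ∈ U) : Region G M ω (cmp G U (ω m)) := by
  refine ⟨cmp_sub.trans hU, conn_cmp, hf.subset NB_cmp, m, fun n hn => ?_⟩
  induction n, hn using Nat.le_induction with
  | base => exact mem_cmp_self (hm m le_rfl)
  | succ n hn ih => exact cmp_adj ih (hm _ (by omega)) (hr.2 n)

lemma conn_compl_cmp (hM : Conn G M) {U : Set V} (hU : U ⊆ M) {a : V} (ha : a ∈ U)
    (hc : Conn G (M \ U)) : Conn G (M \ cmp G U a) := by
  rcases (M \ U).eq_empty_or_nonempty with he | ⟨z, hz⟩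
  · have hMU : M ⊆ U := by
      intro x hx; by_contra h; exact (he ▸ (⟨hx, h⟩ : x ∈ M \ U) : x ∈ (∅ : Set V))
    intro x hx
    exfalso
    have : U = M := Subset.antisymm hU hMU
    subst this
    exact hx.2 ⟨hx.1, hM a ha x hx.1⟩
  · refine conn_of_base (x := z) ?_
    have hsub : M \ U ⊆ M \ cmp G U a := sdiff_subset_sdiff_right cmp_sub
    intro x hx
    by_cases hxU : x ∈ U
    · obtain ⟨p, y, hp, hy, hpM, hyM, hpy, hr⟩ := (hM x hx.1 z hz.1).exit (T := cmp G U x) hx.1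
        (mem_cmp_self hxU) (fun h => hz.2 h.1)
      have hyU : y ∉ U := fun h => hy (cmp_adj hp h hpy)
      have hs : M ∩ cmp G U x ⊆ M \ cmp G U a := by
        rintro u ⟨hu, hux⟩
        refine ⟨hu, fun hua => hx.2 ?_⟩
        rw [← cmp_eq_of_mem hua, cmp_eq_of_mem hux]
        exact mem_cmp_self hxU
      exact ((hr.mono hs).trans (RIn.single hpy (hs ⟨hpM, hp⟩) (hsub ⟨hyM, hyU⟩))).trans
        ((hc y ⟨hyM, hyU⟩ z hz).mono hsub)
    · exact (hc x ⟨hx.1, hxU⟩ z hz).mono hsub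

lemma NB_inter_sub {C D : Set V} : NB G M (C ∩ D) ⊆ NB G M C ∪ NB G M D := by
  rintro v ⟨hv, hvC, u, hu, huv⟩
  by_cases h : v ∈ C
  · exact Or.inr ⟨hv, fun h' => hvC ⟨h, h'⟩, u, hu.2, huv⟩
  · exact Or.inl ⟨hv, h, u, hu.1, huv⟩

lemma NB_union_sub {C D : Set V} : NB G M (C ∪ D) ⊆ NB G M C ∪ NB G M D := by
  rintro v ⟨hv, hvC, u, hu | hu, huv⟩
  · exact Or.inl ⟨hv, fun h => hvC (Or.inl h), u, hu, huv⟩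
  · exact Or.inr ⟨hv, fun h => hvC (Or.inr h), u, hu, huv⟩

lemma NB_submod {C D : Set V} (hC : (NB G M C).Finite) (hD : (NB G M D).Finite) :
    (NB G M (C ∩ D)).ncard + (NB G M (C ∪ D)).ncard ≤ (NB G M C).ncard + (NB G M D).ncard := by
  have hi := (hC.union hD).subset (NB_inter_sub (G := G) (M := M) (C := C) (D := D))
  have hu := (hC.union hD).subset (NB_union_sub (G := G) (M := M) (C := C) (D := D))
  rw [← Set.ncard_union_add_ncard_inter _ _ hi hu, ← Set.ncard_union_add_ncard_inter _ _ hC hD]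
  apply Nat.add_le_add
  · exact Set.ncard_le_ncard (union_subset NB_inter_sub NB_union_sub) (hC.union hD)
  · refine Set.ncard_le_ncard ?_ (hC.subset inter_subset_left)
    rintro v ⟨⟨hv, hvC, u, hu, huv⟩, ⟨-, hv2, -⟩⟩
    exact ⟨⟨hv, fun h => hv2 (Or.inl h), u, hu.1, huv⟩, ⟨hv, fun h => hv2 (Or.inr h), u, hu.2, huv⟩⟩

lemma Region.union {C D : Set V} (hC : Region G M ω C) (hD : Region G M ω D) :
    Region G M ω (C ∪ D) := by
  obtain ⟨m, hm⟩ := hC.tail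
  obtain ⟨m', hm'⟩ := hD.tail
  refine ⟨union_subset hC.sub hD.sub, hC.conn.union hD.conn (hm (max m m') (le_max_left _ _))
    (hm' (max m m') (le_max_right _ _)), (hC.fin.union hD.fin).subset NB_union_sub, m, fun n hn => Or.inl (hm n hn)⟩

lemma Region.inter (hr : IsRay G ω) {C D : Set V} (hC : Region G M ω C) (hD : Region G M ω D) :
    ∃ E, Region G M ω E ∧ E ⊆ C ∩ D ∧ NB G M E ⊆ NB G M (C ∩ D) ∧
      (Conn G M → Conn G (M \ (C ∩ D)) → Conn G (M \ E)) := by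
  obtain ⟨m, hm⟩ := hC.tail
  obtain ⟨m', hm'⟩ := hD.tail
  have hU : C ∩ D ⊆ M := inter_subset_left.trans hC.sub
  have ht : ∀ n, max m m' ≤ n → ω n ∈ C ∩ D := fun n hn =>
    ⟨hm n ((le_max_left _ _).trans hn), hm' n ((le_max_right _ _).trans hn)⟩
  refine ⟨cmp G (C ∩ D) (ω (max m m')), region_cmp hr hU ((hC.fin.union hD.fin).subset NB_inter_sub) ht,
    cmp_sub, NB_cmp, fun hM h => conn_compl_cmp hM hU (ht _ le_rfl) h⟩

lemma Region.finInter (hr : IsRay G ω) {ι : Type*} {s : Set ι} (hs : s.Finite) (f : ι → Set V)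
    (hf : ∀ i ∈ s, Region G M ω (f i)) {C : Set V} (hC : Region G M ω C) :
    ∃ E, Region G M ω E ∧ E ⊆ C ∧ ∀ i ∈ s, E ⊆ f i := by
  induction s, hs using Set.Finite.induction_on with
  | empty => exact ⟨C, hC, subset_rfl, by simp⟩
  | @insert a s ha hs ih =>
    obtain ⟨E, hE, hEC, hEs⟩ := ih (fun i hi => hf i (mem_insert_of_mem _ hi))
    obtain ⟨E', hE', hsub, -⟩ := hE.inter hr (hf a (mem_insert _ _))
    refine ⟨E', hE', (hsub.trans inter_subset_left).trans hEC, ?_⟩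
    rintro i (rfl | hi)
    · exact hsub.trans inter_subset_right
    · exact (hsub.trans inter_subset_left).trans (hEs i hi)

lemma Good.region_M (h : Good G M ω k) : Region G M ω M := by
  refine ⟨subset_rfl, h.conn, ?_, 0, fun n _ => h.inM n⟩
  convert Set.finite_empty (α := V)
  ext v
  simp only [mem_empty_iff_false, iff_false]
  exact fun hv => hv.2.1 hv.1

lemma Good.shrink (h : Good G M ω k) {C : Set V} (hC : Region G M ω C) {F : Set V} (hF : F.Finite)
    (hFM : F ⊆ M) : ∃ C', Region G M ω C' ∧ C' ⊆ C ∧ NB G M C' ⊆ C ∧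
      ∀ v ∈ F, v ∉ C' ∧ v ∉ NB G M C' := by
  have : ∀ v, ∃ C, v ∈ M → Region G M ω C ∧ v ∉ C ∧ v ∉ NB G M C := by
    intro v
    by_cases hv : v ∈ M
    · obtain ⟨C, hC⟩ := h.h3 v hv; exact ⟨C, fun _ => hC⟩
    · exact ⟨∅, fun h => absurd h hv⟩
  choose D hD using this
  have hFC : F ∪ NB G M C ⊆ M := union_subset hFM NB_sub_M
  obtain ⟨E, hE, hEC, hED⟩ := Region.finInter h.ray (hF.union hC.fin) D (fun v hv => (hD v (hFC hv)).1) hC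
  have key : ∀ v ∈ F ∪ NB G M C, v ∉ E ∧ v ∉ NB G M E := by
    intro v hv
    obtain ⟨h1, h2, h3⟩ := hD v (hFC hv)
    refine ⟨fun h => h2 (hED v hv h), fun h => ?_⟩
    rcases NB_mono_closure (hED v hv) h with h | h
    · exact h2 h
    · exact h3 h
  refine ⟨E, hE, hEC, ?_, fun v hv => key v (Or.inl hv)⟩
  intro v hv
  rcases NB_mono_closure hEC hv with h | h
  · exact h
  · exact absurd hv (key v (Or.inr h)).2

lemma NB_map {g : Equiv.Perm V} (hg : g ∈ Gam G M) (C : Set V) :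
    NB G M (g '' C) = g '' (NB G M C) := by
  ext v
  constructor
  · rintro ⟨hv, hvC, _, ⟨u, hu, rfl⟩, huv⟩
    refine ⟨g⁻¹ v, ⟨(Gam.mem_iff (inv_mem hg) v).2 hv, fun h => hvC ⟨_, h, by simp⟩, u, hu, ?_⟩, by simp⟩
    rw [← hg.1]; simpa using huv
  · rintro ⟨v, ⟨hv, hvC, u, hu, huv⟩, rfl⟩
    refine ⟨(Gam.mem_iff hg v).2 hv, ?_, g u, mem_image_of_mem _ hu, (hg.1 _ _).2 huv⟩
    rintro ⟨w, hw, e⟩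
    exact hvC (g.injective e ▸ hw)

lemma NB_map_card {g : Equiv.Perm V} (hg : g ∈ Gam G M) (C : Set V) :
    (NB G M (g '' C)).ncard = (NB G M C).ncard := by
  rw [NB_map hg, Set.ncard_image_of_injective _ g.injective]

lemma IsRay.map {r : ℕ → V} (hr : IsRay G r) {g : Equiv.Perm V} (hg : g ∈ Gam G M) :
    IsRay G (fun n => g (r n)) :=
  ⟨g.injective.comp hr.1, fun n => (hg.1 _ _).2 (hr.2 n)⟩

lemma Good.map (h : Good G M ω k) {C : Set V} (hC : Region G M ω C) {g : Equiv.Perm V}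
    (hg : g ∈ Gam G M) : Region G M ω (g '' C) := by
  refine ⟨?_, hC.conn.map hg.1, ?_, ?_⟩
  · rintro _ ⟨x, hx, rfl⟩
    exact (Gam.mem_iff hg x).2 (hC.sub hx)
  · rw [NB_map hg]; exact hC.fin.image _
  · obtain ⟨m, hm⟩ := h.h2 (fun n => g⁻¹ (ω n)) (h.ray.map (inv_mem hg))
      (fun n => (Gam.mem_iff (inv_mem hg) _).2 (h.inM n)) C hC
    exact ⟨m, fun n hn => ⟨_, hm n hn, by simp⟩⟩

lemma compl_map {g : Equiv.Perm V} (hg : g ∈ Gam G M) (C : Set V) :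
    M \ g '' C = g '' (M \ C) := by
  rw [image_sdiff g.injective, Gam.image_eq hg]

lemma conn_compl_map {g : Equiv.Perm V} (hg : g ∈ Gam G M) {C : Set V} (h : Conn G (M \ C)) :
    Conn G (M \ g '' C) := by
  rw [compl_map hg]; exact h.map hg.1

end regions


section link
variable {V : Type} {G : SimpleGraph V}

lemma hall_link [DecidableEq V] (J P Q : Finset V) (hP : P ⊆ J) :
    (∃ θ : V → V, InjOn θ (J \ Q : Finset V) ∧ ∀ v ∈ J \ Q, θ v ∈ J \ P ∧ (θ v = v ∨ G.Adj v (θ v))) ∨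
    ∃ Y : Finset V, Y ⊆ J ∧ Y.card < P.card ∧
      ∀ p ∈ P, p ∉ Y → ∀ q ∈ Q, q ∉ Y → ¬ RIn G ((J : Set V) \ Y) p q := by
  classical
  let t : {v // v ∈ J \ Q} → Finset V := fun v => (J \ P).filter (fun u => u = v.1 ∨ G.Adj v.1 u)
  by_cases hH : ∀ s : Finset {v // v ∈ J \ Q}, s.card ≤ (s.biUnion t).card
  · left
    obtain ⟨f, hf, hft⟩ := (Finset.all_card_le_biUnion_card_iff_exists_injective t).1 hH
    refine ⟨fun v => if h : v ∈ J \ Q then f ⟨v, h⟩ else v, ?_, ?_⟩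
    · intro a ha b hb e
      have ha' : a ∈ J \ Q := ha
      have hb' : b ∈ J \ Q := hb
      simp only [ha', hb', dif_pos] at e
      exact congrArg Subtype.val (hf e)
    · intro v hv
      simp only [hv, dif_pos]
      have := hft ⟨v, hv⟩
      simp only [t, Finset.mem_filter] at this
      exact this
  · right
    push Not at hH
    obtain ⟨s, hs⟩ := hH
    let T : Finset V := s.image Subtype.val
    have hTc : T.card = s.card := Finset.card_image_of_injective _ Subtype.val_injective
    have hTJ : ∀ v ∈ T, v ∈ J ∧ v ∉ Q := by
      intro v hv
      simp only [T, Finset.mem_image] at hv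
      obtain ⟨w, -, rfl⟩ := hv
      exact Finset.mem_sdiff.1 w.2
    let N : Finset V := J.filter (fun u => ∃ v ∈ T, u = v ∨ G.Adj v u)
    have hTN : T ⊆ N := fun v hv => Finset.mem_filter.2 ⟨(hTJ v hv).1, v, hv, Or.inl rfl⟩
    have hNb : N \ P ⊆ s.biUnion t := by
      intro u hu
      simp only [N, T, Finset.mem_sdiff, Finset.mem_filter, Finset.mem_image] at hu
      obtain ⟨⟨huJ, v, ⟨w, hw, rfl⟩, h⟩, huP⟩ := hu
      refine Finset.mem_biUnion.2 ⟨w, hw, ?_⟩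
      simp only [t, Finset.mem_filter, Finset.mem_sdiff]
      exact ⟨⟨huJ, huP⟩, h⟩
    have hc1 := Finset.card_le_card hNb
    refine ⟨(N \ T) ∪ (P \ N), ?_, ?_, ?_⟩
    · apply Finset.union_subset
      · exact Finset.sdiff_subset.trans (Finset.filter_subset _ _)
      · exact Finset.sdiff_subset.trans hP
    · have h1 := Finset.card_union_le (N \ T) (P \ N)
      have h2 := Finset.card_sdiff_add_card_eq_card hTN
      have h3 := Finset.card_sdiff_add_card_inter N P
      have h4 := Finset.card_sdiff_add_card_inter P N
      rw [Finset.inter_comm] at h4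
      omega
    · intro p hp hpY q hq hqY hr
      have hpN : p ∈ N := by
        by_contra h; exact hpY (Finset.mem_union_right _ (Finset.mem_sdiff.2 ⟨hp, h⟩))
      have hpT : p ∈ T := by
        by_contra h; exact hpY (Finset.mem_union_left _ (Finset.mem_sdiff.2 ⟨hpN, h⟩))
      have : q ∈ (T : Set V) := by
        refine hr.closed (T := (T : Set V)) hpT ?_
        intro x hx y hy hxU hxy
        have hyN : y ∈ N := Finset.mem_filter.2 ⟨hy.1, x, hx, Or.inr hxy⟩
        by_contra h
        exact hy.2 (Finset.mem_union_left _ (Finset.mem_sdiff.2 ⟨hyN, h⟩))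
      exact (hTJ q this).2 hq

lemma linkage {W P Q : Set V} (hP : P.Finite) (hQ : Q.Finite) (hPW : P ⊆ W) (hQW : Q ⊆ W)
    (hsep : ∀ Y : Set V, Y.Finite → Y ⊆ W →
      (∀ p ∈ P, p ∉ Y → ∀ q ∈ Q, q ∉ Y → ¬ RIn G (W \ Y) p q) → P.ncard ≤ Y.ncard) :
    ∃ (J : Set V) (θ : V → V), P ⊆ J ∧ Q ⊆ J ∧ J ⊆ W ∧ InjOn θ (J \ Q) ∧
      ∀ v ∈ J \ Q, θ v ∈ J \ P ∧ (θ v = v ∨ G.Adj v (θ v)) := by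
  classical
  lift P to Finset V using hP
  lift Q to Finset V using hQ
  by_contra hcon
  let B : Finset V → Finset V := fun J => J.filter (· ∈ W) ∪ P ∪ Q
  have hBW : ∀ J, (B J : Set V) ⊆ W := by
    intro J v hv
    simp only [B, Finset.coe_union, Finset.coe_filter, mem_union, mem_setOf_eq] at hv
    rcases hv with (h | h) | h
    · exact h.2
    · exact hPW h
    · exact hQW h
  have hPB : ∀ J, P ⊆ B J := fun J v hv => by simp [B, hv]
  have hQB : ∀ J, Q ⊆ B J := fun J v hv => by simp [B, hv]
  have hY : ∀ J : Finset V, ∃ Y : Finset V, Y ⊆ B J ∧ Y.card < P.card ∧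
      ∀ p ∈ P, p ∉ Y → ∀ q ∈ Q, q ∉ Y → ¬ RIn G ((B J : Set V) \ Y) p q := by
    intro J
    refine (hall_link (G := G) (B J) P Q (hPB J)).resolve_left ?_
    rintro ⟨θ, h1, h2⟩
    refine hcon ⟨B J, θ, by exact_mod_cast hPB J, by exact_mod_cast hQB J, hBW J, by simpa using h1, ?_⟩
    intro v hv
    have := h2 v (by simpa using hv)
    simpa using this
  choose Yf hY1 hY2 hY3 using hY
  let 𝒰 : Ultrafilter (Finset V) := Ultrafilter.of Filter.atTop
  have h𝒰 : (𝒰 : Filter (Finset V)) ≤ Filter.atTop := Ultrafilter.of_le _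
  let Y : Set V := {v | ∀ᶠ J in (𝒰 : Filter (Finset V)), v ∈ Yf J}
  have hYcard : ∀ F : Finset V, (F : Set V) ⊆ Y → F.card < P.card := by
    intro F hF
    have : ∀ᶠ J in (𝒰 : Filter (Finset V)), ∀ v ∈ F, v ∈ Yf J :=
      (Filter.eventually_all_finset F).2 (fun v hv => hF hv)
    obtain ⟨J, hJ⟩ := this.exists
    exact lt_of_le_of_lt (Finset.card_le_card hJ) (hY2 J)
  have hYfin : Y.Finite := by
    by_contra hinf
    obtain ⟨F, hF, hFc⟩ := Set.Infinite.exists_subset_card_eq hinf P.card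
    exact absurd (hYcard F hF) (by omega)
  have hYW : Y ⊆ W := by
    intro v hv
    obtain ⟨J, hJ⟩ := Filter.Eventually.exists hv
    exact hBW J (hY1 J hJ)
  have := hsep Y hYfin hYW (by
    intro p hp hpY q hq hqY hr
    obtain ⟨J0, hJ0, hJ0U, hJ0c, hpJ, hqJ⟩ := hr.finite_path ⟨hPW hp, hpY⟩
    lift J0 to Finset V using hJ0
    have e1 : ∀ᶠ J in (𝒰 : Filter (Finset V)), ∀ v ∈ J0, v ∉ Yf J := by
      refine (Filter.eventually_all_finset J0).2 (fun v hv => ?_)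
      exact Ultrafilter.eventually_not.2 (hJ0U hv).2
    have e2 : ∀ᶠ J in (𝒰 : Filter (Finset V)), J0 ≤ J := h𝒰 (Filter.eventually_ge_atTop J0)
    obtain ⟨J, hJ1, hJ2⟩ := (e1.and e2).exists
    refine hY3 J p hp (hJ1 p hpJ) q hq (hJ1 q hqJ) ((hJ0c p hpJ q hqJ).mono ?_)
    intro v hv
    refine ⟨?_, hJ1 v hv⟩
    simp only [B, Finset.coe_union, Finset.coe_filter, mem_union, mem_setOf_eq]
    exact Or.inl (Or.inl ⟨hJ2 hv, (hJ0U hv).1⟩))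
  have h2 := hYcard hYfin.toFinset (by simp)
  rw [Set.ncard_coe_finset, Set.ncard_eq_toFinset_card Y hYfin] at this
  omega

lemma orbit_rays {A P : Set V} {Θ : V → V} (hmap : ∀ v ∈ A, Θ v ∈ A) (hinj : InjOn Θ A) (hPA : P ⊆ A)
    (hav : ∀ v ∈ A, Θ v ∉ P) (hadj : ∀ v ∈ A, Θ v = v ∨ G.Adj v (Θ v)) {k : ℕ} (hk : k + 1 ≤ P.ncard)
    (hPf : P.Finite) :
    ∃ f : Fin (k+1) → ℕ → V, (∀ i, IsRay G (f i) ∧ ∀ n, f i n ∈ A) ∧ DisjointRays f := by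
  classical
  have hA : ∀ n, ∀ p ∈ A, Θ^[n] p ∈ A := by
    intro n
    induction n with
    | zero => intro p hp; exact hp
    | succ n ih => intro p hp; rw [Function.iterate_succ_apply]; exact ih _ (hmap p hp)
  have key : ∀ m n, ∀ p ∈ P, ∀ q ∈ P, Θ^[m] p = Θ^[n] q → m = n ∧ p = q := by
    intro m
    induction m with
    | zero =>
      intro n p hp q hq e
      cases n with
      | zero => exact ⟨rfl, e⟩
      | succ n =>
        rw [Function.iterate_succ_apply'] at e
        exact absurd (e ▸ hp) (hav _ (hA n q (hPA hq)))
    | succ m ih =>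
      intro n p hp q hq e
      cases n with
      | zero =>
        rw [Function.iterate_succ_apply'] at e
        exact absurd (e.symm ▸ hq) (hav _ (hA m p (hPA hp)))
      | succ n =>
        rw [Function.iterate_succ_apply', Function.iterate_succ_apply'] at e
        obtain ⟨h1, h2⟩ := ih n p hp q hq (hinj (hA m p (hPA hp)) (hA n q (hPA hq)) e)
        exact ⟨by omega, h2⟩
  lift P to Finset V using hPf
  rw [Set.ncard_coe_finset] at hk
  obtain ⟨e⟩ : Nonempty (Fin (k+1) ↪ P) := by
    apply Function.Embedding.nonempty_of_card_le
    simpa using hk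
  refine ⟨fun i n => Θ^[n] (e i), fun i => ⟨⟨?_, ?_⟩, fun n => hA n _ (hPA (e i).2)⟩, ?_⟩
  · intro m n h
    exact (key m n _ (e i).2 _ (e i).2 h).1
  · intro n
    have h1 := hadj _ (hA n _ (hPA (e i).2))
    change G.Adj (Θ^[n] (e i)) (Θ^[n+1] (e i))
    rw [Function.iterate_succ_apply']
    refine h1.resolve_left (fun h => ?_)
    rw [← Function.iterate_succ_apply' Θ] at h
    have := (key (n+1) n _ (e i).2 _ (e i).2 h).1
    omega
  · intro i j hij
    rw [Set.disjoint_left]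
    rintro x ⟨m, rfl⟩ ⟨n, h⟩
    have := (key n m _ (e j).2 _ (e i).2 h).2
    exact hij (e.injective (Subtype.ext this)).symm

end link


section exK
variable {V : Type} {G : SimpleGraph V} {M : Set V} {ω : ℕ → V} {k : ℕ}

lemma strip_link {C D : Set V} (hC : Region G M ω C) (hD : Region G M ω D)
    (ht : ∀ E, Region G M ω E → E ⊆ C → (NB G M C).ncard ≤ (NB G M E).ncard)
    (hDC : D ⊆ C) (hND : NB G M D ⊆ C) :
    ∃ (J : Set V) (θ : V → V), NB G M C ⊆ J ∧ NB G M D ⊆ J ∧ J ⊆ (C ∪ NB G M C) \ D ∧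
      InjOn θ (J \ NB G M D) ∧
      ∀ v ∈ J \ NB G M D, θ v ∈ J \ NB G M C ∧ (θ v = v ∨ G.Adj v (θ v)) := by
  refine linkage (W := (C ∪ NB G M C) \ D) hC.fin hD.fin ?_ ?_ ?_
  · exact fun v hv => ⟨Or.inr hv, fun h => hv.2.1 (hDC h)⟩
  · exact fun v hv => ⟨Or.inl (hND hv), hv.2.1⟩
  intro Y hY hYW hsep
  set W := (C ∪ NB G M C) \ D with hW
  let R : Set V := {x | x ∈ W \ Y ∧ ∃ q ∈ NB G M D, q ∉ Y ∧ RIn G (W \ Y) q x}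
  have hRC : R ⊆ C := by
    rintro x ⟨⟨⟨hx | hx, -⟩, hxY⟩, q, hq, hqY, hr⟩
    · exact hx
    · exact absurd hr.symm (hsep x hx hxY q hq hqY)
  have hRadj : ∀ x ∈ R, ∀ y ∈ W \ Y, G.Adj x y → y ∈ R := by
    rintro x ⟨hx, q, hq, hqY, hr⟩ y hy hxy
    exact ⟨hy, q, hq, hqY, hr.trans (RIn.single hxy hx hy)⟩
  have hNB : NB G M (D ∪ R) ⊆ Y := by
    rintro v ⟨hvM, hv, u, hu, huv⟩
    have hvD : v ∉ D := fun h => hv (Or.inl h)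
    by_contra hvY
    rcases hu with hu | hu
    · have hq : v ∈ NB G M D := ⟨hvM, hvD, u, hu, huv⟩
      exact hv (Or.inr ⟨⟨⟨Or.inl (hND hq), hvD⟩, hvY⟩, v, hq, hvY, RIn.refl _⟩)
    · have : v ∈ C ∪ NB G M C := by
        by_cases h : v ∈ C
        · exact Or.inl h
        · exact Or.inr ⟨hvM, h, u, hRC hu, huv⟩
      exact hv (Or.inr (hRadj u hu v ⟨⟨this, hvD⟩, hvY⟩ huv))
  have hreg : Region G M ω (D ∪ R) := by
    refine ⟨union_subset hD.sub (hRC.trans hC.sub), ?_, hY.subset hNB, ?_⟩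
    · obtain ⟨d, hd⟩ := hD.nonempty
      refine conn_of_base (x := d) ?_
      rintro a (ha | ha)
      · exact (hD.conn a ha d hd).mono subset_union_left
      · obtain ⟨haW, q, hq, hqY, hr⟩ := ha
        have hqR : q ∈ R := ⟨⟨⟨Or.inl (hND hq), hq.2.1⟩, hqY⟩, q, hq, hqY, RIn.refl _⟩
        obtain ⟨-, hqD, u, hu, huq⟩ := hq
        have h1 : RIn G R q a := by
          have : a ∈ {z | RIn G R q z ∧ z ∈ R} := by
            refine hr.closed ⟨RIn.refl _, hqR⟩ ?_
            rintro x ⟨hx1, hx2⟩ y hy _ hxy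
            have := hRadj x hx2 y hy hxy
            exact ⟨hx1.trans (RIn.single hxy hx2 this), this⟩
          exact this.1
        exact ((h1.symm.mono subset_union_right).trans
          (RIn.single huq.symm (Or.inr hqR) (Or.inl hu))).trans ((hD.conn u hu d hd).mono subset_union_left)
    · obtain ⟨m, hm⟩ := hD.tail
      exact ⟨m, fun n hn => Or.inl (hm n hn)⟩
  exact (ht _ hreg (union_subset hDC hRC)).trans (Set.ncard_le_ncard hNB hY)

lemma exists_tight {C : Set V} (hC : Region G M ω C) : ∃ D, Region G M ω D ∧ D ⊆ C ∧
    ∀ E, Region G M ω E → E ⊆ D → (NB G M D).ncard ≤ (NB G M E).ncard := by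
  classical
  have hex : ∃ n, ∃ D, Region G M ω D ∧ D ⊆ C ∧ (NB G M D).ncard = n := ⟨_, C, hC, subset_rfl, rfl⟩
  obtain ⟨D, hD, hDC, hn⟩ := Nat.find_spec hex
  exact ⟨D, hD, hDC, fun E hE hED => hn ▸ Nat.find_min' hex ⟨E, hE, hED.trans hDC, rfl⟩⟩

lemma Good.bound_k (h : Good G M ω k) {C' : Set V} (hC' : Region G M ω C') :
    ∃ C, Region G M ω C ∧ C ⊆ C' ∧ (NB G M C).ncard ≤ k := by
  classical
  by_contra hcon
  push Not at hcon
  let St := {C : Set V // Region G M ω C ∧ C ⊆ C' ∧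
    ∀ E, Region G M ω E → E ⊆ C → (NB G M C).ncard ≤ (NB G M E).ncard}
  have step : ∀ s : St, ∃ t : St, t.1 ⊆ s.1 ∧ NB G M t.1 ⊆ s.1 := by
    rintro ⟨C, hC, hCC, ht⟩
    obtain ⟨D, hD, hDC, hND, -⟩ := h.shrink hC finite_empty (empty_subset _)
    obtain ⟨E, hE, hED, hEt⟩ := exists_tight hD
    refine ⟨⟨E, hE, hED.trans (hDC.trans hCC), hEt⟩, hED.trans hDC, ?_⟩
    exact (NB_mono_closure hED).trans (union_subset hDC hND)
  choose nx hnx1 hnx2 using step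
  obtain ⟨E, hE, hED, hEt⟩ := exists_tight hC'
  let s : ℕ → St := fun n => Nat.rec ⟨E, hE, hED, hEt⟩ (fun _ t => nx t) n
  have hs : ∀ n, s (n+1) = nx (s n) := fun n => rfl
  let C : ℕ → Set V := fun n => (s n).1
  have hC : ∀ n, Region G M ω (C n) := fun n => (s n).2.1
  have hsub : ∀ n, C (n+1) ⊆ C n := fun n => hnx1 (s n)
  have hNsub : ∀ n, NB G M (C (n+1)) ⊆ C n := fun n => hnx2 (s n)
  have hanti : ∀ m n, m ≤ n → C n ⊆ C m := by
    intro m n hmn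
    induction n, hmn using Nat.le_induction with
    | base => exact subset_rfl
    | succ n _ ih => exact (hsub n).trans ih
  have hNanti : ∀ m n, m ≤ n → C n ∪ NB G M (C n) ⊆ C m ∪ NB G M (C m) := by
    intro m n hmn
    exact union_subset ((hanti m n hmn).trans subset_union_left) (NB_mono_closure (hanti m n hmn))
  have hl := fun n => strip_link (hC n) (hC (n+1)) (s n).2.2.2 (hsub n) (hNsub n)
  choose J θ hJ1 hJ2 hJ3 hθi hθ using hl
  let A : Set V := {v | ∃ n, v ∈ J n \ NB G M (C (n+1))}
  have huniq : ∀ v n m, v ∈ J n \ NB G M (C (n+1)) → v ∈ J m \ NB G M (C (m+1)) → n = m := by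
    have aux : ∀ v n m, v ∈ J n \ NB G M (C (n+1)) → v ∈ J m \ NB G M (C (m+1)) → ¬ n < m := by
      intro v n m hn hm hlt
      rcases hNanti (n+1) m hlt (hJ3 m hm.1).1 with h | h
      · exact (hJ3 n hn.1).2 h
      · exact hn.2 h
    intro v n m hn hm
    rcases lt_trichotomy n m with h | h | h
    · exact absurd h (aux v n m hn hm)
    · exact h
    · exact absurd h (aux v m n hm hn)
  let Θ : V → V := fun v => if h : v ∈ A then θ (Classical.choose h) v else v
  have hΘ : ∀ v n, v ∈ J n \ NB G M (C (n+1)) → Θ v = θ n v := by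
    intro v n hv
    have hA : v ∈ A := ⟨n, hv⟩
    have e := huniq v _ n (Classical.choose_spec hA) hv
    simp only [Θ, dif_pos hA]
    rw [e]
  have hJA : ∀ n, J n ⊆ A := by
    intro n v hv
    by_cases hq : v ∈ NB G M (C (n+1))
    · refine ⟨n+1, hJ1 (n+1) hq, fun h => ?_⟩
      exact hq.2.1 (hNsub (n+1) h)
    · exact ⟨n, hv, hq⟩
  have hcell : ∀ v n, v ∈ J n \ NB G M (C (n+1)) → Θ v ∈ C n ∧ Θ v ∉ C (n+1) ∧ Θ v ∈ J n := by
    intro v n hv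
    rw [hΘ v n hv]
    obtain ⟨⟨h1, h2⟩, -⟩ := hθ n v hv
    obtain ⟨h3, h4⟩ := hJ3 n h1
    exact ⟨h3.resolve_right h2, h4, h1⟩
  have hinj : InjOn Θ A := by
    rintro a ⟨n, hn⟩ b ⟨m, hm⟩ e
    obtain ⟨a1, a2, -⟩ := hcell a n hn
    obtain ⟨b1, b2, -⟩ := hcell b m hm
    have : n = m := by
      rcases lt_trichotomy n m with h | h | h
      · exact absurd (hanti (n+1) m h (e ▸ b1)) a2
      · exact h
      · exact absurd (hanti (m+1) n h (e ▸ a1)) b2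
    subst this
    rw [hΘ a n hn, hΘ b n hm] at e
    exact hθi n hn hm e
  obtain ⟨f, hf1, hf2⟩ := orbit_rays (G := G) (A := A) (P := NB G M (C 0)) (Θ := Θ) (k := k)
    (by rintro v ⟨n, hn⟩; exact hJA n (hcell v n hn).2.2) hinj
    ((hJ1 0).trans (hJA 0))
    (by rintro v ⟨n, hn⟩ hP; exact hP.2.1 (hanti 0 n (Nat.zero_le _) (hcell v n hn).1))
    (by rintro v ⟨n, hn⟩; rw [hΘ v n hn]; exact (hθ n v hn).2)
    (hcon _ (hC 0) (s 0).2.2.1) (hC 0).fin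
  refine h.h4 ⟨f, fun i => ⟨(hf1 i).1, fun n => ?_⟩, hf2⟩
  obtain ⟨m, hm⟩ := (hf1 i).2 n
  rcases (hJ3 m hm.1).1 with h | h
  · exact (hC m).sub h
  · exact h.1

lemma Good.fill (h : Good G M ω k) {K : ℕ}
    (hK : ∀ C', Region G M ω C' → ∃ C, Region G M ω C ∧ C ⊆ C' ∧ (NB G M C).ncard ≤ K)
    {C' : Set V} (hC' : Region G M ω C') :
    ∃ C, Region G M ω C ∧ C ⊆ C' ∧ (NB G M C).ncard ≤ K ∧ Conn G (M \ C) := by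
  obtain ⟨J, hJf, hJM, hJc, hJ⟩ := h.conn.finite_conn (F := insert (ω 0) (NB G M C')) (hC'.fin.insert _)
    (insert_subset (h.inM 0) NB_sub_M)
  obtain ⟨D, hD, hDC, -, hDJ⟩ := h.shrink hC' hJf hJM
  obtain ⟨C₂, hC₂, hC₂D, hcard⟩ := hK D hD
  have hJ2 : J ⊆ M \ C₂ := fun v hv => ⟨hJM hv, fun h => (hDJ v hv).1 (hC₂D h)⟩
  have h0 : ω 0 ∈ J := hJ (mem_insert _ _)
  set A := cmp G (M \ C₂) (ω 0) with hA
  have hAM : A ⊆ M \ C₂ := cmp_sub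
  have hMA : M \ (M \ A) = A := by
    rw [sdiff_sdiff_right_self]; exact inter_eq_right.2 (hAM.trans sdiff_subset)
  have hsub : C₂ ⊆ M \ A := fun v hv => ⟨hC₂.sub hv, fun h => (hAM h).2 hv⟩
  have hNB : NB G M (M \ A) ⊆ NB G M C₂ := by
    rintro v ⟨hvM, hv, u, hu, huv⟩
    have hvA : v ∈ A := by by_contra h; exact hv ⟨hvM, h⟩
    have huC : u ∈ C₂ := by
      by_contra h
      exact hu.2 (cmp_adj hvA ⟨hu.1, h⟩ huv.symm)
    exact ⟨hvM, (hAM hvA).2, u, huC, huv⟩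
  refine ⟨M \ A, ⟨sdiff_subset, ?_, hC₂.fin.subset hNB, ?_⟩, ?_, ?_, ?_⟩
  · obtain ⟨d, hd⟩ := hC₂.nonempty
    refine conn_of_base (x := d) ?_
    intro c hc
    by_cases hcC : c ∈ C₂
    · exact (hC₂.conn c hcC d hd).mono hsub
    · obtain ⟨p, y, hp, hy, hpM, hyM, hpy, hr⟩ := (h.conn c hc.1 d (hC₂.sub hd)).exit
        (T := cmp G (M \ C₂) c) hc.1 (mem_cmp_self ⟨hc.1, hcC⟩) (fun h => h.1.2 hd)
      have hyC : y ∈ C₂ := by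
        by_contra hn; exact hy (cmp_adj hp ⟨hyM, hn⟩ hpy)
      have hs : M ∩ cmp G (M \ C₂) c ⊆ M \ A := by
        rintro u ⟨hu, huc⟩
        refine ⟨hu, fun huA => hc.2 ?_⟩
        rw [hA, ← cmp_eq_of_mem huA, cmp_eq_of_mem huc]
        exact mem_cmp_self ⟨hc.1, hcC⟩
      exact ((hr.mono hs).trans (RIn.single hpy (hs ⟨hpM, hp⟩) (hsub hyC))).trans
        ((hC₂.conn y hyC d hd).mono hsub)
  · obtain ⟨m, hm⟩ := hC₂.tail
    exact ⟨m, fun n hn => hsub (hm n hn)⟩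
  · intro x hx
    by_contra hxC
    apply hx.2
    have hC'' : M \ C' ⊆ M \ C₂ := sdiff_subset_sdiff_right (hC₂D.trans hDC)
    by_cases hr : RIn G (M \ C') x (ω 0)
    · exact ⟨hC'' ⟨hx.1, hxC⟩, (hr.mono hC'').symm⟩
    · obtain ⟨p, y, hp, hy, hpM, hyM, hpy, hr'⟩ := (h.conn x hx.1 (ω 0) (h.inM 0)).exit
        (T := cmp G (M \ C') x) hx.1 (mem_cmp_self ⟨hx.1, hxC⟩) (fun h => hr h.2)
      have hyC : y ∈ C' := by
        by_contra hn; exact hy (cmp_adj hp ⟨hyM, hn⟩ hpy)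
      have hpJ : p ∈ J := hJ (mem_insert_of_mem _ ⟨hpM, hp.1.2, y, hyC, hpy.symm⟩)
      exact ⟨hC'' ⟨hx.1, hxC⟩, ((hp.2.mono hC'').trans ((hJc p hpJ _ h0).mono hJ2)).symm⟩
  · exact (Set.ncard_le_ncard hNB hC₂.fin).trans hcard
  · rw [hMA]; exact conn_cmp

/-- the critical size -/
structure Crit {V : Type} (G : SimpleGraph V) (M : Set V) (ω : ℕ → V) (K : ℕ) (C₀ : Set V) : Prop where
  reg : Region G M ω C₀
  low : ∀ C, Region G M ω C → C ⊆ C₀ → K ≤ (NB G M C).ncard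
  cof : ∀ C', Region G M ω C' → ∃ C, Region G M ω C ∧ C ⊆ C' ∧ (NB G M C).ncard ≤ K ∧ Conn G (M \ C)

lemma Good.exists_crit (h : Good G M ω k) : ∃ K C₀, Crit G M ω K C₀ := by
  classical
  have hex : ∃ K, ∀ C', Region G M ω C' → ∃ C, Region G M ω C ∧ C ⊆ C' ∧ (NB G M C).ncard ≤ K :=
    ⟨k, fun C' hC' => h.bound_k hC'⟩
  have hsp := Nat.find_spec hex
  rcases Nat.eq_zero_or_pos (Nat.find hex) with h0 | h0
  · exact ⟨_, M, h.region_M, fun C _ _ => by rw [h0]; exact Nat.zero_le _, fun C' hC' => h.fill hsp hC'⟩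
  · have := Nat.find_min hex (m := Nat.find hex - 1) (by omega)
    push Not at this
    obtain ⟨C₀, hC₀, hlow⟩ := this
    exact ⟨_, C₀, hC₀, fun C hC hCC => by have := hlow C hC hCC; omega, fun C' hC' => h.fill hsp hC'⟩

end exK


section strips
variable {V : Type} {G : SimpleGraph V} {M : Set V} {ω : ℕ → V} {k : ℕ}

lemma regions_meet {C D : Set V} (hC : Region G M ω C) (hD : Region G M ω D) : ∃ x, x ∈ C ∧ x ∈ D := by
  obtain ⟨m, hm⟩ := hC.tail
  obtain ⟨m', hm'⟩ := hD.tail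
  exact ⟨_, hm (max m m') (le_max_left _ _), hm' _ (le_max_right _ _)⟩

lemma strip_step {C D L : Set V} (hC : Region G M ω C) (hD : Region G M ω D) (hDc : Conn G (M \ D))
    (hL : Conn G L) (hLM : L ⊆ M) (hCL : NB G M C ⊆ L) (hav : ∀ v ∈ L, v ∉ NB G M D)
    {x y : V} (hx : x ∈ M \ D) (hxC : x ∉ C) (hy : y ∈ M \ D) (hyC : y ∈ C) :
    D ⊆ C ∧ NB G M D ⊆ C := by
  obtain ⟨p, q, hp, hq, hpU, hqU, hpq, -⟩ := (hDc y hy x hx).exit hy hyC hxC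
  have hqN : q ∈ NB G M C := ⟨hqU.1, hq, p, hp, hpq⟩
  have hLD : ∀ v ∈ L, v ∉ D := by
    intro v hv hvD
    exact hqU.2 (hL.sub_of_avoid hLM hv hvD hav (hCL hqN))
  obtain ⟨z, hzD, hzC⟩ := regions_meet hD hC
  have h1 : D ⊆ C := hD.conn.sub_of_avoid hD.sub hzD hzC (fun v hv hvN => hLD v (hCL hvN) hv)
  refine ⟨h1, fun v hv => ?_⟩
  rcases NB_mono_closure h1 hv with h | h
  · exact h
  · exact absurd hv (hav v (hCL h))

lemma Good.strip_aux (h : Good G M ω k) (j : ℕ) : ∀ C, Region G M ω C → ∃ C', Region G M ω C' ∧ C' ⊆ C ∧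
    ∀ D, Region G M ω D → Conn G (M \ D) → (NB G M D ∩ (C ∪ NB G M C)).ncard ≤ j →
      (∃ x ∈ M \ D, x ∉ C) → (∃ x ∈ M \ D, x ∈ C') → D ⊆ C ∧ NB G M D ⊆ C := by
  have hLex : ∀ C, Region G M ω C → ∃ L : Set V, L.Finite ∧ L ⊆ C ∪ NB G M C ∧ Conn G L ∧ NB G M C ⊆ L := by
    intro C hC
    obtain ⟨d, hd⟩ := hC.nonempty
    refine Conn.finite_conn (U := C ∪ NB G M C) ?_ hC.fin subset_union_right
    refine conn_of_base (x := d) ?_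
    rintro a (ha | ha)
    · exact (hC.conn a ha d hd).mono subset_union_left
    · obtain ⟨-, -, u, hu, hua⟩ := id ha
      exact (RIn.single hua.symm (Or.inr ha) (Or.inl hu)).trans
        ((hC.conn u hu d hd).mono subset_union_left)
  have hcl : ∀ C, Region G M ω C → C ∪ NB G M C ⊆ M := fun C hC => union_subset hC.sub NB_sub_M
  induction j with
  | zero =>
    intro C hC
    obtain ⟨L, hLf, hLC, hLc, hNL⟩ := hLex C hC
    refine ⟨C, hC, subset_rfl, ?_⟩
    rintro D hD hDc hn ⟨x, hx, hxC⟩ ⟨y, hy, hyC⟩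
    refine strip_step hC hD hDc hLc (hLC.trans (hcl C hC)) hNL ?_ hx hxC hy hyC
    intro v hv hvN
    have h0 := (Set.ncard_eq_zero (hD.fin.subset inter_subset_left)).1 (Nat.le_zero.1 hn)
    exact (h0 ▸ (⟨hvN, hLC hv⟩ : v ∈ NB G M D ∩ (C ∪ NB G M C)) : v ∈ (∅ : Set V))
  | succ j ih =>
    intro C hC
    obtain ⟨L, hLf, hLC, hLc, hNL⟩ := hLex C hC
    obtain ⟨C₁, hC₁, hC₁C, hN₁, hC₁L⟩ := h.shrink hC hLf (hLC.trans (hcl C hC))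
    obtain ⟨C', hC', hC'C, hS⟩ := ih C₁ hC₁
    refine ⟨C', hC', hC'C.trans hC₁C, ?_⟩
    rintro D hD hDc hn ⟨x, hx, hxC⟩ ⟨y, hy, hyC⟩
    by_cases hav : ∀ v ∈ L, v ∉ NB G M D
    · exact strip_step hC hD hDc hLc (hLC.trans (hcl C hC)) hNL hav hx hxC hy (hC₁C (hC'C hyC))
    · push Not at hav
      obtain ⟨v, hv, hvN⟩ := hav
      have hlt : (NB G M D ∩ (C₁ ∪ NB G M C₁)).ncard < (NB G M D ∩ (C ∪ NB G M C)).ncard := by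
        refine Set.ncard_lt_ncard ⟨inter_subset_inter_right _ ?_, fun hsub => ?_⟩
          (hD.fin.subset inter_subset_left)
        · exact union_subset (hC₁C.trans subset_union_left) (hN₁.trans subset_union_left)
        · rcases (hsub ⟨hvN, hLC hv⟩).2 with h | h
          · exact (hC₁L v hv).1 h
          · exact (hC₁L v hv).2 h
      obtain ⟨h1, h2⟩ := hS D hD hDc (by omega) ⟨x, hx, fun h => hxC (hC₁C h)⟩ ⟨y, hy, hyC⟩
      exact ⟨h1.trans hC₁C, h2.trans hC₁C⟩

lemma Good.strip (h : Good G M ω k) (K : ℕ) {C : Set V} (hC : Region G M ω C) :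
    ∃ C', Region G M ω C' ∧ C' ⊆ C ∧
    ∀ D, Region G M ω D → Conn G (M \ D) → (NB G M D).ncard ≤ K →
      (∃ x ∈ M \ D, x ∉ C) → (∃ x ∈ M \ D, x ∈ C') → D ⊆ C ∧ NB G M D ⊆ C := by
  obtain ⟨C', h1, h2, h3⟩ := h.strip_aux K C hC
  exact ⟨C', h1, h2, fun D hD hDc hn => h3 D hD hDc
    ((Set.ncard_le_ncard inter_subset_left hD.fin).trans hn)⟩

lemma push_step {C D : Set V} (hC : Region G M ω C) (hD : Region G M ω D) (hCD : C ⊆ D)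
    (hND : NB G M C ⊆ D) (ht : ∀ E, Region G M ω E → E ⊆ D → (NB G M C).ncard ≤ (NB G M E).ncard)
    {x : V} (hx : x ∈ NB G M C) : ∃ y ∈ NB G M D, RIn G ((D ∪ NB G M D) \ C) x y := by
  by_contra hcon
  push Not at hcon
  set U := (D ∪ NB G M D) \ C with hU
  have hxU : x ∈ U := ⟨Or.inl (hND hx), hx.2.1⟩
  set B := cmp G U x with hB
  have hBU : B ⊆ U := cmp_sub
  have hBD : B ⊆ D := by
    intro v hv
    exact (hBU hv).1.resolve_right (fun hN => hcon v hN hv.2)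
  have hxB : x ∈ B := mem_cmp_self hxU
  have hNE : NB G M (C ∪ B) ⊆ NB G M C \ {x} := by
    rintro v ⟨hvM, hv, u, hu, huv⟩
    have hvC : v ∉ C := fun h => hv (Or.inl h)
    have hvB : v ∉ B := fun h => hv (Or.inr h)
    refine ⟨?_, fun e => hvB (e ▸ hxB)⟩
    rcases hu with hu | hu
    · exact ⟨hvM, hvC, u, hu, huv⟩
    · exfalso
      apply hvB
      refine cmp_adj hu ⟨?_, hvC⟩ huv
      by_cases hvD : v ∈ D
      · exact Or.inl hvD
      · exact Or.inr ⟨hvM, hvD, u, hBD hu, huv⟩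
  have hreg : Region G M ω (C ∪ B) := by
    obtain ⟨m, hm⟩ := hC.tail
    refine ⟨union_subset hC.sub (hBD.trans hD.sub), ?_, hC.fin.subset (hNE.trans sdiff_subset),
      m, fun n hn => Or.inl (hm n hn)⟩
    obtain ⟨-, -, u, hu, hux⟩ := hx
    refine conn_of_base (x := u) ?_
    rintro a (ha | ha)
    · exact (hC.conn a ha u hu).mono subset_union_left
    · exact (((conn_cmp (G := G) (U := U) (a := x)) a ha x hxB).mono subset_union_right).trans
        (RIn.single hux.symm (Or.inr hxB) (Or.inl hu))
  have h1 := ht _ hreg (union_subset hCD hBD)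
  have h2 := Set.ncard_le_ncard hNE (hC.fin.subset sdiff_subset)
  have h3 := Set.ncard_sdiff_singleton_lt_of_mem hx hC.fin
  omega

lemma NB_nonempty (hM : Conn G M) {C : Set V} (hne : C.Nonempty) (hCM : C ⊆ M) {v : V} (hv : v ∈ M) (hvC : v ∉ C) :
    (NB G M C).Nonempty := by
  obtain ⟨c, hc⟩ := hne
  obtain ⟨p, q, hp, hq, hpU, hqU, hpq, -⟩ := (hM c (hCM hc) v hv).exit (hCM hc) hc hvC
  exact ⟨q, hqU, hq, p, hp, hpq⟩

lemma Crit.pos {K : ℕ} {C₀ : Set V} (hc : Crit G M ω K C₀) (h : Good G M ω k) : 0 < K := by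
  obtain ⟨C, hC, hv, -⟩ := h.h3 (ω 0) (h.inM 0)
  obtain ⟨D, hD, hDC, hn, -⟩ := hc.cof C hC
  have := NB_nonempty h.conn hD.nonempty hD.sub (h.inM 0) (fun h => hv (hDC h))
  have := (Set.ncard_pos hD.fin).2 this
  omega

lemma no_hyperbolic (h : Good G M ω k) {K : ℕ} {C₀ : Set V} (hc : Crit G M ω K C₀) {C : Set V}
    (hC : Region G M ω C) (hCC : C ⊆ C₀) (hn : (NB G M C).ncard ≤ K) {g : Equiv.Perm V}
    (hg : g ∈ Gam G M) (h1 : g '' C ⊆ C) (h2 : NB G M (g '' C) ⊆ C) : False := by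
  classical
  let D : ℕ → Set V := fun j => ((g⁻¹)^j : Equiv.Perm V) '' C
  have hgj : ∀ j : ℕ, (g⁻¹)^j ∈ Gam G M := fun j => pow_mem (inv_mem hg) j
  have hD : ∀ j, Region G M ω (D j) := fun j => h.map hC (hgj j)
  have hDg : ∀ j, D j = ((g⁻¹)^(j+1) : Equiv.Perm V) '' (g '' C) := by
    intro j
    rw [← image_comp, ← Equiv.Perm.coe_mul]
    simp [D, pow_succ]
  have hD0 : D 0 = C := by
    change ((g⁻¹)^0 : Equiv.Perm V) '' C = C
    rw [pow_zero]; ext; simp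
  have hsub : ∀ j, D j ⊆ D (j+1) := by
    intro j; rw [hDg j]; exact image_mono h1
  have hNsub : ∀ j, NB G M (D j) ⊆ D (j+1) := by
    intro j; rw [hDg j, NB_map (hgj _)]; exact image_mono h2
  have hmono : ∀ i j, i ≤ j → D i ⊆ D j := by
    intro i j hij
    induction j, hij using Nat.le_induction with
    | base => exact subset_rfl
    | succ j _ ih => exact ih.trans (hsub j)
  have hstep : ∀ j, ∀ x ∈ NB G M (D j), ∃ y ∈ NB G M (D (j+1)),
      RIn G ((D (j+1) ∪ NB G M (D (j+1))) \ D j) x y := by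
    intro j x hx
    refine push_step (hD j) (hD (j+1)) (hsub j) (hNsub j) ?_ hx
    intro E hE hED
    have e1 : (NB G M (D j)).ncard = (NB G M C).ncard := NB_map_card (hgj j) C
    have hinv := inv_mem (hgj (j+1))
    have := hc.low _ (h.map hE hinv) (by
      refine Subset.trans ?_ hCC
      calc _ ⊆ (((g⁻¹)^(j+1))⁻¹ : Equiv.Perm V) '' (D (j+1)) := image_mono hED
        _ = C := image_inv_image _)
    rw [NB_map_card hinv] at this
    omega
  choose! nx hnx1 hnx2 using hstep
  have hpos : (NB G M C).Nonempty := by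
    rw [← Set.ncard_pos hC.fin]
    exact lt_of_lt_of_le (hc.pos h) (hc.low C hC hCC)
  obtain ⟨x0, hx0⟩ := hpos
  let x : ℕ → V := fun n => Nat.rec x0 (fun j t => nx j t) n
  have hx : ∀ n, x n ∈ NB G M (D n) := by
    intro n
    induction n with
    | zero => rw [hD0]; exact hx0
    | succ n ih => exact hnx1 n _ ih
  have hr : ∀ n, RIn G ((D (n+1) ∪ NB G M (D (n+1))) \ D n) (x n) (x (n+1)) := fun n => hnx2 n _ (hx n)
  have hCD : ∀ n, C ⊆ D n := fun n => by
    have := hmono 0 n (Nat.zero_le _); rwa [hD0] at this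
  have hTU : ∀ n, (D (n+1) ∪ NB G M (D (n+1))) \ D n ⊆ M \ C := fun n v hv =>
    ⟨union_subset (hD _).sub NB_sub_M hv.1, fun h => hv.2 (hCD n h)⟩
  have hxT : ∀ n, x n ∈ (D (n+1) ∪ NB G M (D (n+1))) \ D n := fun n =>
    ⟨Or.inl (hNsub n (hx n)), (hx n).2.1⟩
  obtain ⟨r, hrr, hrU⟩ := exists_ray (U := M \ C) x (fun j => hTU j (hxT j)) (fun j => (hr j).mono (hTU j)) (by
    intro S hS
    have : ∀ᶠ j in Filter.atTop, ∀ v ∈ S, v ∉ (D (j+1) ∪ NB G M (D (j+1))) \ D j := by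
      refine (Filter.eventually_all_finite hS).2 (fun v _ => ?_)
      rw [Filter.eventually_atTop]
      by_cases hv : ∃ i, v ∈ (D (i+1) ∪ NB G M (D (i+1))) \ D i
      · obtain ⟨i, hi⟩ := hv
        refine ⟨i+2, fun j hj hvj => hvj.2 (hmono (i+2) j hj ?_)⟩
        rcases hi.1 with h | h
        · exact hsub _ h
        · exact hNsub _ h
      · exact ⟨0, fun j _ hvj => hv ⟨j, hvj⟩⟩
    obtain ⟨J, hJ⟩ := Filter.eventually_atTop.1 this
    refine ⟨J, fun j hj => ⟨fun hS => hJ j hj _ hS (hxT j), (hr j).mono ?_⟩⟩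
    exact fun v hv => ⟨hTU j hv, fun hS => hJ j hj v hS hv⟩)
  obtain ⟨m, hm⟩ := h.h2 r hrr (fun n => (hrU n).1) C hC
  exact (hrU m).2 (hm m le_rfl)

end strips

section bounded
variable {V : Type} {G : SimpleGraph V} {M : Set V} {ω : ℕ → V} {k : ℕ}

lemma closure_ind {F : Set (Equiv.Perm V)} (hinv : ∀ f ∈ F, f⁻¹ ∈ F) {p : Equiv.Perm V → Prop} (h1 : p 1)
    (hm : ∀ w ∈ Subgroup.closure F, p w → ∀ f ∈ F, p (w * f)) : ∀ w ∈ Subgroup.closure F, p w := by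
  intro w hw
  induction hw using Subgroup.closure_induction_right with
  | one => exact h1
  | mul_right x hx y hy ih => exact hm x hx ih y hy
  | mul_inv_cancel x hx y hy ih => exact hm x hx ih _ (hinv y hy)

lemma words (h : Good G M ω k) {K : ℕ} {C₀ : Set V} (hc : Crit G M ω K C₀) {C : Set V}
    (hC : Region G M ω C) (hn : (NB G M C).ncard ≤ K) (hcc : Conn G (M \ C)) (hCC : C ⊆ C₀)
    {F : Set (Equiv.Perm V)} (hF : ∀ f ∈ F, f ∈ Gam G M) (hinv : ∀ f ∈ F, f⁻¹ ∈ F)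
    (hFC : ∀ f ∈ F, f '' C ⊆ C₀) (h0 : ω 0 ∉ C) (h0F : ∀ f ∈ F, ω 0 ∉ f '' C) :
    ∀ w ∈ Subgroup.closure F, ∃ D, Region G M ω D ∧ D ⊆ C ∧ D ⊆ w '' C ∧ (NB G M D).ncard ≤ K ∧
      Conn G (M \ D) := by
  have hcl : Subgroup.closure F ≤ Gam G M := (Subgroup.closure_le _).2 hF
  refine closure_ind hinv ⟨C, hC, subset_rfl, by simp, hn, hcc⟩ ?_
  rintro w hw ⟨D, hD, hDC, hDw, hDn, hDc⟩ f hf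
  have hwM := hcl hw
  have hwf : w * f ∈ Gam G M := mul_mem hwM (hF f hf)
  have hE : Region G M ω ((w * f) '' C) := h.map hC hwf
  have hEe : (w * f) '' C = w '' (f '' C) := by rw [← image_comp, ← Equiv.Perm.coe_mul]
  have hEn : (NB G M ((w * f) '' C)).ncard ≤ K := by rw [NB_map_card hwf]; exact hn
  have hU := hD.union hE
  have hUn : K ≤ (NB G M (D ∪ (w * f) '' C)).ncard := by
    rw [← NB_map_card (inv_mem hwM)]
    refine hc.low _ (h.map hU (inv_mem hwM)) ?_
    rw [image_union, hEe, image_inv_image]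
    refine union_subset ?_ (hFC f hf)
    exact (image_mono hDw).trans ((image_inv_image C).subset.trans hCC)
  have hsm := NB_submod hD.fin hE.fin
  obtain ⟨E, hER, hEsub, hENB, hEc⟩ := hD.inter h.ray hE
  refine ⟨E, hER, hEsub.trans (inter_subset_left.trans hDC), hEsub.trans inter_subset_right, ?_, hEc h.conn ?_⟩
  · have := Set.ncard_le_ncard hENB ((hD.fin.union hE.fin).subset NB_inter_sub)
    omega
  · rw [sdiff_inter]
    refine hDc.union (conn_compl_map hwf hcc) (x := w (ω 0)) ?_ ?_
    · refine ⟨(Gam.mem_iff hwM _).2 (h.inM 0), fun hd => ?_⟩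
      obtain ⟨y, hy, e⟩ := hDw hd
      exact h0 (w.injective e ▸ hy)
    · refine ⟨(Gam.mem_iff hwM _).2 (h.inM 0), fun hd => ?_⟩
      rw [hEe] at hd
      obtain ⟨y, hy, e⟩ := hd
      exact h0F f hf (w.injective e ▸ hy)

lemma bounded (h : Good G M ω k) {K : ℕ} {C₀ : Set V} (hc : Crit G M ω K C₀) {C₁ : Set V}
    (hC₁ : Region G M ω C₁)
    {F : Set (Equiv.Perm V)} (hFf : F.Finite) (hF : ∀ f ∈ F, f ∈ Gam G M) (hinv : ∀ f ∈ F, f⁻¹ ∈ F) :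
    ∃ D, Region G M ω D ∧ ∀ w ∈ Subgroup.closure F, D ⊆ w '' C₁ := by
  have hcl : Subgroup.closure F ≤ Gam G M := (Subgroup.closure_le _).2 hF
  -- choose C
  obtain ⟨E1, hE1, hE1C, hE1f⟩ := Region.finInter h.ray hFf (fun f => f '' C₀)
    (fun f hf => h.map hc.reg (hF f hf)) hc.reg
  obtain ⟨E2, hE2, hE2C, -⟩ := hE1.inter h.ray hC₁
  obtain ⟨E3, hE3, hE3C, -, hE3F⟩ := h.shrink hE2 (F := insert (ω 0) ((fun f : Equiv.Perm V => f (ω 0)) '' F))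
    ((hFf.image _).insert _) (by
      refine insert_subset (h.inM 0) ?_
      rintro _ ⟨f, hf, rfl⟩
      exact (Gam.mem_iff (hF f hf) _).2 (h.inM 0))
  obtain ⟨C, hC, hCE, hCn, hCc⟩ := hc.cof E3 hE3
  have hCE1 : C ⊆ E1 := (hCE.trans hE3C).trans (hE2C.trans inter_subset_left)
  have hCC₁ : C ⊆ C₁ := (hCE.trans hE3C).trans (hE2C.trans inter_subset_right)
  have hCC₀ := hCE1.trans hE1C
  have h0 : ω 0 ∉ C := fun hh => (hE3F _ (mem_insert _ _)).1 (hCE hh)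
  have h0F : ∀ f ∈ F, ω 0 ∉ f '' C := by
    rintro f hf ⟨y, hy, e⟩
    refine (hE3F (f⁻¹ (ω 0)) (mem_insert_of_mem _ ⟨f⁻¹, hinv f hf, rfl⟩)).1 ?_
    rw [← e]; simpa using hCE hy
  have hFC : ∀ f ∈ F, f '' C ⊆ C₀ := by
    intro f hf
    have := image_mono (f := f) (hCE1.trans (hE1f _ (hinv f hf)))
    rwa [image_image_inv] at this
  have hW := words h hc hC hCn hCc hCC₀ hF hinv hFC h0 h0F
  suffices hs : ∃ D, Region G M ω D ∧ ∀ w ∈ Subgroup.closure F, D ⊆ w '' C by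
    obtain ⟨D, hD, hDw⟩ := hs
    exact ⟨D, hD, fun w hw => (hDw w hw).trans (image_mono hCC₁)⟩
  by_contra hcon
  push Not at hcon
  obtain ⟨Cp, hCp, hCpC, hCpf⟩ := Region.finInter h.ray hFf (fun f => f '' C)
    (fun f hf => h.map hC (hF f hf)) hC
  obtain ⟨Q0, hQ0, hQ0C, hQ0s⟩ := h.strip K hCp
  obtain ⟨Q, hQ, hQC, hQn, hQc⟩ := hc.cof Q0 hQ0
  obtain ⟨Q', hQ', hQ'C, hQ's⟩ := h.strip K hQ
  obtain ⟨w, hw, hwQ⟩ := hcon Q' hQ'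
  obtain ⟨D, hD, hDC, hDw, hDn, hDc⟩ := hW w hw
  have hex : ∃ v ∈ Subgroup.closure F, D ⊆ v '' C ∧ ∃ f ∈ F, ¬ D ⊆ (v * f) '' C := by
    by_contra hno
    push Not at hno
    obtain ⟨v, hv, hvD⟩ := hcon D hD
    refine hvD (closure_ind hinv (p := fun v => D ⊆ v '' C) (by simpa using hDC) ?_ v hv)
    exact fun u hu hDu f hf => hno u hu hDu f hf
  obtain ⟨v, hv, hvD, f, hf, hvf⟩ := hex
  have hvM := hcl hv
  have hQQ : Q ⊆ C := hQC.trans (hQ0C.trans hCpC)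
  have hEreg : Region G M ω ((v⁻¹ : Equiv.Perm V) '' D) := h.map hD (inv_mem hvM)
  have hEC : (v⁻¹ : Equiv.Perm V) '' D ⊆ C := (image_mono hvD).trans (image_inv_image C).subset
  by_cases hcase : Q ⊆ (v⁻¹ : Equiv.Perm V) '' D
  · have hvQ : v '' Q ⊆ D := by
      have := image_mono (f := v) hcase
      rwa [image_image_inv] at this
    have := hQ's (v '' Q) (h.map hQ hvM) (conn_compl_map hvM hQc) (by rw [NB_map_card hvM]; exact hQn)
      ⟨ω 0, ⟨h.inM 0, fun hh => h0 (hDC (hvQ hh))⟩, fun hh => h0 (hQQ hh)⟩ (by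
        obtain ⟨x, hx, hxw⟩ := not_subset.1 hwQ
        exact ⟨x, ⟨hQ'.sub hx, fun hh => hxw (hDw (hvQ hh))⟩, hx⟩)
    exact no_hyperbolic h hc hQ (hQQ.trans hCC₀) hQn hvM this.1 this.2
  · have := hQ0s _ hEreg (conn_compl_map (inv_mem hvM) hDc) (by rw [NB_map_card (inv_mem hvM)]; exact hDn)
      ⟨ω 0, ⟨h.inM 0, fun hh => h0 (hEC hh)⟩, fun hh => h0 (hCpC hh)⟩ (by
        obtain ⟨x, hx, hxw⟩ := not_subset.1 hcase
        exact ⟨x, ⟨hQ.sub hx, hxw⟩, hQC hx⟩)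
    have h2 := image_mono (f := v) (this.1.trans (hCpf f hf))
    rw [image_image_inv, ← image_comp, ← Equiv.Perm.coe_mul] at h2
    exact hvf h2

/-- invariant region -/
lemma inv_region (h : Good G M ω k) {K : ℕ} {C₀ : Set V} (hc : Crit G M ω K C₀) {C₁ : Set V}
    (hC₁₀ : C₁ ⊆ C₀) {Δ : Subgroup (Equiv.Perm V)} (hΔ : Δ ≤ Gam G M) {D : Set V}
    (hD : Region G M ω D) (hDw : ∀ w ∈ Δ, D ⊆ w '' C₁) :
    ∃ C, Region G M ω C ∧ C ⊆ C₁ ∧ (NB G M C).ncard ≤ K ∧ ∀ w ∈ Δ, w '' C = C := by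
  classical
  let 𝓔 : Set (Set V) := {E | Region G M ω E ∧ (NB G M E).ncard ≤ K ∧ ∀ w ∈ Δ, E ⊆ w '' C₁}
  have h1 : ∀ E ∈ 𝓔, E ⊆ C₁ := fun E hE => by simpa using hE.2.2 1 (one_mem _)
  obtain ⟨E0, hE0, hE0D, hE0n, -⟩ := hc.cof D hD
  have hE0m : E0 ∈ 𝓔 := ⟨hE0, hE0n, fun w hw => hE0D.trans (hDw w hw)⟩
  have hun : ∀ E ∈ 𝓔, ∀ E' ∈ 𝓔, E ∪ E' ∈ 𝓔 := by
    intro E hE E' hE'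
    refine ⟨hE.1.union hE'.1, ?_, fun w hw => union_subset (hE.2.2 w hw) (hE'.2.2 w hw)⟩
    obtain ⟨I, hI, hIs, hIN, -⟩ := hE.1.inter h.ray hE'.1
    have := NB_submod hE.1.fin hE'.1.fin
    have h2 := Set.ncard_le_ncard hIN ((hE.1.fin.union hE'.1.fin).subset NB_inter_sub)
    have h3 := hc.low I hI (hIs.trans (inter_subset_left.trans ((h1 E hE).trans hC₁₀)))
    have := hE.2.1
    have := hE'.2.1
    omega
  have hmap : ∀ w ∈ Δ, ∀ E ∈ 𝓔, w '' E ∈ 𝓔 := by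
    intro w hw E hE
    refine ⟨h.map hE.1 (hΔ hw), by rw [NB_map_card (hΔ hw)]; exact hE.2.1, fun u hu => ?_⟩
    have := image_mono (f := w) (hE.2.2 (w⁻¹ * u) (mul_mem (inv_mem hw) hu))
    rwa [← image_comp, ← Equiv.Perm.coe_mul, mul_inv_cancel_left] at this
  have hfin : ∀ F : Finset V, (F : Set V) ⊆ NB G M (⋃₀ 𝓔) → ∃ E ∈ 𝓔, (F : Set V) ⊆ NB G M E := by
    intro F
    induction F using Finset.induction_on with
    | empty => exact fun _ => ⟨E0, hE0m, by simp⟩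
    | insert a s ha ih =>
      intro hs
      rw [Finset.coe_insert] at hs
      obtain ⟨E, hE, hsE⟩ := ih ((subset_insert _ _).trans hs)
      obtain ⟨haM, haU, u, ⟨E', hE', hu⟩, hua⟩ := hs (mem_insert _ _)
      have hnot : ∀ x ∈ NB G M (⋃₀ 𝓔), x ∉ E ∪ E' := fun x hx hx' => hx.2.1 ⟨_, hun E hE E' hE', hx'⟩
      refine ⟨E ∪ E', hun E hE E' hE', ?_⟩
      rw [Finset.coe_insert]
      rintro x (rfl | hx)
      · exact ⟨haM, hnot _ (hs (mem_insert _ _)), u, Or.inr hu, hua⟩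
      · obtain ⟨hxM, -, y, hy, hyx⟩ := hsE hx
        exact ⟨hxM, hnot x (hs (mem_insert_of_mem _ hx)), y, Or.inl hy, hyx⟩
  have hcard : ∀ F : Finset V, (F : Set V) ⊆ NB G M (⋃₀ 𝓔) → F.card ≤ K := by
    intro F hF
    obtain ⟨E, hE, hFE⟩ := hfin F hF
    have := Set.ncard_le_ncard hFE hE.1.fin
    rw [Set.ncard_coe_finset] at this
    exact this.trans hE.2.1
  have hNf : (NB G M (⋃₀ 𝓔)).Finite := by
    by_contra hinf
    obtain ⟨F, hF, hFc⟩ := Set.Infinite.exists_subset_card_eq hinf (K+1)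
    have := hcard F hF
    omega
  obtain ⟨m, hm⟩ := hE0.tail
  refine ⟨⋃₀ 𝓔, ⟨sUnion_subset fun E hE => hE.1.sub, ?_, hNf, m, fun n hn => ⟨E0, hE0m, hm n hn⟩⟩,
    sUnion_subset h1, ?_, ?_⟩
  · rintro a ⟨E, hE, ha⟩ b ⟨E', hE', hb⟩
    exact ((hun E hE E' hE').1.conn a (Or.inl ha) b (Or.inr hb)).mono (subset_sUnion_of_mem (hun E hE E' hE'))
  · have := hcard hNf.toFinset (by simp)
    rwa [Set.ncard_eq_toFinset_card _ hNf]
  · have hsub : ∀ w ∈ Δ, w '' (⋃₀ 𝓔) ⊆ ⋃₀ 𝓔 := by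
      rintro w hw _ ⟨x, ⟨E, hE, hx⟩, rfl⟩
      exact ⟨_, hmap w hw E hE, mem_image_of_mem _ hx⟩
    intro w hw
    refine (hsub w hw).antisymm ?_
    have := image_mono (f := w) (hsub _ (inv_mem hw))
    rwa [image_image_inv] at this

end bounded

section dich
variable {V : Type} {G : SimpleGraph V} {M : Set V} {ω : ℕ → V} {k : ℕ}

lemma exists_moved {Z : Set V} (hne : Gam G Z ≠ ⊥) : ∃ g ∈ Gam G Z, ∃ v ∈ Z, g v ≠ v := by
  obtain ⟨⟨g, hg⟩, h1⟩ := Subgroup.ne_bot_iff_exists_ne_one.1 hne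
  have h1 : g ≠ 1 := fun e => h1 (Subtype.ext e)
  have : ∃ v, g v ≠ v := by
    by_contra hno
    push Not at hno
    exact h1 (Equiv.ext hno)
  obtain ⟨v, hv⟩ := this
  refine ⟨g, hg, v, ?_, hv⟩
  by_contra hvZ
  exact hv (Gam.fix hg hvZ)

lemma continuum_of_nontrivial (h : Good G M ω k) (hne : ∀ C, Region G M ω C → Gam G C ≠ ⊥) :
    𝔠 ≤ #(Gam G M) := by
  classical
  let St := {s : Set V × Set (Equiv.Perm V) // Region G M ω s.1 ∧ s.2.Finite ∧ ∀ p ∈ s.2, p ∈ Gam G M}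
  have step : ∀ s : St, ∃ (t : St) (g : Equiv.Perm V) (v : V), g ∈ Gam G s.1.1 ∧ g v ≠ v ∧ v ∈ s.1.1 ∧
      v ∉ t.1.1 ∧ t.1.1 ⊆ s.1.1 ∧ NB G M t.1.1 ⊆ s.1.1 ∧ (∀ p ∈ s.1.2, p ∈ t.1.2 ∧ p * g ∈ t.1.2) ∧
      ∀ p ∈ t.1.2, p '' t.1.1 ⊆ s.1.1 := by
    rintro ⟨⟨C, P⟩, hC, hP, hPM⟩
    dsimp only at hC hP hPM
    obtain ⟨g, hg, v, hvC, hgv⟩ := exists_moved (hne C hC)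
    have hgM : g ∈ Gam G M := Gam_mono hC.sub hg
    have hQf : (P ∪ (fun p => p * g) '' P).Finite := hP.union (hP.image _)
    have hQM : ∀ p ∈ P ∪ (fun p => p * g) '' P, p ∈ Gam G M := by
      rintro p (hp | ⟨p, hp, rfl⟩)
      · exact hPM p hp
      · exact mul_mem (hPM p hp) hgM
    obtain ⟨E, hE, hEC, hEp⟩ := Region.finInter h.ray hQf (fun p => (p⁻¹ : Equiv.Perm V) '' C)
      (fun p hp => h.map hC (inv_mem (hQM p hp))) hC
    obtain ⟨D, hD, hDE, hDN, hDv⟩ := h.shrink hE (F := {v}) (finite_singleton _) (by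
      rintro _ rfl; exact hC.sub hvC)
    refine ⟨⟨(D, P ∪ (fun p => p * g) '' P), hD, hQf, hQM⟩, g, v, hg, hgv, hvC, (hDv v rfl).1, hDE.trans hEC,
      hDN.trans hEC, fun p hp => ⟨Or.inl hp, Or.inr ⟨p, hp, rfl⟩⟩, fun p hp => ?_⟩
    have := image_mono (f := p) (hDE.trans (hEp p hp))
    rwa [image_image_inv] at this
  choose nx g v hg hgv hvC hvt hts hNt hPt hPs using step
  let s0 : St := ⟨(M, {1}), h.region_M, finite_singleton _, by rintro _ rfl; exact one_mem _⟩
  let s : ℕ → St := fun n => Nat.rec s0 (fun _ t => nx t) n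
  have hs : ∀ n, s (n+1) = nx (s n) := fun n => rfl
  have hsub : ∀ n, (s (n+1)).1.1 ⊆ (s n).1.1 := fun n => hts (s n)
  have hanti : Antitone (fun n => (s n).1.1) := antitone_nat_of_succ_le hsub
  have hpp : ∀ T n, pprod (fun n => g (s n)) T n ∈ (s n).1.2 := by
    intro T n
    induction n with
    | zero => exact rfl
    | succ n ih =>
      have := hPt (s n) _ ih
      rw [pprod]
      split
      · exact this.2
      · rw [mul_one]; exact this.1
  refine infinite_product (fun n => g (s n)) (fun n => Gam_mono (s n).2.1.sub (hg (s n)))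
    (fun n => ((s n).1.1)ᶜ) (fun a b hab => compl_subset_compl.2 (hanti hab)) ?_ ?_ ?_ ?_
  · intro x
    by_contra hx
    push Not at hx
    have hx' : ∀ n, x ∈ (s n).1.1 := fun n => by
      have := hx n
      simpa using this
    have hv0 : v (s 0) ∈ M := (s 0).2.1.sub (hvC (s 0))
    have : v (s 0) ∈ {y | ∀ n, y ∈ (s n).1.1} := by
      refine (h.conn x ((s 0).2.1.sub (hx' 0)) _ hv0).closed hx' ?_
      intro a ha b hb _ hab n
      by_cases hbn : b ∈ (s (n+1)).1.1
      · exact hsub n hbn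
      · exact hNt (s n) ⟨hb, hbn, a, ha (n+1), hab⟩
    exact hvt (s 0) (this 1)
  · intro n x hx
    exact Gam.fix (hg (s n)) hx
  · intro n
    exact ⟨v (s n), hvt (s n), hgv (s n)⟩
  · intro T m x hx hx'
    refine hx (hPs (s m) _ (hpp T (m+1)) ⟨_, hx', ?_⟩)
    simp

lemma map_eq_of_fix_NB (h : Good G M ω k) {C : Set V} (hC : Region G M ω C) {g : Equiv.Perm V}
    (hg : g ∈ Gam G M) (hfix : ∀ s ∈ NB G M C, g s = s) : g '' C = C := by
  have hgC := h.map hC hg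
  have hN : NB G M (g '' C) = NB G M C := by
    rw [NB_map hg]
    exact (image_congr hfix).trans (image_id _)
  obtain ⟨x, hx1, hx2⟩ := regions_meet hgC hC
  refine Subset.antisymm ?_ ?_
  · refine hgC.conn.sub_of_avoid hgC.sub hx1 hx2 (fun v hv hv' => ?_)
    rw [← hN] at hv'
    exact hv'.2.1 hv
  · refine hC.conn.sub_of_avoid hC.sub hx2 hx1 (fun v hv hv' => ?_)
    rw [hN] at hv'
    exact hv'.2.1 hv

lemma fix_of_fix_NB (h : Good G M ω k) {C : Set V} (hC : Region G M ω C) (hbot : Gam G C = ⊥) {g : Equiv.Perm V}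
    (hg : g ∈ Gam G M) (hfix : ∀ s ∈ NB G M C, g s = s) : g ∈ Gam G (M \ (C ∪ NB G M C)) := by
  have he := map_eq_of_fix_NB h hC hg hfix
  obtain ⟨f, hf, hfg⟩ := restrict (C := C) hg.1 (fun x => by
    conv_lhs => rw [← he]
    exact g.injective.mem_set_image) (by
    rintro v hv ⟨u, hu, huv⟩
    by_cases hvM : v ∈ M
    · exact hfix v ⟨hvM, hv, u, hu, huv⟩
    · exact Gam.fix hg hvM)
  rw [hbot, Subgroup.mem_bot] at hf
  subst hf
  refine ⟨hg.1, fun v hv => ?_⟩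
  by_cases hvM : v ∈ M
  · by_cases hvC : v ∈ C
    · exact (hfg v hvC).symm
    · by_cases hvN : v ∈ NB G M C
      · exact hfix v hvN
      · exact absurd ⟨hvM, fun hh => hh.elim hvC hvN⟩ hv
  · exact Gam.fix hg hvM

lemma stab_finite (h : Good G M ω k) (hcont : ¬ 𝔠 ≤ #(Gam G M)) {C : Set V} (hC : Region G M ω C)
    (hbot : Gam G C = ⊥) : {g | g ∈ Gam G M ∧ ∀ s ∈ NB G M C, g s = s}.Finite := by
  have hray : ¬ ∃ r, IsRay G r ∧ ∀ n, r n ∈ M \ (C ∪ NB G M C) := by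
    rintro ⟨r, hr, hrM⟩
    obtain ⟨m, hm⟩ := h.h2 r hr (fun n => (hrM n).1) C hC
    exact (hrM m).2 (Or.inl (hm m le_rfl))
  rcases rayless_dichotomy hray with hf | hf
  · exact hf.subset (fun g hg => fix_of_fix_NB h hC hbot hg.1 hg.2)
  · exact absurd (cont_mono sdiff_subset hf) hcont

lemma Good.dichotomy (h : Good G M ω k) : FC G M := by
  classical
  by_cases hcont : 𝔠 ≤ #(Gam G M)
  · exact Or.inr hcont
  left
  obtain ⟨K, C₀, hc⟩ := h.exists_crit
  have hex : ∃ C, Region G M ω C ∧ Gam G C = ⊥ := by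
    by_contra hno
    push Not at hno
    exact hcont (continuum_of_nontrivial h hno)
  obtain ⟨C, hC, hCb⟩ := hex
  obtain ⟨C₁, hC₁, hC₁s, -⟩ := hC.inter h.ray hc.reg
  have hC₁₀ : C₁ ⊆ C₀ := hC₁s.trans inter_subset_right
  have hbot : ∀ E, E ⊆ C₁ → Gam G E = ⊥ := by
    intro E hE
    rw [eq_bot_iff, ← hCb]
    exact Gam_mono (hE.trans (hC₁s.trans inter_subset_left))
  by_cases hbd : ∃ D, Region G M ω D ∧ ∀ w ∈ Gam G M, D ⊆ w '' C₁
  · obtain ⟨D, hD, hDw⟩ := hbd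
    obtain ⟨E, hE, hE1, hEn, hEw⟩ := inv_region h hc hC₁₀ le_rfl hD hDw
    refine finite_of_stab _ hE.fin (fun g hg s hs => ?_) (stab_finite h hcont hE (hbot E hE1))
    have := NB_map hg E
    rw [hEw g hg] at this
    rw [this]; exact mem_image_of_mem _ hs
  push Not at hbd
  have hU1 : ∀ E, Region G M ω E → ∀ f ∈ Gam G (M \ E), f = 1 := by
    intro E hE f hf
    obtain ⟨E1, hE1, hE1s, -⟩ := hE.inter h.ray hC₁
    obtain ⟨C', hC', hC's, hC'n, hC'c⟩ := hc.cof E1 hE1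
    obtain ⟨C'', hC'', hC''s, hst⟩ := h.strip K hC'
    obtain ⟨ψ, hψ, hψC⟩ := hbd C'' hC''
    have hC'1 : C' ⊆ C₁ := hC's.trans (hE1s.trans inter_subset_right)
    have hC'E : C' ⊆ E := hC's.trans (hE1s.trans inter_subset_left)
    by_cases hx : ∃ x ∈ M \ ψ '' C', x ∉ C'
    · exfalso
      have := hst _ (h.map hC' hψ) (conn_compl_map hψ hC'c) (by rw [NB_map_card hψ]; exact hC'n) hx (by
        obtain ⟨x, hx, hxw⟩ := not_subset.1 hψC
        exact ⟨x, ⟨hC''.sub hx, fun hh => hxw (image_mono hC'1 hh)⟩, hx⟩)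
      exact no_hyperbolic h hc hC' (hC'1.trans hC₁₀) hC'n hψ this.1 this.2
    · push Not at hx
      have hfM : f ∈ Gam G M := Gam_mono sdiff_subset hf
      have hm : ψ * f * ψ⁻¹ ∈ Gam G C₁ := by
        have h0 : ψ * f * ψ⁻¹ ∈ Gam G M := mul_mem (mul_mem hψ hfM) (inv_mem hψ)
        refine ⟨h0.1, fun v hv => ?_⟩
        by_cases hvM : v ∈ M
        · by_cases hvC : v ∈ ψ '' C'
          · obtain ⟨y, hy, rfl⟩ := hvC
            have : f y = y := Gam.fix hf (fun hh => hh.2 (hC'E hy))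
            simp [this]
          · exact absurd (hC'1 (hx v ⟨hvM, hvC⟩)) hv
        · exact Gam.fix h0 hvM
      rw [hbot C₁ subset_rfl, Subgroup.mem_bot] at hm
      have : f = ψ⁻¹ * (ψ * f * ψ⁻¹) * ψ := by group
      rw [this, hm]; simp
  by_contra hinf
  obtain ⟨F, hF, hFc⟩ := Set.Infinite.exists_subset_card_eq hinf (K^K+1)
  let F' : Set (Equiv.Perm V) := (F : Set _) ∪ (fun f => f⁻¹) '' (F : Set _)
  have hF'f : F'.Finite := F.finite_toSet.union (F.finite_toSet.image _)
  have hF'M : ∀ f ∈ F', f ∈ Gam G M := by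
    rintro f (hf | ⟨f, hf, rfl⟩)
    · exact hF hf
    · exact inv_mem (hF hf)
  obtain ⟨D, hD, hDw⟩ := bounded h hc hC₁ hF'f hF'M (by
    rintro f (hf | ⟨f, hf, rfl⟩)
    · exact Or.inr ⟨f, hf, rfl⟩
    · left; simpa using hf)
  have hcl : Subgroup.closure F' ≤ Gam G M := (Subgroup.closure_le _).2 hF'M
  obtain ⟨E, hE, hE1, hEn, hEw⟩ := inv_region h hc hC₁₀ hcl hD hDw
  have hpres : ∀ f ∈ F, ∀ s ∈ NB G M E, f s ∈ NB G M E := by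
    intro f hf s hs
    have hfc : f ∈ Subgroup.closure F' := Subgroup.subset_closure (Or.inl hf)
    have := NB_map (hcl hfc) E
    rw [hEw f hfc] at this
    rw [this]; exact mem_image_of_mem _ hs
  have : Finite (NB G M E) := hE.fin
  let Φ : F → (NB G M E → NB G M E) := fun f s => ⟨f.1 s.1, hpres f.1 f.2 s.1 s.2⟩
  have hΦ : Function.Injective Φ := by
    intro a b hab
    have hmem : b.1⁻¹ * a.1 ∈ Gam G M := mul_mem (inv_mem (hF b.2)) (hF a.2)
    have h1 := fix_of_fix_NB h hE (hbot E hE1) hmem (by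
      intro s hs
      have := congrArg Subtype.val (congrFun hab ⟨s, hs⟩)
      change a.1 s = b.1 s at this
      rw [Equiv.Perm.mul_apply, this]; simp)
    have h2 := hU1 E hE _ (Gam_mono (sdiff_subset_sdiff_right subset_union_left) h1)
    exact Subtype.ext (inv_mul_eq_one.1 h2).symm
  have hcard := Nat.card_le_card_of_injective Φ hΦ
  rw [Nat.card_fun] at hcard
  have e1 : Nat.card (NB G M E) = (NB G M E).ncard := Nat.card_coe_set_eq _
  have e2 : Nat.card F = K^K+1 := by rw [Nat.card_eq_fintype_card, Fintype.card_coe, hFc]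
  rw [e1, e2] at hcard
  have := (Nat.pow_le_pow_left hEn (NB G M E).ncard).trans (Nat.pow_le_pow_right (hc.pos h) hEn)
  omega

end dich


structure DSt {V : Type} {n : ℕ} (D : Set V) (W : Fin n → Set V) (hd : Fin n → V) : Prop where
  fin : ∀ i, (W i).Finite
  disj : ∀ i j, i ≠ j → Disjoint (W i) (W j)
  mem : ∀ i, hd i ∈ W i
  memD : ∀ i, hd i ∈ D

section final
variable {V : Type} {G : SimpleGraph V} {ω : ℕ → V} {k : ℕ}

lemma dst_step {n : ℕ} {D : Set V} (hD : D.Infinite)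
    (hcon : ∀ S : Set V, S.Finite → ∀ u ∈ D, ∀ v ∈ D, u ∉ S → v ∉ S → RIn G Sᶜ u v)
    {W : Fin n → Set V} {hd : Fin n → V} (h : DSt D W hd) (a : Fin n) :
    ∃ (Wa : Set V) (d : V), DSt D (Function.update W a Wa) (Function.update hd a d) ∧ W a ⊆ Wa ∧ d ∉ W a ∧
      RIn G (Wa \ (W a \ {hd a})) (hd a) d := by
  classical
  have hUf : (⋃ i, W i).Finite := finite_iUnion h.fin
  obtain ⟨d, hdD, hdU⟩ := (hD.sdiff hUf).nonempty
  have hp := hcon ((⋃ i, W i) \ {hd a}) (hUf.subset sdiff_subset) (hd a) (h.memD a) d hdD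
    (fun hh => hh.2 rfl) (fun hh => hdU hh.1)
  obtain ⟨J, hJf, hJS, hJc, haJ, hdJ⟩ := hp.finite_path (fun hh => hh.2 rfl)
  have hJW : ∀ x ∈ J, ∀ i, x ∈ W i → x = hd a := by
    intro x hx i hxi
    by_contra hne
    exact hJS hx ⟨mem_iUnion.2 ⟨i, hxi⟩, hne⟩
  have hJd : ∀ j, j ≠ a → Disjoint (W a ∪ J) (W j) := by
    intro j hj
    refine Set.disjoint_left.2 ?_
    rintro x (hx | hx) hxj
    · exact Set.disjoint_left.1 (h.disj a j hj.symm) hx hxj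
    · have := hJW x hx j hxj
      subst this
      exact Set.disjoint_left.1 (h.disj a j hj.symm) (h.mem a) hxj
  refine ⟨W a ∪ J, d, ⟨?_, ?_, ?_, ?_⟩, subset_union_left, fun hh => hdU (mem_iUnion.2 ⟨a, hh⟩), ?_⟩
  · intro i
    by_cases hi : i = a
    · subst hi; simpa using ⟨h.fin i, hJf⟩
    · simpa [hi] using h.fin i
  · intro i j hij
    by_cases hi : i = a
    · subst hi
      simp only [Function.update_self, Function.update_of_ne (Ne.symm hij)]
      exact hJd j (Ne.symm hij)
    · by_cases hj : j = a
      · subst hj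
        simp only [Function.update_self, Function.update_of_ne hij]
        exact (hJd i hij).symm
      · simp only [Function.update_of_ne hi, Function.update_of_ne hj]
        exact h.disj i j hij
  · intro i
    by_cases hi : i = a
    · subst hi; simpa using Or.inr hdJ
    · simpa [hi] using h.mem i
  · intro i
    by_cases hi : i = a
    · subst hi; simpa using hdD
    · simpa [hi] using h.memD i
  · refine (hJc _ haJ _ hdJ).mono (fun x hx => ⟨Or.inr hx, fun hh => hh.2 ?_⟩)
    exact hJW x hx a hh.1

lemma dst_round {n : ℕ} {D : Set V} (hD : D.Infinite)
    (hcon : ∀ S : Set V, S.Finite → ∀ u ∈ D, ∀ v ∈ D, u ∉ S → v ∉ S → RIn G Sᶜ u v)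
    {W : Fin n → Set V} {hd : Fin n → V} (h : DSt D W hd) (s : Finset (Fin n)) :
    ∃ (W' : Fin n → Set V) (hd' : Fin n → V), DSt D W' hd' ∧
      (∀ i ∈ s, W i ⊆ W' i ∧ hd' i ∉ W i ∧ RIn G (W' i \ (W i \ {hd i})) (hd i) (hd' i)) ∧
      ∀ i, i ∉ s → W' i = W i ∧ hd' i = hd i := by
  classical
  induction s using Finset.induction_on with
  | empty => exact ⟨W, hd, h, by simp, fun i _ => ⟨rfl, rfl⟩⟩
  | insert a s ha ih =>
    obtain ⟨W', hd', h', h1, h2⟩ := ih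
    obtain ⟨Wa, d, hst, hs1, hs2, hs3⟩ := dst_step hD hcon h' a
    refine ⟨_, _, hst, ?_, ?_⟩
    · intro i hi
      by_cases hia : i = a
      · subst hia
        obtain ⟨e1, e2⟩ := h2 i ha
        rw [e1] at hs1 hs2 hs3
        rw [e2] at hs3
        simpa using ⟨hs1, hs2, hs3⟩
      · simp only [Function.update_of_ne hia]
        exact h1 i ((Finset.mem_insert.1 hi).resolve_left hia)
    · intro i hi
      rw [Finset.mem_insert, not_or] at hi
      simp only [Function.update_of_ne hi.1]
      exact h2 i hi.2

lemma rays_of_dom {D : Set V} (hD : D.Infinite)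
    (hcon : ∀ S : Set V, S.Finite → ∀ u ∈ D, ∀ v ∈ D, u ∉ S → v ∉ S → RIn G Sᶜ u v) (n : ℕ) :
    ∃ f : Fin n → ℕ → V, (∀ i, IsRay G (f i)) ∧ DisjointRays f := by
  classical
  let St := {s : (Fin n → Set V) × (Fin n → V) // DSt D s.1 s.2}
  have step : ∀ s : St, ∃ t : St, ∀ i, s.1.1 i ⊆ t.1.1 i ∧ t.1.2 i ∉ s.1.1 i ∧
      RIn G (t.1.1 i \ (s.1.1 i \ {s.1.2 i})) (s.1.2 i) (t.1.2 i) := by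
    intro s
    obtain ⟨W', hd', h', h1, -⟩ := dst_round hD hcon s.2 Finset.univ
    exact ⟨⟨(W', hd'), h'⟩, fun i => h1 i (Finset.mem_univ _)⟩
  choose nx hnx using step
  let e := hD.natEmbedding
  let s0 : St := ⟨(fun i => {(e i : V)}, fun i => (e i : V)), fun i => finite_singleton _, by
    intro i j hij
    simp only [disjoint_singleton]
    intro he
    exact hij (Fin.ext (e.injective (Subtype.ext he))), fun i => rfl, fun i => (e i).2⟩
  let s : ℕ → St := fun n => Nat.rec s0 (fun _ t => nx t) n
  have hs : ∀ m i, (s m).1.1 i ⊆ (s (m+1)).1.1 i ∧ (s (m+1)).1.2 i ∉ (s m).1.1 i ∧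
      RIn G ((s (m+1)).1.1 i \ ((s m).1.1 i \ {(s m).1.2 i})) ((s m).1.2 i) ((s (m+1)).1.2 i) :=
    fun m i => hnx (s m) i
  have hmono : ∀ i, Monotone (fun m => (s m).1.1 i) := fun i => monotone_nat_of_le_succ (fun m => (hs m i).1)
  have hex : ∀ i, ∃ r, IsRay G r ∧ ∀ m, r m ∈ ⋃ m, (s m).1.1 i := by
    intro i
    have hsub : ∀ m, (s (m+1)).1.1 i \ ((s m).1.1 i \ {(s m).1.2 i}) ⊆ ⋃ m, (s m).1.1 i :=
      fun m x hx => mem_iUnion.2 ⟨m+1, hx.1⟩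
    refine exists_ray (fun m => (s m).1.2 i) (fun m => mem_iUnion.2 ⟨m, (s m).2.mem i⟩)
      (fun m => (hs m i).2.2.mono (hsub m)) ?_
    intro S hS
    have : ∀ᶠ m in Filter.atTop, ∀ v ∈ S, v ∈ (⋃ m, (s m).1.1 i) → v ∈ (s m).1.1 i := by
      refine (Filter.eventually_all_finite hS).2 (fun v _ => ?_)
      rw [Filter.eventually_atTop]
      by_cases hv : v ∈ ⋃ m, (s m).1.1 i
      · obtain ⟨m, hm⟩ := mem_iUnion.1 hv
        exact ⟨m, fun j hj _ => hmono i hj hm⟩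
      · exact ⟨0, fun j _ hh => absurd hh hv⟩
    obtain ⟨N, hN⟩ := Filter.eventually_atTop.1 this
    have hx : ∀ j, N + 1 ≤ j → (s j).1.2 i ∉ S := by
      intro j hj hjS
      obtain ⟨j, rfl⟩ : ∃ j', j = j' + 1 := ⟨j - 1, by omega⟩
      exact (hs j i).2.1 (hN j (by omega) _ hjS (mem_iUnion.2 ⟨j+1, (s (j+1)).2.mem i⟩))
    refine ⟨N+1, fun j hj => ⟨hx j hj, (hs j i).2.2.mono ?_⟩⟩
    intro x hxx
    refine ⟨hsub j hxx, fun hxS => hxx.2 ⟨hN j (by omega) x hxS (hsub j hxx), ?_⟩⟩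
    rintro rfl
    exact hx j hj hxS
  choose f hf hfU using hex
  refine ⟨f, hf, ?_⟩
  intro i j hij
  rw [Set.disjoint_left]
  rintro _ ⟨a, rfl⟩ ⟨b, hb⟩
  have h1 := hfU i a
  have h2 := hfU j b
  rw [hb] at h2
  obtain ⟨m, hm⟩ := mem_iUnion.1 h1
  obtain ⟨m', hm'⟩ := mem_iUnion.1 h2
  exact Set.disjoint_left.1 ((s (max m m')).2.disj i j hij) (hmono i (le_max_left _ _) hm)
    (hmono j (le_max_right _ _) hm')

lemma rin_of_walk {S : Set V} {a b : V} (w : G.Walk a b) (h : ∀ v ∈ w.support, v ∉ S) : RIn G Sᶜ a b := by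
  induction w with
  | nil => exact RIn.refl _
  | @cons u v w' hadj p ih =>
    have h2 : ∀ x ∈ p.support, x ∉ S := fun x hx => h x (by simp [hx])
    exact (RIn.single hadj (h u (by simp)) (h2 v p.start_mem_support)).trans (ih h2)

lemma rin_tail {r : ℕ → V} (hr : IsRay G r) {S : Set V} {m : ℕ} (hm : ∀ i, m ≤ i → r i ∉ S) {j : ℕ}
    (hj : m ≤ j) : RIn G Sᶜ (r m) (r j) := by
  induction j, hj using Nat.le_induction with
  | base => exact RIn.refl _
  | succ j hj ih => exact ih.trans (RIn.single (hr.2 j) (hm j hj) (hm _ (by omega)))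

/-- eventual joining of tails -/
lemma rin_tails {r r' : ℕ → V} (hr : IsRay G r) (hr' : IsRay G r') {S : Set V}
    {m m' n n' : ℕ} (hm : ∀ i, m ≤ i → r i ∉ S) (hm' : ∀ i, m' ≤ i → r i ∉ S)
    (hn : ∀ i, n ≤ i → r' i ∉ S) (hn' : ∀ i, n' ≤ i → r' i ∉ S)
    (h : RIn G Sᶜ (r m) (r' n)) : RIn G Sᶜ (r m') (r' n') := by
  have h1 := (rin_tail hr hm' (le_max_right m m')).trans (rin_tail hr hm (le_max_left m m')).symm
  have h2 := (rin_tail hr' hn (le_max_left n n')).trans (rin_tail hr' hn' (le_max_right n n')).symm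
  exact (h1.trans h).trans h2

def DomV {V : Type} (G : SimpleGraph V) (ω : ℕ → V) (v : V) : Prop :=
  ∀ S : Set V, S.Finite → v ∉ S → ∃ m, (∀ n, m ≤ n → ω n ∉ S) ∧ RIn G Sᶜ v (ω m)

lemma FC_compl (hray : IsRay G ω) (hone : ∀ r, IsRay G r → RayEquiv G r ω)
    (hdeg : EndVertexDegree G ω k) {X : Set V} (hX : X.Finite) : FC G Xᶜ := by
  classical
  have hEq : ∀ r, IsRay G r → ∀ S : Set V, S.Finite → ∃ m n : ℕ,
    (∀ i, m ≤ i → r i ∉ S) ∧ (∀ j, n ≤ j → ω j ∉ S) ∧ RIn G Sᶜ (r m) (ω n) := by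
    intro r hr S hS
    obtain ⟨m, n, h1, h2, w, hw⟩ := hone r hr S hS
    exact ⟨m, n, h1, h2, rin_of_walk w hw⟩
  have hDf : {v | DomV G ω v}.Finite := by
    by_contra hinf
    obtain ⟨f, hf, hdisj⟩ := rays_of_dom hinf (by
      intro S hS u hu v hv huS hvS
      obtain ⟨m, hm, h1⟩ := hu S hS huS
      obtain ⟨n, hn, h2⟩ := hv S hS hvS
      exact h1.trans ((rin_tails hray hray hm hm hm hn (RIn.refl _)).trans h2.symm)) (k+1)
    exact hdeg.2 ⟨f, fun i => ⟨hf i, hone _ (hf i)⟩, hdisj⟩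
  have hX'f : (X ∪ {v | DomV G ω v}).Finite := hX.union hDf
  set X' := X ∪ {v | DomV G ω v} with hX'
  have hY : FC G X'ᶜ := by
    refine comps_dichotomy (fun y hy => ?_)
    by_cases hr : ∃ r, IsRay G r ∧ ∀ n, r n ∈ cmp G X'ᶜ y
    swap
    · exact rayless_dichotomy hr
    obtain ⟨r, hr, hrM⟩ := hr
    have hgood : Good G (cmp G X'ᶜ y) r k := by
      refine ⟨hr, hrM, conn_cmp, ?_, ?_, ?_⟩
      · intro r' hr' hrM' C hC
        have hSf : (NB G (cmp G X'ᶜ y) C ∪ X').Finite := hC.fin.union hX'f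
        obtain ⟨m, n, hm, hn, h1⟩ := hEq r hr _ hSf
        obtain ⟨m', n', hm', hn', h1'⟩ := hEq r' hr' _ hSf
        obtain ⟨m0, hm0⟩ := hC.tail
        refine ⟨m', fun j hj => ?_⟩
        have hm2 : ∀ i, max m m0 ≤ i → r i ∉ NB G (cmp G X'ᶜ y) C ∪ X' :=
          fun i hi => hm i ((le_max_left _ _).trans hi)
        have h2 := rin_tails hr hray hm hm2 hn hn' h1
        have h3 := (h2.trans h1'.symm).trans (rin_tail hr' hm' hj)
        refine h3.closed (hm0 _ (le_max_right _ _)) ?_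
        intro a ha b hb _ hab
        by_contra hbC
        have hbX : b ∈ X'ᶜ := fun hh => hb (Or.inr hh)
        exact hb (Or.inl ⟨cmp_adj (hC.sub ha) hbX hab, hbC, a, ha, hab⟩)
      · intro v hv
        have hnd : ¬ DomV G ω v := fun hh => hv.1 (Or.inr hh)
        unfold DomV at hnd
        push Not at hnd
        obtain ⟨S, hS, hvS, hno⟩ := hnd
        obtain ⟨m, n, hm, hn, h1⟩ := hEq r hr S hS
        have hNS : NB G (cmp G X'ᶜ y) (cmp G X'ᶜ y \ S) ⊆ S := by
          rintro x ⟨hx, hx2, -⟩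
          by_contra hxS
          exact hx2 ⟨hx, hxS⟩
        refine ⟨cmp G (cmp G X'ᶜ y \ S) (r m), region_cmp hr sdiff_subset (hS.subset hNS)
          (fun i hi => ⟨hrM i, hm i hi⟩), ?_, fun hh => hvS (hNS (NB_cmp hh))⟩
        intro hvC
        exact hno n hn ((hvC.2.mono (fun x hx => hx.2)).symm.trans h1)
      · rintro ⟨f, hf, hdisj⟩
        exact hdeg.2 ⟨f, fun i => ⟨(hf i).1, hone _ (hf i).1⟩, hdisj⟩
    exact hgood.dichotomy
  have hXX : X'ᶜ = Xᶜ \ {v | DomV G ω v} := by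
    rw [hX', compl_union]; rfl
  rcases hY with hf | hcn
  · left
    refine finite_of_stab _ hDf ?_ (pstab_finite (hXX ▸ hf))
    intro g hg v hv S hS hgv
    have hS1 : ((⇑g⁻¹) '' S).Finite := hS.image _
    have himg : ∀ x, x ∉ (⇑g⁻¹) '' S → g x ∉ S := fun x hx hh => hx ⟨g x, hh, by simp⟩
    obtain ⟨m, hm, h1⟩ := hv _ hS1 (by
      rintro ⟨y, hy, e⟩
      apply hgv
      rw [← e]; simpa using hy)
    have hgr : IsRay G (fun n => g (ω n)) := hray.map hg
    obtain ⟨m1, n1, hm1, hn1, h2⟩ := hEq _ hgr S hS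
    refine ⟨n1, hn1, ?_⟩
    have h3 : RIn G Sᶜ (g v) (g (ω m)) := (h1.map hg.1).mono (by
      rintro _ ⟨x, hx, rfl⟩
      exact himg x hx)
    exact h3.trans (rin_tails hgr hray hm1 (fun i hi => himg _ (hm i hi)) hn1 hn1 h2)
  · right
    refine cont_mono ?_ hcn
    rw [hXX]; exact sdiff_subset

end final

/-- in a one-ended graph whose end has finite vertex degree, if a finite
vertex set `X` contains all vertices dominating the end and `G − X` is connected, then
the pointwise stabiliser of `X` is finite or of cardinality at least `2^ℵ₀`. -/
theorem pointwise_stabiliser_dichotomy {V : Type} (G : SimpleGraph V) (ω : ℕ → V) (k : ℕ)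
    (hray : IsRay G ω) (hone : ∀ r, IsRay G r → RayEquiv G r ω)
    (hdeg : EndVertexDegree G ω k)
    (X : Set V) (hX : X.Finite)
    (hdom : ∀ v : V, Dominates G v ω → v ∈ X)
    (hconn : (G.induce (Xᶜ : Set V)).Connected) :
    Finite {φ : G ≃g G | ∀ v ∈ X, φ v = v} ∨
      Cardinal.continuum ≤ Cardinal.mk {φ : G ≃g G | ∀ v ∈ X, φ v = v} := by
  let E : {φ : G ≃g G | ∀ v ∈ X, φ v = v} ≃ Gam G Xᶜ :=
    { toFun := fun φ => ⟨φ.1.toEquiv, fun a b => φ.1.map_rel_iff, fun v hv => φ.2 v (by simpa using hv)⟩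
      invFun := fun g => ⟨⟨g.1, fun {a b} => g.2.1 a b⟩, fun v hv => g.2.2 v (by simpa using hv)⟩
      left_inv := fun φ => rfl
      right_inv := fun g => rfl }
  rcases FC_compl hray hone hdeg hX with h | h
  · left
    have : Finite (Gam G Xᶜ) := h
    exact Finite.of_equiv _ E.symm
  · right
    rw [Cardinal.mk_congr E]
    exact h


end PaperEnds
end

section
/- Let G be a graph and ω an end of G with vertex degree k. (1) If (A,B) is an ω-relevant separation of G, then there is a family of k pairwise disjoint rays belonging to ω, each having its initial vertex in A ∩ B. (2) Conversely, if (A,B) is a separation of order k such that A∖B is connected, every vertex of A ∩ B has a neighbour in A∖B, the end ω lies in B, and there is a family of k pairwise disjoint rays belonging to ω each having its initial vertex in A ∩ B, then (A,B) is ω-relevant. -/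
open Set Cardinal

namespace PaperEnds

/-- One step of an injection: stay, or move along an edge inside `B`. -/
def Stp {V : Type} (G : SimpleGraph V) (B : Set V) (u w : V) : Prop :=
  u = w ∨ (G.Adj u w ∧ u ∈ B ∧ w ∈ B)

/-- `n`-step alternating reachability. -/
def Rn {V : Type} (G : SimpleGraph V) (B : Set V) (σ : V → V) : ℕ → V → V → Prop
  | 0, w, s => w = s
  | n + 1, w, s => ∃ u, Stp G B u w ∧ Rn G B σ n (σ u) s

theorem Rn_snoc {V : Type} {G : SimpleGraph V} {B : Set V} {σ : V → V} {n : ℕ} {h w u : V}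
    (hr : Rn G B σ n h w) (hu : Stp G B u w) : Rn G B σ (n + 1) h (σ u) := by
  induction n generalizing h with
  | zero =>
    have : h = w := hr
    subst this
    exact ⟨u, hu, rfl⟩
  | succ n ih =>
    obtain ⟨v, hv, hr⟩ := hr
    exact ⟨v, hv, ih hr⟩

/-- Injections along edges inside `B` that differ finitely from `σ₀` and have `k` holes. -/
structure Good_s19 {V : Type} (G : SimpleGraph V) (B : Set V) (k : ℕ) (σ₀ σ : V → V) : Prop where
  inj : Function.Injective σ
  stp : ∀ v, Stp G B v (σ v)
  holes : ((Set.range σ)ᶜ).encard = (k : ℕ∞)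
  fin : {v | σ v ≠ σ₀ v}.Finite

theorem holes_update {V : Type} [DecidableEq V] {σ : V → V} (hσ : Function.Injective σ) {u w : V}
    (hw : w ∉ Set.range σ) :
    (Set.range (Function.update σ u w))ᶜ = insert (σ u) ((Set.range σ)ᶜ \ {w}) := by
  ext x
  simp only [mem_compl_iff, mem_range, not_exists, mem_insert_iff, mem_diff, mem_singleton_iff]
  constructor
  · intro h
    by_cases hx : x = σ u
    · exact Or.inl hx
    · right
      refine ⟨fun y hy => ?_, fun hxw => ?_⟩
      · by_cases hyu : y = u
        · subst hyu; exact hx hy.symm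
        · apply h y; rw [Function.update_of_ne hyu]; exact hy
      · apply h u; simp [hxw]
  · rintro (rfl | ⟨h1, h2⟩) y hy
    · by_cases hyu : y = u
      · subst hyu
        rw [Function.update_self] at hy
        exact hw ⟨_, hy.symm⟩
      · rw [Function.update_of_ne hyu] at hy
        exact hyu (hσ hy)
    · by_cases hyu : y = u
      · subst hyu
        rw [Function.update_self] at hy
        exact h2 hy.symm
      · rw [Function.update_of_ne hyu] at hy
        exact h1 y hy

theorem Good_s19.update {V : Type} [DecidableEq V] {G : SimpleGraph V} {B : Set V} {k : ℕ}
    {σ₀ σ : V → V} (h : Good_s19 G B k σ₀ σ) {u w : V} (hw : w ∉ Set.range σ)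
    (hu : Stp G B u w) : Good_s19 G B k σ₀ (Function.update σ u w) where
  inj := by
    intro x y hxy
    by_cases hx : x = u <;> by_cases hy : y = u
    · rw [hx, hy]
    · subst hx
      rw [Function.update_self, Function.update_of_ne hy] at hxy
      exact absurd ⟨_, hxy.symm⟩ hw
    · subst hy
      rw [Function.update_self, Function.update_of_ne hx] at hxy
      exact absurd ⟨_, hxy⟩ hw
    · rw [Function.update_of_ne hx, Function.update_of_ne hy] at hxy
      exact h.inj hxy
  stp := by
    intro v
    by_cases hv : v = u
    · subst hv; rw [Function.update_self]; exact hu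
    · rw [Function.update_of_ne hv]; exact h.stp v
  holes := by
    rw [holes_update h.inj hw, Set.encard_insert_of_notMem (by simp),
      Set.encard_diff_singleton_add_one (by simpa using hw)]
    exact h.holes
  fin := by
    apply (h.fin.insert u).subset
    intro v hv
    by_cases hvu : v = u
    · exact Or.inl hvu
    · right
      simpa [Function.update_of_ne hvu] using hv

theorem Rn_update {V : Type} [DecidableEq V] {G : SimpleGraph V} {B : Set V} {σ : V → V}
    {u₀ w₀ s : V} (j : ℕ) (w : V) (h : Rn G B σ j w s) :
    Rn G B (Function.update σ u₀ w₀) j w s ∨ ∃ j' < j, Rn G B σ j' (σ u₀) s := by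
  induction j generalizing w with
  | zero => exact Or.inl h
  | succ j ih =>
    obtain ⟨u, hu, hr⟩ := h
    by_cases huu : u = u₀
    · subst huu; exact Or.inr ⟨j, Nat.lt_succ_self j, hr⟩
    · rcases ih _ hr with h1 | ⟨j', hj', h1⟩
      · left
        refine ⟨u, hu, ?_⟩
        rw [Function.update_of_ne huu]; exact h1
      · exact Or.inr ⟨j', by omega, h1⟩

theorem augment {V : Type} {G : SimpleGraph V} {B S : Set V} {k : ℕ} {σ₀ : V → V}
    (n : ℕ) : ∀ σ, Good_s19 G B k σ₀ σ → ∀ w s, w ∉ Set.range σ → w ∉ S → s ∈ S →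
      Rn G B σ n w s → ∃ σ', Good_s19 G B k σ₀ σ' ∧
        ∃ t ∈ S, t ∈ Set.range σ ∧ t ∉ Set.range σ' ∧ S \ Set.range σ ⊆ S \ Set.range σ' := by
  classical
  induction n using Nat.strong_induction_on with
  | _ n ih =>
  intro σ hσ w s hw hwS hs hr
  cases n with
  | zero =>
    have : w = s := hr
    subst this; exact absurd hs hwS
  | succ n =>
    obtain ⟨u, hu, hr⟩ := hr
    have hex : ∃ j, Rn G B σ j (σ u) s := ⟨n, hr⟩
    have hle : Nat.find hex ≤ n := Nat.find_min' hex hr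
    have hg := hσ.update hw hu
    have hh := holes_update hσ.inj hw (u := u)
    have hsub : S \ Set.range σ ⊆ S \ Set.range (Function.update σ u w) := by
      rintro x ⟨hxS, hx⟩
      refine ⟨hxS, ?_⟩
      have : x ∈ (Set.range (Function.update σ u w))ᶜ := by
        rw [hh]; right
        exact ⟨hx, fun h => hwS (h ▸ hxS)⟩
      exact this
    have hnew : σ u ∉ Set.range (Function.update σ u w) := by
      have : σ u ∈ (Set.range (Function.update σ u w))ᶜ := by
        rw [hh]; left; rfl
      exact this
    by_cases hS : σ u ∈ S
    · exact ⟨_, hg, σ u, hS, ⟨u, rfl⟩, hnew, hsub⟩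
    · have h2 : Rn G B (Function.update σ u w) (Nat.find hex) (σ u) s := by
        rcases Rn_update (u₀ := u) (w₀ := w) _ _ (Nat.find_spec hex) with h | ⟨j', hj', h⟩
        · exact h
        · exact absurd h (Nat.find_min hex hj')
      obtain ⟨σ', hg', t, ht, htr, htr', hsub'⟩ :=
        ih (Nat.find hex) (by omega) _ hg _ s hnew hS hs h2
      refine ⟨σ', hg', t, ht, ?_, htr', hsub.trans hsub'⟩
      by_contra hcon
      exact (hsub ⟨ht, hcon⟩).2 htr

theorem exists_max {V : Type} {G : SimpleGraph V} {B S : Set V} {k : ℕ} {σ₀ : V → V}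
    (hS : S.Finite) : ∀ (m : ℕ) (σ : V → V), (S ∩ Set.range σ).ncard = m → Good_s19 G B k σ₀ σ →
      ∃ σ', Good_s19 G B k σ₀ σ' ∧ ∀ n w s, w ∉ Set.range σ' → w ∉ S → s ∈ S → ¬ Rn G B σ' n w s := by
  intro m
  induction m using Nat.strong_induction_on with
  | _ m ih =>
  intro σ hm hσ
  by_cases h : ∀ n w s, w ∉ Set.range σ → w ∉ S → s ∈ S → ¬ Rn G B σ n w s
  · exact ⟨σ, hσ, h⟩
  · push Not at h
    obtain ⟨n, w, s, h1, h2, h3, h4⟩ := h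
    obtain ⟨σ', hg, t, ht, htr, htr', hsub⟩ := augment n σ hσ w s h1 h2 h3 h4
    refine ih _ ?_ σ' rfl hg
    rw [← hm]
    apply Set.ncard_lt_ncard _ (hS.subset inter_subset_left)
    refine ⟨?_, fun hc => htr' (hc ⟨ht, htr⟩).2⟩
    rintro x ⟨hx, hxr⟩
    refine ⟨hx, ?_⟩
    by_contra hcon
    exact (hsub ⟨hx, hcon⟩).2 hxr

theorem orbit_inj {V : Type} {σ : V → V} (hσ : Function.Injective σ) {h : V}
    (hh : h ∉ Set.range σ) {h' : V} (hh' : h' ∉ Set.range σ) :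
    ∀ {m n : ℕ}, σ^[m] h = σ^[n] h' → m = n ∧ h = h' := by
  intro m
  induction m with
  | zero =>
    intro n e
    cases n with
    | zero => exact ⟨rfl, e⟩
    | succ n =>
      rw [Function.iterate_succ_apply'] at e
      exact absurd ⟨_, e.symm⟩ hh
  | succ m ih =>
    intro n e
    cases n with
    | zero =>
      rw [Function.iterate_succ_apply'] at e
      exact absurd ⟨_, e⟩ hh'
    | succ n =>
      rw [Function.iterate_succ_apply', Function.iterate_succ_apply'] at e
      obtain ⟨h1, h2⟩ := ih (hσ e)
      exact ⟨by omega, h2⟩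

theorem ray_reach {V : Type} {G : SimpleGraph V} {r : ℕ → V} (hr : IsRay G r) (S : Set V) (a : ℕ) :
    ∀ d, (∀ i, a ≤ i → r i ∉ S) → ReachableOutside G S (r (a + d)) (r a) := by
  intro d h
  induction d with
  | zero => exact ⟨SimpleGraph.Walk.nil, by simpa using h a le_rfl⟩
  | succ d ih =>
    obtain ⟨w, hw⟩ := ih
    refine ⟨SimpleGraph.Walk.cons (hr.2 (a + d)).symm w, ?_⟩
    intro v hv
    rw [SimpleGraph.Walk.support_cons, List.mem_cons] at hv
    rcases hv with rfl | hv
    · exact h _ (by omega)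
    · exact hw v hv

theorem reach_trans {V : Type} {G : SimpleGraph V} {S : Set V} {a b c : V}
    (h1 : ReachableOutside G S a b) (h2 : ReachableOutside G S b c) :
    ReachableOutside G S a c := by
  obtain ⟨w1, h1⟩ := h1
  obtain ⟨w2, h2⟩ := h2
  refine ⟨w1.append w2, fun v hv => ?_⟩
  rw [SimpleGraph.Walk.mem_support_append_iff] at hv
  exact hv.elim (h1 v) (h2 v)

theorem reach_symm {V : Type} {G : SimpleGraph V} {S : Set V} {a b : V}
    (h1 : ReachableOutside G S a b) : ReachableOutside G S b a := by
  obtain ⟨w1, h1⟩ := h1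
  refine ⟨w1.reverse, fun v hv => ?_⟩
  rw [SimpleGraph.Walk.support_reverse, List.mem_reverse] at hv
  exact h1 v hv

theorem inEnd_of_tail {V : Type} {G : SimpleGraph V} {ω r r' : ℕ → V} (hr : IsRay G r)
    (hr' : InEnd G ω r') (N p : ℕ) (h : ∀ j, r (N + j) = r' (p + j)) : InEnd G ω r := by
  refine ⟨hr, fun S hS => ?_⟩
  obtain ⟨m, n, h1, h2, h3⟩ := hr'.2 S hS
  refine ⟨N + m, n, ?_, h2, ?_⟩
  · intro i hi
    obtain ⟨d, rfl⟩ := Nat.exists_eq_add_of_le hi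
    rw [add_assoc, h]
    exact h1 _ (by omega)
  · rw [h]
    have := ray_reach hr'.1 S m p h1
    rw [add_comm]
    exact reach_trans this h3

theorem tail_inEnd {V : Type} {G : SimpleGraph V} {ω r : ℕ → V}
    (hr : InEnd G ω r) (p : ℕ) : InEnd G ω (fun j => r (p + j)) := by
  have hr2 : IsRay G (fun j => r (p + j)) :=
    ⟨fun a b e => by have := hr.1.1 e; omega, fun n => hr.1.2 (p + n)⟩
  exact inEnd_of_tail hr2 hr 0 p (fun j => by simp)

theorem eventually_notMem {V : Type} {x : ℕ → V} (hx : Function.Injective x) {E : Set V}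
    (hE : E.Finite) : ∃ N, ∀ n, N ≤ n → x n ∉ E := by
  have : (x ⁻¹' E).Finite := hE.preimage hx.injOn
  obtain ⟨M, hM⟩ := this.bddAbove
  refine ⟨M + 1, fun n hn hc => ?_⟩
  have := hM (show n ∈ x ⁻¹' E from hc)
  omega

/-- `σ₀` shifts the rays `g i` and fixes everything else. -/
structure Base {V : Type} (k : ℕ) (g : Fin k → ℕ → V) (σ₀ : V → V) : Prop where
  on : ∀ i n, σ₀ (g i n) = g i (n + 1)
  off : ∀ v, (∀ i n, v ≠ g i n) → σ₀ v = v

theorem hole_orbit {V : Type} {G : SimpleGraph V} {ω : ℕ → V} {B : Set V} {k : ℕ}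
    {g : Fin k → ℕ → V} {σ₀ σ : V → V} (hb : Base k g σ₀) (hg : ∀ i, InEnd G ω (g i))
    (hσ : Good_s19 G B k σ₀ σ) {h : V} (hh : h ∉ Set.range σ) : InEnd G ω (fun n => σ^[n] h) := by
  have hinj : Function.Injective (fun n => σ^[n] h) := fun a b e =>
    (orbit_inj hσ.inj hh hh e).1
  have hray : IsRay G (fun n => σ^[n] h) := by
    refine ⟨hinj, fun n => ?_⟩
    rcases hσ.stp (σ^[n] h) with e | e
    · exfalso
      have : n = n + 1 := hinj (by simpa only [Function.iterate_succ_apply'] using e)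
      omega
    · simpa only [Function.iterate_succ_apply'] using e.1
  obtain ⟨N, hN⟩ := eventually_notMem hinj hσ.fin
  have hN' : ∀ n, N ≤ n → σ^[n+1] h = σ₀ (σ^[n] h) := by
    intro n hn
    rw [Function.iterate_succ_apply']
    have := hN n hn
    simpa using this
  have hmem : ∃ i p, σ^[N] h = g i p := by
    by_contra hc
    push Not at hc
    have h1 := hN' N le_rfl
    rw [hb.off _ hc] at h1
    have : N + 1 = N := hinj h1
    omega
  obtain ⟨i, p, hip⟩ := hmem
  refine inEnd_of_tail hray (hg i) N p ?_
  intro j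
  induction j with
  | zero => exact hip
  | succ j ih =>
    have h1 := hN' (N + j) (by omega)
    have h2 : σ^[N + j] h = g i (p + j) := ih
    rw [h2, hb.on] at h1
    exact h1

theorem back_term {V : Type} {G : SimpleGraph V} {B : Set V} {k : ℕ}
    {g : Fin k → ℕ → V} {σ₀ σ : V → V} (hb : Base k g σ₀)
    (hgi : Function.Injective (fun q : Fin k × ℕ => g q.1 q.2))
    (hσ : Good_s19 G B k σ₀ σ) (y : ℕ → V) (hy : Function.Injective y)
    (hyy : ∀ n, σ (y (n + 1)) = y n) : False := by
  obtain ⟨N, hN⟩ := eventually_notMem hy hσ.fin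
  have hN' : ∀ n, N ≤ n → σ₀ (y (n+1)) = y n := by
    intro n hn
    have := hN (n+1) (by omega)
    simp only [mem_setOf_eq, not_not] at this
    rw [← this, hyy]
  have hmem : ∀ n, ∃ q : Fin k × ℕ, N ≤ n → y (n + 1) = g q.1 q.2 := by
    intro n
    by_cases hn : N ≤ n
    swap
    · obtain ⟨q⟩ : Nonempty (Fin k × ℕ) := by
        by_contra hemp
        have h1 := hN' N le_rfl
        rw [hb.off _ (fun i p _ => hemp ⟨(i, p)⟩)] at h1
        have : N + 1 = N := hy h1
        omega
      exact ⟨q, fun h => absurd h hn⟩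
    suffices ∃ i p, y (n + 1) = g i p by
      obtain ⟨i, p, h⟩ := this
      exact ⟨(i, p), fun _ => h⟩
    by_contra hc
    push Not at hc
    have h1 := hN' n hn
    rw [hb.off _ hc] at h1
    have : n + 1 = n := hy h1
    omega
  choose Q hIP using hmem
  set I := fun n => (Q n).1 with hI
  set P := fun n => (Q n).2 with hP
  have hdec : ∀ n, N ≤ n → P (n + 1) + 1 = P n := by
    intro n hn
    have h1 := hN' (n + 1) (by omega)
    rw [hIP (n+1) (by omega), hIP n hn, hb.on] at h1
    have := @hgi (I (n+1), P (n+1) + 1) (I n, P n) h1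
    exact (Prod.ext_iff.1 this).2
  have hsum : ∀ j, P (N + j) + j = P N := by
    intro j
    induction j with
    | zero => rfl
    | succ j ih =>
      have := hdec (N + j) (by omega)
      have e : N + (j + 1) = N + j + 1 := by omega
      rw [e]; omega
  have := hsum (P N + 1)
  omega

/-- backward tracing -/
theorem trace_back {V : Type} {G : SimpleGraph V} {B : Set V} {k : ℕ}
    {g : Fin k → ℕ → V} {σ₀ σ : V → V} (hb : Base k g σ₀)
    (hgi : Function.Injective (fun q : Fin k × ℕ => g q.1 q.2))
    (hσ : Good_s19 G B k σ₀ σ) {W : Set V} (hW : ∀ w ∈ W, σ w ∈ W) {x : V} (hx : x ∉ W)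
    (hx' : σ x ∈ W) : ∃ h n, h ∉ Set.range σ ∧ h ∉ W ∧ σ^[n] h = x := by
  have hiter : ∀ n w, w ∈ W → σ^[n] w ∈ W := by
    intro n
    induction n with
    | zero => intro w hw; exact hw
    | succ n ih => intro w hw; rw [Function.iterate_succ_apply]; exact ih _ (hW _ hw)
  by_contra hc
  have hc' : ∀ n h, σ^[n] h = x → h ∈ Set.range σ := by
    intro n h e
    by_contra hr
    apply hc
    exact ⟨h, n, hr, fun hw => hx (e ▸ hiter n h hw), e⟩
  have hpre : ∀ v : V, v ∈ Set.range σ → ∃ u, σ u = v := fun v hv => hv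
  choose! q hq using hpre
  set y : ℕ → V := fun n => q^[n] x with hydef
  have hy0 : ∀ n, σ^[n] (y n) = x ∧ y n ∈ Set.range σ := by
    intro n
    induction n with
    | zero => exact ⟨rfl, hc' 0 _ rfl⟩
    | succ n ih =>
      have h1 : σ (y (n+1)) = y n := by
        simp only [hydef, Function.iterate_succ_apply']
        exact hq _ ih.2
      have h2 : σ^[n+1] (y (n+1)) = x := by
        rw [Function.iterate_succ_apply, h1]; exact ih.1
      exact ⟨h2, hc' _ _ h2⟩
  have hyy : ∀ n, σ (y (n+1)) = y n := by
    intro n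
    simp only [hydef, Function.iterate_succ_apply']
    exact hq _ (hy0 n).2
  have hlt : ∀ a d, y a ≠ y (a + d + 1) := by
    intro a d e
    -- then `x` is periodic
    have h1 := (hy0 (a + d + 1)).1
    rw [← e, show a + d + 1 = (d + 1) + a by omega, Function.iterate_add_apply, (hy0 a).1,
      Function.iterate_succ_apply] at h1
    exact hx (h1 ▸ hiter d _ hx')
  have hyinj : Function.Injective y := by
    intro a b e
    rcases lt_trichotomy a b with h | h | h
    · obtain ⟨d, rfl⟩ := Nat.exists_eq_add_of_lt h
      exact absurd e (hlt a d)
    · exact h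
    · obtain ⟨d, rfl⟩ := Nat.exists_eq_add_of_lt h
      exact absurd e.symm (hlt b d)
  exact back_term hb hgi hσ y hyinj hyy

theorem base_exists {V : Type} {k : ℕ} {g : Fin k → ℕ → V}
    (hgi : Function.Injective (fun q : Fin k × ℕ => g q.1 q.2)) : ∃ σ₀, Base k g σ₀ := by
  classical
  refine ⟨Function.extend (fun q : Fin k × ℕ => g q.1 q.2) (fun q => g q.1 (q.2 + 1)) id, ?_, ?_⟩
  · intro i n
    exact hgi.extend_apply (fun q => g q.1 (q.2 + 1)) id (i, n)
  · intro v hv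
    rw [Function.extend_apply']
    · rfl
    · rintro ⟨q, hq⟩
      exact hv q.1 q.2 hq.symm

theorem base_good {V : Type} {G : SimpleGraph V} {B : Set V} {k : ℕ}
    {g : Fin k → ℕ → V} {σ₀ : V → V} (hb : Base k g σ₀)
    (hgi : Function.Injective (fun q : Fin k × ℕ => g q.1 q.2))
    (hg : ∀ i, IsRay G (g i)) (hgB : ∀ i n, g i n ∈ B) : Good_s19 G B k σ₀ σ₀ where
  inj := by
    intro a b e
    by_cases ha : ∃ i n, a = g i n <;> by_cases hb' : ∃ i n, b = g i n
    · obtain ⟨i, n, rfl⟩ := ha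
      obtain ⟨j, m, rfl⟩ := hb'
      rw [hb.on, hb.on] at e
      have := @hgi (i, n+1) (j, m+1) e
      simp only [Prod.mk.injEq, add_left_inj] at this
      rw [this.1, this.2]
    · obtain ⟨i, n, rfl⟩ := ha
      push Not at hb'
      rw [hb.on, hb.off _ hb'] at e
      exact absurd e.symm (hb' _ _)
    · obtain ⟨i, n, rfl⟩ := hb'
      push Not at ha
      rw [hb.on, hb.off _ ha] at e
      exact absurd e (ha _ _)
    · push Not at ha hb'
      rwa [hb.off _ ha, hb.off _ hb'] at e
  stp := by
    intro v
    by_cases hv : ∃ i n, v = g i n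
    · obtain ⟨i, n, rfl⟩ := hv
      rw [hb.on]
      exact Or.inr ⟨(hg i).2 n, hgB _ _, hgB _ _⟩
    · push Not at hv
      exact Or.inl (hb.off _ hv).symm
  holes := by
    have : (Set.range σ₀)ᶜ = Set.range (fun i : Fin k => g i 0) := by
      ext x
      constructor
      · intro hx
        by_cases hv : ∃ i n, x = g i n
        · obtain ⟨i, n, rfl⟩ := hv
          cases n with
          | zero => exact ⟨i, rfl⟩
          | succ n => exact absurd ⟨g i n, hb.on i n⟩ hx
        · push Not at hv
          exact absurd ⟨x, hb.off _ hv⟩ hx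
      · rintro ⟨i, rfl⟩ ⟨y, hy⟩
        by_cases hv : ∃ i n, y = g i n
        · obtain ⟨j, n, rfl⟩ := hv
          rw [hb.on] at hy
          have := @hgi (j, n+1) (i, 0) hy
          simp at this
        · push Not at hv
          rw [hb.off _ hv] at hy
          exact hv _ _ hy
    rw [this, ← Set.image_univ, Function.Injective.encard_image]
    · simp
    · intro i j e
      have := @hgi (i, 0) (j, 0) e
      exact (Prod.ext_iff.1 this).1
  fin := by simp

theorem small_sep {V : Type} {G : SimpleGraph V} {ω : ℕ → V} (hray : IsRay G ω)
    {A B : Set V} {k : ℕ}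
    {g : Fin k → ℕ → V} {σ₀ σ : V → V} (hb : Base k g σ₀) (hg : ∀ i, InEnd G ω (g i))
    (hgi : Function.Injective (fun q : Fin k × ℕ => g q.1 q.2))
    (hσ : Good_s19 G B k σ₀ σ) (hsep : IsSeparation G A B) (hord : SepOrder A B = (k : ℕ∞))
    (hmax : ∀ n w s, w ∉ Set.range σ → w ∉ A ∩ B → s ∈ A ∩ B → ¬ Rn G B σ n w s)
    (hne : ¬ A ∩ B ⊆ (Set.range σ)ᶜ) :
    ∃ C D : Set V, IsSeparation G C D ∧ SepOrder C D < (k : ℕ∞) ∧ A ⊆ C ∧ LiesIn G ω D := by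
  have hSfin : (A ∩ B).Finite := Set.finite_of_encard_eq_coe hord
  have hHfin : ((Set.range σ)ᶜ).Finite := Set.finite_of_encard_eq_coe hσ.holes
  have hr : ∃ r, r ∉ Set.range σ ∧ r ∉ A ∩ B := by
    by_contra hc
    push Not at hc
    have hsub : (Set.range σ)ᶜ ⊆ A ∩ B := fun x hx => hc x hx
    have : (Set.range σ)ᶜ = A ∩ B :=
      hHfin.eq_of_subset_of_encard_le hsub (by rw [hσ.holes]; exact hord.le)
    exact hne this.symm.subset
  obtain ⟨r, hr, hrS⟩ := hr
  set W : Set V := {w | ∃ h, h ∉ Set.range σ ∧ h ∉ A ∩ B ∧ ∃ n, Rn G B σ n h w} with hWdef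
  have hWS : ∀ w ∈ W, w ∉ A ∩ B := by
    rintro w ⟨h, h1, h2, n, h3⟩ hw
    exact hmax n h w h1 h2 hw h3
  have hWN : ∀ w ∈ W, ∀ u, Stp G B u w → σ u ∈ W := by
    rintro w ⟨h, h1, h2, n, h3⟩ u hu
    exact ⟨h, h1, h2, n + 1, Rn_snoc h3 hu⟩
  have hWσ : ∀ w ∈ W, σ w ∈ W := fun w hw => hWN w hw w (Or.inl rfl)
  have hrW : r ∈ W := ⟨r, hr, hrS, 0, rfl⟩
  have hσB : ∀ v, v ∉ B → σ v = v := by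
    intro v hv
    rcases hσ.stp v with e | e
    · exact e.symm
    · exact absurd e.2.1 hv
  have hRB : ∀ n h w, h ∈ B → Rn G B σ n h w → w ∈ B := by
    intro n
    induction n with
    | zero => intro h w hB (e : h = w); exact e ▸ hB
    | succ n ih =>
      rintro h w hB ⟨u, hu, hrn⟩
      refine ih _ w ?_ hrn
      have huB : u ∈ B := by
        rcases hu with e | e
        · exact e ▸ hB
        · exact e.2.1
      rcases hσ.stp u with e | e
      · exact e ▸ huB
      · exact e.2.2
  have hWB : ∀ w ∈ W, w ∈ B := by
    rintro w ⟨h, h1, h2, n, h3⟩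
    refine hRB n h w ?_ h3
    by_contra hh
    exact h1 ⟨h, hσB h hh⟩
  have hWA : ∀ w ∈ W, w ∉ A := fun w hw hA => hWS w hw ⟨hA, hWB w hw⟩
  have hstep : ∀ w ∈ W, ∀ a, G.Adj w a → σ a ∈ W := by
    intro w hw a hadj
    by_cases ha : a ∈ B
    · exact hWN w hw a (Or.inr ⟨hadj.symm, ha, hWB w hw⟩)
    · have haA : a ∈ A := by
        have : a ∈ A ∪ B := hsep.1 ▸ mem_univ a
        exact this.resolve_right ha
      exact absurd hadj.symm (hsep.2 a ⟨haA, ha⟩ w ⟨hWB w hw, hWA w hw⟩)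
  have hitW : ∀ n w, w ∈ W → σ^[n] w ∈ W := by
    intro n
    induction n with
    | zero => intro w hw; exact hw
    | succ n ih => intro w hw; rw [Function.iterate_succ_apply]; exact ih _ (hWσ _ hw)
  have hXcard : (Wᶜ ∩ σ ⁻¹' W).encard < (k : ℕ∞) := by
    have htr : ∀ x ∈ Wᶜ ∩ σ ⁻¹' W, ∃ h ∈ (A ∩ B) \ Set.range σ, ∃ n, σ^[n] h = x := by
      rintro x ⟨hx, hx'⟩
      obtain ⟨h, n, h1, h2, h3⟩ := trace_back hb hgi hσ hWσ hx hx'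
      refine ⟨h, ⟨?_, h1⟩, n, h3⟩
      by_contra hhS
      exact h2 ⟨h, h1, hhS, 0, rfl⟩
    choose! F hF N hN using htr
    have hle : (Wᶜ ∩ σ ⁻¹' W).encard ≤ ((A ∩ B) \ Set.range σ).encard := by
      apply Set.encard_le_encard_of_injOn (f := F) (fun x hx => hF x hx)
      have key : ∀ x ∈ Wᶜ ∩ σ ⁻¹' W, ∀ y ∈ Wᶜ ∩ σ ⁻¹' W, F x = F y → N x < N y → False := by
        intro x hx y hy e hlt
        obtain ⟨d, hd⟩ := Nat.exists_eq_add_of_lt hlt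
        have h1 := hN y hy
        rw [hd, show N x + d + 1 = (d + 1) + N x by omega, Function.iterate_add_apply, ← e,
          hN x hx, Function.iterate_succ_apply] at h1
        exact hy.1 (h1 ▸ hitW d _ hx.2)
      intro x hx y hy e
      rcases lt_trichotomy (N x) (N y) with h | h | h
      · exact (key x hx y hy e h).elim
      · rw [← hN x hx, ← hN y hy, e, h]
      · exact (key y hy x hx e.symm h).elim
    have hlt : ((A ∩ B) \ Set.range σ).encard < (A ∩ B).encard := by
      apply Set.Finite.encard_lt_encard (hSfin.subset diff_subset)
      refine ⟨diff_subset, fun hc => hne fun x hx => (hc hx).2⟩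
    calc _ ≤ _ := hle
      _ < _ := hlt
      _ = _ := hord
  have hXfin : (Wᶜ ∩ σ ⁻¹' W).Finite := Set.finite_of_encard_le_coe hXcard.le
  refine ⟨Wᶜ, σ ⁻¹' W, ⟨?_, ?_⟩, hXcard, fun a ha haW => hWA a haW ha, ?_⟩
  · ext x
    simp only [mem_union, mem_univ, iff_true]
    by_cases hx : x ∈ W
    · exact Or.inr (hWσ x hx)
    · exact Or.inl hx
  · rintro a ⟨ha1, ha2⟩ b ⟨hb1, hb2⟩ hadj
    have hbW : b ∈ W := by simpa using hb2
    exact ha2 (hstep b hbW a hadj.symm)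
  · intro ρ hρ
    have hR := hole_orbit hb hg hσ hr
    set X := Wᶜ ∩ σ ⁻¹' W with hX
    obtain ⟨m, n, hm, hn, hmn⟩ := hρ.2 X hXfin
    obtain ⟨m', n', hm', hn', hmn'⟩ := hR.2 X hXfin
    have hωω : ReachableOutside G X (ω n') (ω n) := by
      rcases le_total n' n with h | h
      · obtain ⟨d, rfl⟩ := Nat.exists_eq_add_of_le h
        exact reach_symm (ray_reach hray X n' d hn')
      · obtain ⟨d, rfl⟩ := Nat.exists_eq_add_of_le h
        exact ray_reach hray X n d hn
    have hreach : ReachableOutside G X (σ^[m'] r) (ρ m) :=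
      reach_trans hmn' (reach_trans hωω (reach_symm hmn))
    have hstay : ∀ a b, ReachableOutside G X a b → a ∈ W → b ∈ W := by
      rintro a b ⟨w, hw⟩ ha
      induction w with
      | nil => exact ha
      | cons hadj p ih =>
        rename_i u v w'
        apply ih
        · intro x hx; apply hw; simp [hx]
        · by_contra hv
          exact hw v (by simp) ⟨hv, hstep _ ha _ hadj⟩
    have hρm : ρ m ∈ W := hstay _ _ hreach (hitW m' r hrW)
    refine ⟨m, fun i hi => hWσ _ ?_⟩
    obtain ⟨d, rfl⟩ := Nat.exists_eq_add_of_le hi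
    exact hstay _ _ (reach_symm (ray_reach hρ.1 X m d hm)) hρm

theorem part_one {V : Type} {G : SimpleGraph V} {ω : ℕ → V} {k : ℕ}
    (hray : IsRay G ω) (hdeg : EndVertexDegree G ω k) {A B : Set V} (hrel : Relevant G ω k A B) :
    ∃ f : Fin k → ℕ → V, (∀ i, InEnd G ω (f i)) ∧ DisjointRays f ∧ ∀ i, f i 0 ∈ A ∩ B := by
  obtain ⟨hsep, hord, -, -, hlies, hno⟩ := hrel
  obtain ⟨⟨f, hf, hdisj⟩, -⟩ := hdeg
  have hSfin : (A ∩ B).Finite := Set.finite_of_encard_eq_coe hord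
  choose M hM using fun i => hlies (f i) (hf i)
  set g : Fin k → ℕ → V := fun i n => f i (M i + n) with hgdef
  have hg : ∀ i, InEnd G ω (g i) := fun i => tail_inEnd (hf i) (M i)
  have hgB : ∀ i n, g i n ∈ B := fun i n => hM i _ (by omega)
  have hgi : Function.Injective (fun q : Fin k × ℕ => g q.1 q.2) := by
    rintro ⟨i, n⟩ ⟨j, m⟩ e
    have e' : f i (M i + n) = f j (M j + m) := e
    by_cases hij : i = j
    · subst hij
      have := (hf i).1.1 e'
      have : n = m := by omega
      rw [this]
    · exact (Set.disjoint_left.1 (hdisj hij) ⟨_, rfl⟩ ⟨_, e'.symm⟩).elim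
  obtain ⟨σ₀, hb⟩ := base_exists hgi
  obtain ⟨σ, hσ, hmax⟩ := exists_max hSfin _ σ₀ rfl
    (base_good (G := G) (B := B) hb hgi (fun i => (hg i).1) hgB)
  by_cases hne : A ∩ B ⊆ (Set.range σ)ᶜ
  · have hcard : Nonempty (Fin k ≃ (A ∩ B : Set V)) := by
      have h1 : (A ∩ B).ncard = k := by
        rw [Set.ncard_def]; unfold SepOrder at hord; rw [hord]; rfl
      haveI := hSfin.fintype
      rw [← Nat.card_coe_set_eq] at h1
      exact ⟨(Finite.equivFinOfCardEq h1).symm⟩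
    obtain ⟨e⟩ := hcard
    refine ⟨fun i n => σ^[n] (e i), fun i => hole_orbit hb hg hσ (hne (e i).2), ?_,
      fun i => (e i).2⟩
    intro i j hij
    rw [Set.disjoint_left]
    rintro x ⟨n, hn⟩ ⟨m, hm⟩
    have := (orbit_inj hσ.inj (hne (e i).2) (hne (e j).2) (hn.trans hm.symm)).2
    exact hij (e.injective (Subtype.ext this))
  · exact (hno (small_sep hray hb hg hgi hσ hsep hord hmax hne)).elim

theorem part_two {V : Type} {G : SimpleGraph V} {ω : ℕ → V} {k : ℕ} {A B : Set V}
    (f : Fin k → ℕ → V) (hf : ∀ i, InEnd G ω (f i)) (hd : DisjointRays f)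
    (h0 : ∀ i, f i 0 ∈ A ∩ B) :
    ¬ ∃ C D : Set V, IsSeparation G C D ∧ SepOrder C D < (k : ℕ∞) ∧ A ⊆ C ∧ LiesIn G ω D := by
  classical
  rintro ⟨C, D, hsep, hord, hAC, hl⟩
  have hex : ∀ i, ∃ n, f i n ∈ C ∩ D := by
    intro i
    have hD : ∃ n, f i n ∈ D := by
      obtain ⟨m, hm⟩ := hl _ (hf i)
      exact ⟨m, hm m le_rfl⟩
    have hs := Nat.find_spec hD
    have hmin := fun m => Nat.find_min hD (m := m)
    generalize Nat.find hD = n at hs hmin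
    cases n with
    | zero => exact ⟨0, hAC (h0 i).1, hs⟩
    | succ n =>
      refine ⟨n + 1, ?_, hs⟩
      by_contra hC
      have h1 := hmin n (Nat.lt_succ_self n)
      have h2 : f i n ∈ C := by
        have : f i n ∈ C ∪ D := hsep.1 ▸ mem_univ _
        exact this.resolve_right h1
      exact hsep.2 _ ⟨h2, h1⟩ _ ⟨hs, hC⟩ ((hf i).1.2 n)
  choose N hN using hex
  have hinj : Function.Injective (fun i => f i (N i)) := by
    intro i j e
    by_contra hij
    exact Set.disjoint_left.1 (hd hij) ⟨_, rfl⟩ ⟨_, e.symm⟩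
  have h1 : (Set.range (fun i => f i (N i))).encard = k := by
    rw [← Set.image_univ, hinj.encard_image]; simp
  have h2 : Set.range (fun i => f i (N i)) ⊆ C ∩ D := by
    rintro _ ⟨i, rfl⟩; exact hN i
  have h3 := Set.encard_le_encard h2
  rw [h1] at h3
  exact absurd hord (not_lt.2 h3)

/-- characterization of ω-relevant separations via `k` disjoint rays
starting in the separator. -/
theorem relevant_iff_disjoint_rays {V : Type} (G : SimpleGraph V) (ω : ℕ → V) (k : ℕ)
    (hray : IsRay G ω) (hdeg : EndVertexDegree G ω k) :
    (∀ A B : Set V, Relevant G ω k A B →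
      ∃ f : Fin k → ℕ → V, (∀ i, InEnd G ω (f i)) ∧ DisjointRays f ∧
        ∀ i, f i 0 ∈ A ∩ B) ∧
    (∀ A B : Set V, IsSeparation G A B → SepOrder A B = (k : ℕ∞) →
      ConnectedIn G (A \ B) →
      (∀ v ∈ A ∩ B, ∃ u ∈ A \ B, G.Adj v u) →
      LiesIn G ω B →
      (∃ f : Fin k → ℕ → V, (∀ i, InEnd G ω (f i)) ∧ DisjointRays f ∧
        ∀ i, f i 0 ∈ A ∩ B) →
      Relevant G ω k A B) := by
  refine ⟨fun A B hrel => part_one hray hdeg hrel, ?_⟩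
  rintro A B h1 h2 h3 h4 h5 ⟨f, hf, hd, h0⟩
  exact ⟨h1, h2, h3, h4, h5, part_two f hf hd h0⟩

end PaperEnds
end
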